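/- Let q ≥ 2 be an integer, f an M_q-function, and α an algebraic number with 0 < |α| < 1 which is not a pole of f and such that f(α) is algebraic. Then for every τ ∈ Gal(ℚ̄/ℚ) with |τ(α)| < 1, the M_q-function f^τ has no pole at τ(α) and f^τ(τ(α)) = τ(f(α)). -/

import Mathlib

noncomputable section

/-- The derivative `d/dz` of a formal power series over `ℂ`. -/
def psD (f : PowerSeries ℂ) : PowerSeries ℂ :=
  PowerSeries.mk fun n => ((n : ℂ) + 1) * PowerSeries.coeff (n + 1) f

/-- The Mahler operator `σ_q : f(z) ↦ f(z^q)` on formal power series over `ℂ`. -/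
def psSigma (q : ℕ) (f : PowerSeries ℂ) : PowerSeries ℂ :=
  PowerSeries.mk fun n => if q ∣ n then PowerSeries.coeff (n / q) f else 0

/-- The canonical embedding of polynomials into power series. -/
def polyPS : Polynomial ℂ →+* PowerSeries ℂ := Polynomial.coeToPowerSeries.ringHom

/-- The power series `∑ (a n / n!) zⁿ` attached to a sequence `a` of coefficients. -/
def ePS (a : ℕ → ℂ) : PowerSeries ℂ := PowerSeries.mk fun n => a n / (n.factorial : ℂ)

/-- `IsE a` : the power series `∑ (a n / n!) zⁿ` is an E-function: its coefficients are
algebraic, it satisfies a nonzero linear differential equation over `ℚ̄[z]`, and the size of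
the conjugates of the `a n` as well as their common denominators grow at most geometrically. -/
def IsE (a : ℕ → ℂ) : Prop :=
  (∀ n, IsAlgebraic ℚ (a n)) ∧
  (∃ (m : ℕ) (p : ℕ → Polynomial ℂ),
      (∀ i k, IsAlgebraic ℚ ((p i).coeff k)) ∧ (∃ i, i ≤ m ∧ p i ≠ 0) ∧
      ∑ i ∈ Finset.range (m + 1), polyPS (p i) * psD^[i] (ePS a) = 0) ∧
  (∃ C : ℝ, 0 < C ∧ ∃ d : ℕ → ℕ, ∀ n : ℕ, 1 ≤ n →
      1 ≤ d n ∧ (d n : ℝ) ≤ C ^ n ∧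
      (∀ σ : (integralClosure ℚ ℂ) →+* ℂ, ∀ h : a n ∈ integralClosure ℚ ℂ,
        ‖σ ⟨a n, h⟩‖ ≤ C ^ n) ∧
      (∀ i, 1 ≤ i → i ≤ n → IsIntegral ℤ ((d n : ℂ) * a i)))

/-- The value at `α` of the E-function with coefficient sequence `a`
(E-functions are entire, so this series converges for all `α`). -/
def evalE (a : ℕ → ℂ) (α : ℂ) : ℂ := ∑' n : ℕ, a n / (n.factorial : ℂ) * α ^ n

/-- `IsM q f` : the formal power series `f` is an M_q-function, i.e. it has algebraic
coefficients and satisfies a linear `σ_q`-difference equation over `ℚ̄[z]` with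
not-all-zero polynomial coefficients. -/
def IsM (q : ℕ) (f : PowerSeries ℂ) : Prop :=
  (∀ n, IsAlgebraic ℚ (PowerSeries.coeff n f)) ∧
  ∃ (m : ℕ) (p : ℕ → Polynomial ℂ),
    (∀ i k, IsAlgebraic ℚ ((p i).coeff k)) ∧ (∃ i, i ≤ m ∧ p i ≠ 0) ∧
    ∑ i ∈ Finset.range (m + 1), polyPS (p i) * (psSigma q)^[i] f = 0

/-- `MahlerValue f α v` : the meromorphic extension of (the sum of) the power series `f`
to the open unit disk has no pole at `α` and takes the value `v` there. -/
def MahlerValue (f : PowerSeries ℂ) (α v : ℂ) : Prop :=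
  ∃ F : ℂ → ℂ, MeromorphicOn F (Metric.ball (0 : ℂ) 1) ∧
    (∀ᶠ z in nhds (0 : ℂ), HasSum (fun n => PowerSeries.coeff n f * z ^ n) (F z)) ∧
    AnalyticAt ℂ F α ∧ F α = v

/-- The power series `f` converges (hence defines an analytic function) on the open
disk `D(0,R)`. -/
def AnOnBall (f : PowerSeries ℂ) (R : ℝ) : Prop :=
  ∀ z : ℂ, ‖z‖ < R → Summable fun n => PowerSeries.coeff n f * z ^ n

/-- The value at `z` of (the sum of) the power series `f`. -/
def psEval (f : PowerSeries ℂ) (z : ℂ) : ℂ := ∑' n : ℕ, PowerSeries.coeff n f * z ^ n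

/-- `Banal fv α P` : the homogeneous algebraic relation `P` among the values at `α` of the
power series `fv 1, …, fv r` is banal: it is the specialization at `z = α` of some
`Q ∈ ℚ̄[z, X₁, …, X_r]`, homogeneous in `X₁, …, X_r`, with `Q(z, fv 1, …, fv r) = 0`. -/
def Banal {r : ℕ} (fv : Fin r → PowerSeries ℂ) (α : ℂ) (P : MvPolynomial (Fin r) ℂ) : Prop :=
  ∃ Q : MvPolynomial (Fin r) (Polynomial ℂ),
    (∀ v k, IsAlgebraic ℚ ((MvPolynomial.coeff v Q).coeff k)) ∧
    (∃ e, Q.IsHomogeneous e) ∧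
    MvPolynomial.eval₂ polyPS fv Q = 0 ∧
    MvPolynomial.map (Polynomial.evalRingHom α) Q = P

/-- `Eset S` : the set of values at `z = 1` of all E-functions with coefficients in `S`. -/
def Eset (S : Set ℂ) : Set ℂ :=
  {x | ∃ a : ℕ → ℂ, IsE a ∧ (∀ n, a n ∈ S) ∧ x = evalE a 1}

/-- `Mset q α S` : the set of values at `α` of all M_q-functions with coefficients in `S`
having no pole at `α`. -/
def Mset (q : ℕ) (α : ℂ) (S : Set ℂ) : Set ℂ :=
  {x | ∃ f : PowerSeries ℂ, IsM q f ∧ (∀ n, PowerSeries.coeff n f ∈ S) ∧ MahlerValue f α x}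

open scoped Classical

/-- The action of an automorphism `τ` of `ℚ̄` on `ℂ`, extended by `0` off the algebraic
numbers (we only ever apply it to algebraic numbers). -/
def galMap (τ : algebraicClosure ℚ ℂ ≃+* algebraicClosure ℚ ℂ) (x : ℂ) : ℂ :=
  if h : x ∈ algebraicClosure ℚ ℂ then (τ ⟨x, h⟩ : ℂ) else 0

set_option linter.unusedSectionVars false

section Sections

variable {F : Type*} [Field F]

/-- The section operator `∑ aₙ zⁿ ↦ ∑ a_{Qn+i} zⁿ`. -/
def psSection (Q i : ℕ) (u : PowerSeries F) : PowerSeries F :=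
  PowerSeries.mk fun n => PowerSeries.coeff (Q * n + i) u

lemma coeff_psSection (Q i n : ℕ) (u : PowerSeries F) :
    PowerSeries.coeff n (psSection Q i u) = PowerSeries.coeff (Q * n + i) u := by
  simp [psSection]

lemma psSection_add (Q i : ℕ) (u v : PowerSeries F) :
    psSection Q i (u + v) = psSection Q i u + psSection Q i v := by
  ext n; simp [psSection]

lemma psSection_zero (Q i : ℕ) : psSection Q i (0 : PowerSeries F) = 0 := by
  ext n; simp [psSection]

lemma psSection_sum {ι : Type*} (Q i : ℕ) (s : Finset ι) (u : ι → PowerSeries F) :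
    psSection Q i (∑ j ∈ s, u j) = ∑ j ∈ s, psSection Q i (u j) := by
  ext n; simp [psSection]

lemma psSection_mul_expand {Q i : ℕ} (hQ : Q ≠ 0) (hi : i < Q) (u v : PowerSeries F) :
    psSection Q i (u * PowerSeries.expand Q hQ v) = psSection Q i u * v := by
  ext n
  rw [coeff_psSection, PowerSeries.coeff_mul, PowerSeries.coeff_mul]
  symm
  refine Finset.sum_of_injOn (fun ab => (Q * ab.1 + i, Q * ab.2)) ?_ ?_ ?_ ?_
  · rintro ⟨a, b⟩ - ⟨a', b'⟩ - h
    simp only [Prod.mk.injEq, Nat.add_right_cancel_iff] at h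
    exact Prod.ext (Nat.eq_of_mul_eq_mul_left (Nat.pos_of_ne_zero hQ) h.1)
      (Nat.eq_of_mul_eq_mul_left (Nat.pos_of_ne_zero hQ) h.2)
  · rintro ⟨a, b⟩ h
    have h' : a + b = n := Finset.HasAntidiagonal.mem_antidiagonal.mp h
    refine Finset.mem_coe.2 (Finset.HasAntidiagonal.mem_antidiagonal.mpr ?_)
    rw [← h']; ring
  · rintro ⟨a, b⟩ h h'
    replace h : a + b = Q * n + i := Finset.HasAntidiagonal.mem_antidiagonal.mp h
    by_cases hb : Q ∣ b
    · exfalso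
      apply h'
      obtain ⟨c, rfl⟩ := hb
      have hcn : c ≤ n := by
        by_contra hc
        have : Q * (n + 1) ≤ Q * c := Nat.mul_le_mul_left _ (by omega)
        rw [mul_add] at this
        omega
      refine ⟨(n - c, c), ?_, ?_⟩
      · exact Finset.mem_coe.2 (Finset.HasAntidiagonal.mem_antidiagonal.mpr (by omega))
      · simp only [Prod.mk.injEq, and_true]
        obtain ⟨m, rfl⟩ := Nat.exists_eq_add_of_le hcn
        rw [mul_add] at h
        simp only [add_tsub_cancel_left]
        omega
    · rw [PowerSeries.coeff_expand_of_not_dvd _ _ _ hb, mul_zero]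
  · rintro ⟨a, b⟩ h
    simp only [coeff_psSection, PowerSeries.coeff_expand_mul]

lemma psSection_expand_mul {Q i : ℕ} (hQ : Q ≠ 0) (hi : i < Q) (u v : PowerSeries F) :
    psSection Q i (PowerSeries.expand Q hQ v * u) = v * psSection Q i u := by
  rw [mul_comm, psSection_mul_expand hQ hi, mul_comm]

lemma eq_zero_of_psSection_eq_zero {Q : ℕ} (hQ : Q ≠ 0) {u : PowerSeries F}
    (h : ∀ i < Q, psSection Q i u = 0) : u = 0 := by
  ext n
  have := congrArg (PowerSeries.coeff (n / Q)) (h (n % Q) (Nat.mod_lt _ (Nat.pos_of_ne_zero hQ)))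
  rwa [coeff_psSection, Nat.div_add_mod] at this

lemma exists_polynomial_psSection {Q : ℕ} (hQ : Q ≠ 0) (i : ℕ) (p : Polynomial F) :
    ∃ p' : Polynomial F, psSection Q i (p : PowerSeries F) = (p' : PowerSeries F) := by
  refine ⟨∑ k ∈ Finset.range (p.natDegree + 1), Polynomial.monomial k (p.coeff (Q * k + i)), ?_⟩
  ext n
  simp only [coeff_psSection, Polynomial.coeff_coe, Polynomial.finsetSum_coeff,
    Polynomial.coeff_monomial, Finset.sum_ite_eq', Finset.mem_range]
  split_ifs with h
  · rfl
  · apply Polynomial.coeff_eq_zero_of_natDegree_lt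
    have : n ≤ Q * n := Nat.le_mul_of_pos_left _ (Nat.pos_of_ne_zero hQ)
    omega

lemma coe_polynomial_expand {Q : ℕ} (hQ : Q ≠ 0) (p : Polynomial F) :
    ((Polynomial.expand F Q p : Polynomial F) : PowerSeries F) =
      PowerSeries.expand Q hQ (p : PowerSeries F) := by
  ext n
  rw [Polynomial.coeff_coe, Polynomial.coeff_expand (Nat.pos_of_ne_zero hQ),
    PowerSeries.coeff_expand]
  simp

lemma expand_ps_injective {Q : ℕ} (hQ : Q ≠ 0) :
    Function.Injective (PowerSeries.expand Q hQ : PowerSeries F →ₐ[F] PowerSeries F) := by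
  intro u v h
  ext n
  have := congrArg (PowerSeries.coeff (Q * n)) h
  simpa [PowerSeries.coeff_expand_mul] using this

lemma polynomial_smul_eq_coe_mul (p : Polynomial F) (u : PowerSeries F) :
    p • u = (p : PowerSeries F) * u := by
  rw [Algebra.smul_def]; rfl

lemma linearIndependent_expand {Q : ℕ} (hQ : Q ≠ 0) {ι : Type*} {y : ι → PowerSeries F}
    (hy : LinearIndependent (Polynomial F) y) :
    LinearIndependent (Polynomial F) fun j => PowerSeries.expand Q hQ (y j) := by
  rw [linearIndependent_iff'] at hy ⊢
  intro s g hg j hj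
  suffices ((g j : Polynomial F) : PowerSeries F) = 0 by exact_mod_cast this
  apply eq_zero_of_psSection_eq_zero hQ
  intro i hi
  choose p' hp' using fun j => exists_polynomial_psSection hQ i (g j)
  have h1 : ∑ j ∈ s, p' j • y j = 0 := by
    have := congrArg (psSection Q i) hg
    rw [psSection_sum, psSection_zero] at this
    simpa only [polynomial_smul_eq_coe_mul, psSection_mul_expand hQ hi, hp'] using this
  rw [hp', hy s p' h1 j hj]; simp

end Sections

section DegreeBound

variable (F : Type*) [Field F] {L : Type*} [Field L] [Algebra (RatFunc F) L]
  [Algebra (Polynomial F) L] [IsScalarTower (Polynomial F) (RatFunc F) L]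

/-- The structure map of the valuation ring at infinity of `F(X)` into an extension field. -/
def inftyRingHom (L : Type*) [Field L] [Algebra (RatFunc F) L] :
    (RatFunc.inftyValuation F).valuationSubring →+* L :=
  (algebraMap (RatFunc F) L).comp (RatFunc.inftyValuation F).valuationSubring.subtype

variable {F}

lemma inftyValuation_div_X_pow_le_one {p : Polynomial F} {D : ℕ} (h : p.natDegree ≤ D) :
    RatFunc.inftyValuation F (algebraMap _ (RatFunc F) p * ((RatFunc.X : RatFunc F) ^ D)⁻¹) ≤ 1 := by
  rcases eq_or_ne p 0 with rfl | hp
  · simp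
  · rw [map_mul, map_inv₀, map_pow, RatFunc.inftyValuation.X, RatFunc.inftyValuation_apply,
      RatFunc.inftyValuation.polynomial _ hp,
      ← WithZero.exp_nsmul, ← WithZero.exp_neg, ← WithZero.exp_add, ← WithZero.exp_zero,
      WithZero.exp_le_exp]
    simp; omega

lemma natDegree_le_of_inftyValuation {p : Polynomial F} {D : ℕ}
    (h : RatFunc.inftyValuation F (algebraMap _ (RatFunc F) p * ((RatFunc.X : RatFunc F) ^ D)⁻¹) ≤ 1) :
    p.natDegree ≤ D := by
  rcases eq_or_ne p 0 with rfl | hp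
  · simp
  · rw [map_mul, map_inv₀, map_pow, RatFunc.inftyValuation.X, RatFunc.inftyValuation_apply,
      RatFunc.inftyValuation.polynomial _ hp,
      ← WithZero.exp_nsmul, ← WithZero.exp_neg, ← WithZero.exp_add, ← WithZero.exp_zero,
      WithZero.exp_le_exp] at h
    simp at h; omega

/-- `u` is integral over `F[X]` and has poles of order at most `D` at infinity. -/
def IsDegreeBounded (F : Type*) [Field F] {L : Type*} [Field L] [Algebra (RatFunc F) L]
    [Algebra (Polynomial F) L] (D : ℕ) (u : L) : Prop :=
  IsIntegral (Polynomial F) u ∧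
    (inftyRingHom F L).IsIntegralElem ((algebraMap (RatFunc F) L (RatFunc.X ^ D))⁻¹ * u)

lemma minpoly_scaleRoots {k L : Type*} [Field k] [Field L] [Algebra k L] {u : L}
    (hu : IsIntegral k u) {a : k} (ha : a ≠ 0) :
    minpoly k (algebraMap k L a * u) = (minpoly k u).scaleRoots a := by
  symm
  refine minpoly.unique _ _ ?_ ?_ ?_
  · exact (Polynomial.monic_scaleRoots_iff _).2 (minpoly.monic hu)
  · exact Polynomial.scaleRoots_aeval_eq_zero (minpoly.aeval k u)
  · intro r hr h0
    rw [Polynomial.degree_scaleRoots]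
    have h1 := Polynomial.scaleRoots_aeval_eq_zero (r := a⁻¹) h0
    rw [← mul_assoc, ← map_mul, inv_mul_cancel₀ ha, map_one, one_mul] at h1
    rw [← Polynomial.degree_scaleRoots r (s := a⁻¹)]
    exact minpoly.min k u ((Polynomial.monic_scaleRoots_iff _).2 hr) h1

lemma IsDegreeBounded.minpoly_coeff {D : ℕ} {u : L} (h : IsDegreeBounded F D u) (j : ℕ) :
    ∃ p : Polynomial F, algebraMap _ (RatFunc F) p = (minpoly (RatFunc F) u).coeff j ∧
      p.natDegree ≤ D * (minpoly (RatFunc F) u).natDegree := by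
  obtain ⟨h1, h2⟩ := h
  have hk : IsIntegral (RatFunc F) u := h1.tower_top
  have e1 := minpoly.isIntegrallyClosed_eq_field_fractions' (RatFunc F) h1
  refine ⟨(minpoly (Polynomial F) u).coeff j, by rw [e1, Polynomial.coeff_map], ?_⟩
  let _ : Algebra (RatFunc.inftyValuation F).valuationSubring L := (inftyRingHom F L).toAlgebra
  have : IsScalarTower (RatFunc.inftyValuation F).valuationSubring (RatFunc F) L :=
    IsScalarTower.of_algebraMap_eq fun _ => rfl
  have hX : ((RatFunc.X : RatFunc F) ^ D)⁻¹ ≠ 0 := inv_ne_zero (pow_ne_zero _ RatFunc.X_ne_zero)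
  have h2' : IsIntegral (RatFunc.inftyValuation F).valuationSubring
      (algebraMap (RatFunc F) L ((RatFunc.X ^ D)⁻¹) * u) := by
    rw [map_inv₀]; exact h2
  have e2 := minpoly.isIntegrallyClosed_eq_field_fractions' (RatFunc F) h2'
  rw [minpoly_scaleRoots hk hX] at e2
  have e3 := congrArg (fun p => Polynomial.coeff p j) e2
  simp only [Polynomial.coeff_scaleRoots, Polynomial.coeff_map] at e3
  have e4 : (minpoly (RatFunc F) u).coeff j =
    algebraMap _ (RatFunc F) ((minpoly (Polynomial F) u).coeff j) := by rw [e1, Polynomial.coeff_map]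
  rw [e4, inv_pow, ← pow_mul] at e3
  have e5 : RatFunc.inftyValuation F (algebraMap _ (RatFunc F)
      ((minpoly (Polynomial F) u).coeff j) * ((RatFunc.X : RatFunc F) ^
        (D * ((minpoly (RatFunc F) u).natDegree - j)))⁻¹) ≤ 1 := by
    rw [e3]
    exact ((minpoly (RatFunc.inftyValuation F).valuationSubring
      (algebraMap (RatFunc F) L ((RatFunc.X ^ D)⁻¹) * u)).coeff j).2
  exact (natDegree_le_of_inftyValuation e5).trans (Nat.mul_le_mul_left _ (Nat.sub_le _ _))

lemma IsDegreeBounded.add {D : ℕ} {u v : L} (hu : IsDegreeBounded F D u)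
    (hv : IsDegreeBounded F D v) : IsDegreeBounded F D (u + v) := by
  refine ⟨hu.1.add hv.1, ?_⟩
  rw [mul_add]
  exact RingHom.IsIntegralElem.add _ hu.2 hv.2

lemma IsDegreeBounded.zero {D : ℕ} : IsDegreeBounded F D (0 : L) := by
  refine ⟨isIntegral_zero, ?_⟩
  rw [mul_zero]
  exact RingHom.isIntegralElem_zero _

lemma IsDegreeBounded.sum {D : ℕ} {ι : Type*} {s : Finset ι} {u : ι → L}
    (hu : ∀ i ∈ s, IsDegreeBounded F D (u i)) : IsDegreeBounded F D (∑ i ∈ s, u i) := by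
  induction s using Finset.induction_on with
  | empty => simpa using IsDegreeBounded.zero
  | insert a s ha ih =>
    rw [Finset.sum_insert ha]
    exact (hu a (by simp)).add (ih fun i hi => hu i (by simp [hi]))

lemma IsDegreeBounded.const_mul {D : ℕ} {u : L} (hu : IsDegreeBounded F D u) (c : F) :
    IsDegreeBounded F D (algebraMap (Polynomial F) L (Polynomial.C c) * u) := by
  refine ⟨isIntegral_algebraMap.mul hu.1, ?_⟩
  rw [mul_left_comm]
  refine RingHom.IsIntegralElem.mul _ ?_ hu.2
  have : RatFunc.inftyValuation F (algebraMap _ (RatFunc F) (Polynomial.C c)) ≤ 1 := by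
    simpa using inftyValuation_div_X_pow_le_one (p := Polynomial.C c) (D := 0) (by simp)
  have h2 := (inftyRingHom F L).isIntegralElem_map (x := ⟨_, this⟩)
  rwa [show (inftyRingHom F L) ⟨_, this⟩ = algebraMap (Polynomial F) L (Polynomial.C c) from
    (IsScalarTower.algebraMap_apply (Polynomial F) (RatFunc F) L _).symm] at h2

lemma isDegreeBounded_of_monic {P : Polynomial (Polynomial F)} (hP : P.Monic) {D : ℕ}
    (hD : ∀ j, (P.coeff j).natDegree ≤ D) {u : L} (hu : Polynomial.aeval u P = 0) :
    IsDegreeBounded F D u := by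
  refine ⟨⟨P, hP, hu⟩, ?_⟩
  have hX0 : (algebraMap (RatFunc F) L (RatFunc.X ^ D))⁻¹ =
    algebraMap (RatFunc F) L ((RatFunc.X ^ D)⁻¹) := (map_inv₀ _ _).symm
  have hX : ((RatFunc.X : RatFunc F) ^ D)⁻¹ ≠ 0 := inv_ne_zero (pow_ne_zero _ RatFunc.X_ne_zero)
  set P' : Polynomial (RatFunc F) := (P.map (algebraMap (Polynomial F) (RatFunc F))).scaleRoots
    ((RatFunc.X ^ D)⁻¹) with hP'
  have hP'0 : Polynomial.aeval (algebraMap (RatFunc F) L ((RatFunc.X ^ D)⁻¹) * u) P' = 0 := by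
    apply Polynomial.scaleRoots_aeval_eq_zero
    rwa [Polynomial.aeval_map_algebraMap]
  have hm : P'.Monic := (Polynomial.monic_scaleRoots_iff _).2 (hP.map _)
  have hcoeff : ∀ j, P'.coeff j ∈ (RatFunc.inftyValuation F).valuationSubring := by
    intro j
    rw [hP', Polynomial.coeff_scaleRoots, Polynomial.coeff_map, hP.natDegree_map]
    rcases lt_trichotomy j P.natDegree with h | h | h
    · rw [inv_pow, ← pow_mul]
      apply inftyValuation_div_X_pow_le_one
      exact (hD j).trans (Nat.le_mul_of_pos_right _ (by omega))
    · subst h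
      rw [hP.coeff_natDegree]; simp
    · rw [Polynomial.coeff_eq_zero_of_natDegree_lt h]; simp
  obtain ⟨R, hR, hRd, hRm⟩ := Polynomial.lifts_and_natDegree_eq_and_monic
    (f := (RatFunc.inftyValuation F).valuationSubring.subtype)
    (p := P') ((Polynomial.lifts_iff_coeff_lifts _).2 fun j => ⟨⟨_, hcoeff j⟩, rfl⟩) hm
  refine ⟨R, hRm, ?_⟩
  rw [inftyRingHom, ← Polynomial.eval₂_map, hR, hX0]
  exact hP'0

end DegreeBound

section EulerOperator

variable {F : Type*} [Field F]

/-- The Euler derivation `z d/dz` on power series. -/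
def eulerDerivation (F : Type*) [Field F] : Derivation F (PowerSeries F) (PowerSeries F) :=
  (PowerSeries.X : PowerSeries F) • PowerSeries.derivative F

lemma coeff_eulerDerivation (e : PowerSeries F) (n : ℕ) :
    PowerSeries.coeff n (eulerDerivation F e) = (n : F) * PowerSeries.coeff n e := by
  rw [eulerDerivation, Derivation.smul_apply, smul_eq_mul]
  cases n with
  | zero => simp
  | succ n =>
    rw [mul_comm, PowerSeries.coeff_succ_mul_X, PowerSeries.coeff_derivative, mul_comm]
    push_cast
    rfl

lemma coeff_iterate_eulerDerivation (e : PowerSeries F) (n l : ℕ) :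
    PowerSeries.coeff n ((eulerDerivation F)^[l] e) = (n : F) ^ l * PowerSeries.coeff n e := by
  induction l with
  | zero => simp
  | succ l ih => rw [Function.iterate_succ_apply', coeff_eulerDerivation, ih, pow_succ]; ring

lemma coeff_coe_mul_of_natDegree_le {p : Polynomial F} {r n : ℕ} (hp : p.natDegree ≤ r)
    (hn : r ≤ n) (u : PowerSeries F) :
    PowerSeries.coeff n ((p : PowerSeries F) * u) =
      ∑ s ∈ Finset.range (r + 1), p.coeff s * PowerSeries.coeff (n - s) u := by
  rw [PowerSeries.coeff_mul, Finset.Nat.sum_antidiagonal_eq_sum_range_succ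
    (fun a b => PowerSeries.coeff a (p : PowerSeries F) * PowerSeries.coeff b u)]
  symm
  apply Finset.sum_subset_zero_on_sdiff
  · intro s hs; simp only [Finset.mem_range] at hs ⊢; omega
  · intro s hs
    simp only [Finset.mem_sdiff, Finset.mem_range] at hs
    rw [Polynomial.coeff_coe, Polynomial.coeff_eq_zero_of_natDegree_lt (by omega), zero_mul]
  · intro s hs; simp

lemma exists_forall_eval_natCast_ne_zero [CharZero F] {R : Polynomial F} (hR : R ≠ 0) :
    ∃ N : ℕ, ∀ n ≥ N, R.eval (n : F) ≠ 0 := by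
  have hfin : {n : ℕ | R.eval (n : F) = 0}.Finite := by
    have h1 : (R.rootSet F).Finite := R.rootSet_finite F
    refine (h1.preimage (f := fun n : ℕ => (n : F)) (Nat.cast_injective.injOn)).subset ?_
    intro n hn
    simp only [Set.mem_preimage, Polynomial.mem_rootSet]
    exact ⟨hR, by simpa using hn⟩
  obtain ⟨N, hN⟩ := hfin.bddAbove
  refine ⟨N + 1, fun n hn h0 => ?_⟩
  have := hN (show n ∈ {n : ℕ | R.eval (n : F) = 0} from h0)
  omega

/-- A power series satisfying a linear differential equation with polynomial coefficients and
having arbitrarily long gaps is a polynomial. -/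
lemma exists_polynomial_of_ode_of_gaps [CharZero F] {e : PowerSeries F} {m : ℕ}
    {P : ℕ → Polynomial F} (hP : ∃ l ≤ m, P l ≠ 0)
    (hode : ∑ l ∈ Finset.range (m + 1), (P l : PowerSeries F) * (eulerDerivation F)^[l] e = 0)
    (hgap : ∀ r N : ℕ, ∃ M ≥ N, ∀ i ≤ r, PowerSeries.coeff (M + i) e = 0) :
    ∃ p : Polynomial F, e = (p : PowerSeries F) := by
  set r := (Finset.range (m + 1)).sup fun l => (P l).natDegree with hr
  have hdeg : ∀ l ∈ Finset.range (m + 1), (P l).natDegree ≤ r := fun l hl =>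
    Finset.le_sup (f := fun l => (P l).natDegree) hl
  set R : ℕ → Polynomial F := fun s =>
    ∑ l ∈ Finset.range (m + 1), Polynomial.C ((P l).coeff s) * Polynomial.X ^ l with hRdef
  have hrec : ∀ n ≥ r, ∑ s ∈ Finset.range (r + 1),
      (R s).eval ((n - s : ℕ) : F) * PowerSeries.coeff (n - s) e = 0 := by
    intro n hn
    have h1 := congrArg (PowerSeries.coeff n) hode
    rw [map_sum, map_zero] at h1
    rw [← h1, Finset.sum_congr rfl fun l hl =>
      coeff_coe_mul_of_natDegree_le (hdeg l hl) hn _, Finset.sum_comm]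
    refine Finset.sum_congr rfl fun s _ => ?_
    simp only [hRdef, Polynomial.eval_finsetSum, Polynomial.eval_mul, Polynomial.eval_C,
      Polynomial.eval_pow, Polynomial.eval_X, Finset.sum_mul, coeff_iterate_eulerDerivation]
    exact Finset.sum_congr rfl fun l _ => by ring
  have hRne : ∃ s, R s ≠ 0 := by
    obtain ⟨l, hl, hl0⟩ := hP
    by_contra! hall
    apply hl0
    ext s
    have h2 := congrArg (fun p => Polynomial.coeff p l) (hall s)
    simp only [hRdef, Polynomial.finsetSum_coeff, Polynomial.coeff_C_mul, Polynomial.coeff_X_pow,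
      Polynomial.coeff_zero, mul_ite, mul_one, mul_zero, Finset.sum_ite_eq, Finset.mem_range] at h2
    rw [if_pos (by omega)] at h2
    simpa using h2
  set s₀ := Nat.find hRne
  have hs₀ : R s₀ ≠ 0 := Nat.find_spec hRne
  have hlt : ∀ s < s₀, R s = 0 := fun s hs => by simpa using Nat.find_min hRne hs
  have hs₀r : s₀ ≤ r := by
    by_contra! hgt
    apply hs₀
    simp only [hRdef]
    refine Finset.sum_eq_zero fun l hl => ?_
    rw [Polynomial.coeff_eq_zero_of_natDegree_lt ((hdeg l hl).trans_lt hgt)]; simp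
  obtain ⟨N₀, hN₀⟩ := exists_forall_eval_natCast_ne_zero hs₀
  obtain ⟨M, hM, hMgap⟩ := hgap r (N₀ + r)
  have hzero : ∀ j, PowerSeries.coeff (M + j) e = 0 := by
    intro j
    induction j using Nat.strong_induction_on with
    | _ j ih =>
      by_cases hj : j ≤ r
      · exact hMgap j hj
      · have h1 := hrec (M + j + s₀) (by omega)
        rw [Finset.sum_eq_single s₀] at h1
        · rw [Nat.add_sub_cancel] at h1
          exact (mul_eq_zero.1 h1).resolve_left (hN₀ _ (by omega))
        · intro s hs hne
          rw [Finset.mem_range] at hs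
          rcases lt_or_gt_of_ne hne with h | h
          · rw [hlt s h]; simp
          · rw [show M + j + s₀ - s = M + (j + s₀ - s) by omega, ih _ (by omega), mul_zero]
        · intro h; simp at h; omega
  refine ⟨PowerSeries.trunc M e, ?_⟩
  ext n
  rw [Polynomial.coeff_coe, PowerSeries.coeff_trunc]
  split_ifs with h
  · rfl
  · rw [← hzero (n - M), Nat.add_sub_cancel' (by omega)]

end EulerOperator

section RootsOfUnity

lemma exists_eq_C_of_aeval_eq_zero {p : Polynomial ℂ} (hp : p ≠ 0) {u : PowerSeries ℂ}
    (h : Polynomial.aeval u p = 0) : ∃ a : ℂ, u = PowerSeries.C a := by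
  rw [(IsAlgClosed.splits p).eq_prod_roots] at h
  rw [map_mul, Polynomial.aeval_C, mul_eq_zero] at h
  rcases h with h | h
  · exfalso
    rw [FaithfulSMul.algebraMap_eq_zero_iff] at h
    exact hp (Polynomial.leadingCoeff_eq_zero.1 h)
  · rw [map_multiset_prod, Multiset.map_map, Multiset.prod_eq_zero_iff, Multiset.mem_map] at h
    obtain ⟨a, -, ha⟩ := h
    refine ⟨a, ?_⟩
    simpa [sub_eq_zero] using ha

lemma X_pow_mul_expand_psSection {Q i : ℕ} (hQ : Q ≠ 0) (hi : i < Q) {ζ : ℂ}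
    (hζ : IsPrimitiveRoot ζ Q) (e : PowerSeries ℂ) :
    PowerSeries.X ^ i * PowerSeries.expand Q hQ (psSection Q i e) =
      ∑ t ∈ Finset.range Q, PowerSeries.C ((Q : ℂ)⁻¹ * (ζ ^ (t * i))⁻¹) *
        PowerSeries.rescale (ζ ^ t) e := by
  have hQ' : (Q : ℂ) ≠ 0 := by exact_mod_cast hQ
  have hζ0 : ζ ≠ 0 := hζ.ne_zero hQ
  ext n
  rw [map_sum]
  simp only [PowerSeries.coeff_C_mul, PowerSeries.coeff_rescale, PowerSeries.coeff_X_pow_mul']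
  have hsum : ∑ t ∈ Finset.range Q, (Q : ℂ)⁻¹ * (ζ ^ (t * i))⁻¹ *
      ((ζ ^ t) ^ n * PowerSeries.coeff n e) =
      (Q : ℂ)⁻¹ * (∑ t ∈ Finset.range Q, (ζ ^ n * (ζ ^ i)⁻¹) ^ t) * PowerSeries.coeff n e := by
    rw [Finset.mul_sum, Finset.sum_mul]
    refine Finset.sum_congr rfl fun t _ => ?_
    rw [mul_pow, inv_pow, ← pow_mul, ← pow_mul, ← pow_mul, mul_comm i t, mul_comm n t]
    ring
  rw [hsum]
  by_cases h1 : ζ ^ n = ζ ^ i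
  · rw [h1, mul_inv_cancel₀ (pow_ne_zero _ hζ0)]
    have hmod' : n % Q = i := by
      refine hζ.pow_inj (Nat.mod_lt _ (Nat.pos_of_ne_zero hQ)) hi ?_
      rw [← h1]
      conv_rhs => rw [← Nat.div_add_mod n Q, pow_add, pow_mul, hζ.pow_eq_one, one_pow, one_mul]
    have hn : n = Q * (n / Q) + i := by rw [← hmod', Nat.div_add_mod]
    rw [if_pos (by rw [hn]; omega), show n - i = Q * (n / Q) by omega,
      PowerSeries.coeff_expand_mul, coeff_psSection, ← hn]
    simp [hQ']
  · have hne : ζ ^ n * (ζ ^ i)⁻¹ ≠ 1 := fun h => h1 (by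
      rwa [mul_inv_eq_one₀ (pow_ne_zero _ hζ0)] at h)
    have hz : ∑ t ∈ Finset.range Q, (ζ ^ n * (ζ ^ i)⁻¹) ^ t = 0 := by
      have := geom_sum_mul (ζ ^ n * (ζ ^ i)⁻¹) Q
      rw [mul_pow, inv_pow, ← pow_mul, ← pow_mul, mul_comm n, mul_comm i, pow_mul, pow_mul,
        hζ.pow_eq_one] at this
      simp only [one_pow, inv_one, mul_one, sub_self] at this
      exact (mul_eq_zero.1 this).resolve_right (sub_ne_zero.2 hne)
    rw [hz, mul_zero, zero_mul]
    split_ifs with hin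
    · apply PowerSeries.coeff_expand_of_not_dvd
      rintro ⟨c, hc⟩
      apply h1
      rw [show n = Q * c + i by omega, pow_add, pow_mul, hζ.pow_eq_one, one_pow, one_mul]
    · rfl

lemma rescale_coe_polynomial {F : Type*} [Field F] (ω : F) (p : Polynomial F) :
    PowerSeries.rescale ω (p : PowerSeries F) =
      ((p.comp (Polynomial.C ω * Polynomial.X) : Polynomial F) : PowerSeries F) := by
  ext n
  rw [PowerSeries.coeff_rescale, Polynomial.coeff_coe, Polynomial.coeff_coe,
    Polynomial.comp_C_mul_X_coeff, mul_comm]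

end RootsOfUnity

section AlgebraicMahler

variable {L : Type*} [Field L] [Algebra (PowerSeries ℂ) L] [IsFractionRing (PowerSeries ℂ) L]
  [Algebra (Polynomial ℂ) L] [IsScalarTower (Polynomial ℂ) (PowerSeries ℂ) L]
  [Algebra (RatFunc ℂ) L] [IsScalarTower (Polynomial ℂ) (RatFunc ℂ) L]

lemma algebraMap_coe_polynomial (p : Polynomial ℂ) :
    algebraMap (PowerSeries ℂ) L (p : PowerSeries ℂ) = algebraMap (Polynomial ℂ) L p :=
  (IsScalarTower.algebraMap_apply (Polynomial ℂ) (PowerSeries ℂ) L p).symm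

lemma linearIndependent_powerSeries_iff {ι : Type*} {y : ι → PowerSeries ℂ} :
    LinearIndependent (Polynomial ℂ) y ↔
      LinearIndependent (RatFunc ℂ) fun i => algebraMap (PowerSeries ℂ) L (y i) := by
  rw [← LinearIndependent.iff_fractionRing (Polynomial ℂ) (RatFunc ℂ)]
  have hinj : Function.Injective (IsScalarTower.toAlgHom (Polynomial ℂ) (PowerSeries ℂ) L) :=
    IsFractionRing.injective (PowerSeries ℂ) L
  exact (LinearMap.linearIndependent_iff_of_injOn
    (IsScalarTower.toAlgHom (Polynomial ℂ) (PowerSeries ℂ) L).toLinearMap hinj.injOn).symm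

lemma algebraMap_polynomial_mem (E : IntermediateField (RatFunc ℂ) L) (p : Polynomial ℂ) :
    algebraMap (Polynomial ℂ) L p ∈ E := by
  rw [IsScalarTower.algebraMap_apply (Polynomial ℂ) (RatFunc ℂ) L]
  exact E.algebraMap_mem _

lemma algebraMap_polynomial_ne_zero {p : Polynomial ℂ} (hp : p ≠ 0) :
    algebraMap (Polynomial ℂ) L p ≠ 0 := by
  rw [IsScalarTower.algebraMap_apply (Polynomial ℂ) (RatFunc ℂ) L]
  simpa using hp

lemma not_linearIndependent_of_mem (E : IntermediateField (RatFunc ℂ) L)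
    [FiniteDimensional (RatFunc ℂ) E] {n : ℕ} {y : Fin n → PowerSeries ℂ}
    (hy : ∀ i, algebraMap (PowerSeries ℂ) L (y i) ∈ E) (hn : Module.finrank (RatFunc ℂ) E < n) :
    ¬ LinearIndependent (Polynomial ℂ) y := by
  intro h
  rw [linearIndependent_powerSeries_iff (L := L)] at h
  have h2 : LinearIndependent (RatFunc ℂ)
      fun i => (⟨algebraMap (PowerSeries ℂ) L (y i), hy i⟩ : E) :=
    LinearIndependent.of_comp E.val.toLinearMap h
  have := h2.fintype_card_le_finrank
  simp at this
  omega

lemma exists_integral_powerSeries_multiple {x : L} (hx : IsAlgebraic (RatFunc ℂ) x) :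
    ∃ D : Polynomial ℂ, D ≠ 0 ∧ ∃ e : PowerSeries ℂ, IsIntegral (Polynomial ℂ) e ∧
      algebraMap (Polynomial ℂ) L D * x = algebraMap (PowerSeries ℂ) L e := by
  have hx' : IsAlgebraic (Polynomial ℂ) x :=
    (IsFractionRing.isAlgebraic_iff (Polynomial ℂ) (RatFunc ℂ) L).2 hx
  obtain ⟨D, hD, hDint⟩ := hx'.exists_integral_multiple
  rw [Algebra.smul_def] at hDint
  have h2 : IsIntegral (PowerSeries ℂ) (algebraMap (Polynomial ℂ) L D * x) := hDint.tower_top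
  obtain ⟨e, he⟩ := IsIntegrallyClosed.isIntegral_iff.1 h2
  refine ⟨D, hD, e, ?_, he.symm⟩
  rw [← he] at hDint
  exact (isIntegral_algHom_iff (IsScalarTower.toAlgHom (Polynomial ℂ) (PowerSeries ℂ) L)
    (IsFractionRing.injective (PowerSeries ℂ) L)).1 hDint

lemma eulerDerivation_mem {E : IntermediateField (RatFunc ℂ) L} [FiniteDimensional (RatFunc ℂ) E]
    {b : PowerSeries ℂ} (hb : algebraMap (PowerSeries ℂ) L b ∈ E) :
    algebraMap (PowerSeries ℂ) L (eulerDerivation ℂ b) ∈ E := by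
  have hmem : ∀ p : Polynomial (Polynomial ℂ),
      algebraMap (PowerSeries ℂ) L (Polynomial.aeval b p) ∈ E := by
    intro p
    rw [← Polynomial.aeval_algebraMap_apply, Polynomial.aeval_eq_sum_range]
    refine sum_mem fun i _ => ?_
    rw [Algebra.smul_def]
    exact mul_mem (algebraMap_polynomial_mem E _) (pow_mem hb i)
  have halg : IsAlgebraic (Polynomial ℂ) b := by
    have h1 : IsAlgebraic (RatFunc ℂ) (algebraMap (PowerSeries ℂ) L b) :=
      (isAlgebraic_algHom_iff E.val E.val.injective).2
        (Algebra.IsAlgebraic.isAlgebraic (⟨_, hb⟩ : E))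
    have h2 := (IsFractionRing.isAlgebraic_iff (Polynomial ℂ) (RatFunc ℂ) L).2 h1
    exact (isAlgebraic_algHom_iff (IsScalarTower.toAlgHom (Polynomial ℂ) (PowerSeries ℂ) L)
      (IsFractionRing.injective (PowerSeries ℂ) L)).1 h2
  have hex : ∃ n, ∃ p : Polynomial (Polynomial ℂ), p ≠ 0 ∧ p.natDegree = n ∧
      Polynomial.aeval b p = 0 := by
    obtain ⟨p, hp, hp0⟩ := halg
    exact ⟨_, p, hp, rfl, hp0⟩
  obtain ⟨p, hp, hpn, hp0⟩ := Nat.find_spec hex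
  have hder : Polynomial.aeval b (Polynomial.derivative p) ≠ 0 := by
    intro h0
    have hd0 : p.natDegree ≠ 0 := by
      intro h
      rw [Polynomial.natDegree_eq_zero] at h
      obtain ⟨c, rfl⟩ := h
      rw [Polynomial.aeval_C] at hp0
      apply hp
      have : (c : PowerSeries ℂ) = 0 := hp0
      have hc : c = 0 := by exact_mod_cast this
      rw [hc, map_zero]
    have hd : Polynomial.derivative p ≠ 0 := by
      intro h
      exact hd0 (Polynomial.derivative_eq_zero.1 h)
    have hlt := Polynomial.natDegree_derivative_lt hd0
    rw [hpn] at hlt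
    exact Nat.find_min hex hlt ⟨_, hd, rfl, h0⟩
  have hcoe : ∀ a : Polynomial ℂ, eulerDerivation ℂ (algebraMap _ (PowerSeries ℂ) a) =
      algebraMap _ (PowerSeries ℂ) (Polynomial.X * Polynomial.derivative a) := by
    intro a
    have e1 : eulerDerivation ℂ (a : PowerSeries ℂ) =
        ((Polynomial.X * Polynomial.derivative a : Polynomial ℂ) : PowerSeries ℂ) := by
      rw [eulerDerivation, Derivation.smul_apply, PowerSeries.derivative_coe, smul_eq_mul]
      push_cast; rfl
    exact e1
  have key : ∀ p : Polynomial (Polynomial ℂ), algebraMap (PowerSeries ℂ) L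
      (eulerDerivation ℂ (Polynomial.aeval b p) -
        Polynomial.aeval b (Polynomial.derivative p) * eulerDerivation ℂ b) ∈ E := by
    intro p
    induction p using Polynomial.induction_on' with
    | add p r hp hr =>
      have := add_mem hp hr
      rw [← map_add] at this
      convert this using 2
      simp only [map_add]; ring
    | monomial n a =>
      have e2 : eulerDerivation ℂ (Polynomial.aeval b (Polynomial.monomial n a)) -
          Polynomial.aeval b (Polynomial.derivative (Polynomial.monomial n a)) *
            eulerDerivation ℂ b =
          Polynomial.aeval b (Polynomial.monomial n (Polynomial.X * Polynomial.derivative a)) := by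
        simp only [Polynomial.aeval_monomial, Polynomial.derivative_monomial, Derivation.leibniz,
          Derivation.leibniz_pow, hcoe, smul_eq_mul, nsmul_eq_mul, map_mul, map_natCast]
        ring
      rw [e2]
      exact hmem _
  have h1 := key p
  rw [hp0, map_zero, zero_sub, map_neg, neg_mem_iff, map_mul] at h1
  have h2 := mul_mem (inv_mem (hmem (Polynomial.derivative p))) h1
  rwa [inv_mul_cancel_left₀] at h2
  rwa [Ne, FaithfulSMul.algebraMap_eq_zero_iff]

lemma exists_ode_of_mem {E : IntermediateField (RatFunc ℂ) L} [FiniteDimensional (RatFunc ℂ) E]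
    {e : PowerSeries ℂ} (he : algebraMap (PowerSeries ℂ) L e ∈ E) :
    ∃ (m : ℕ) (P : ℕ → Polynomial ℂ), (∃ l ≤ m, P l ≠ 0) ∧
      ∑ l ∈ Finset.range (m + 1), (P l : PowerSeries ℂ) * (eulerDerivation ℂ)^[l] e = 0 := by
  set m := Module.finrank (RatFunc ℂ) E
  have hmem : ∀ l, algebraMap (PowerSeries ℂ) L ((eulerDerivation ℂ)^[l] e) ∈ E := by
    intro l
    induction l with
    | zero => exact he
    | succ l ih => rw [Function.iterate_succ_apply']; exact eulerDerivation_mem ih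
  have h1 := not_linearIndependent_of_mem E (y := fun l : Fin (m + 1) =>
    (eulerDerivation ℂ)^[l] e) (fun l => hmem l) (Nat.lt_succ_self m)
  rw [Fintype.not_linearIndependent_iff] at h1
  obtain ⟨g, hg, i, hi⟩ := h1
  refine ⟨m, fun l => if h : l < m + 1 then g ⟨l, h⟩ else 0, ⟨i, by omega, by simpa [Nat.le_of_lt_succ i.2] using hi⟩, ?_⟩
  rw [← hg, Finset.sum_range]
  refine Finset.sum_congr rfl fun l _ => ?_
  simp only [dif_pos l.2, polynomial_smul_eq_coe_mul]

lemma exists_basis_powerSeries (E : IntermediateField (RatFunc ℂ) L)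
    [FiniteDimensional (RatFunc ℂ) E] :
    ∃ (d : ℕ) (b : Fin d → PowerSeries ℂ), d = Module.finrank (RatFunc ℂ) E ∧
      (∀ j, algebraMap (PowerSeries ℂ) L (b j) ∈ E) ∧ LinearIndependent (Polynomial ℂ) b := by
  set b₀ := Module.finBasis (RatFunc ℂ) E
  have halg : ∀ j, IsAlgebraic (RatFunc ℂ) (b₀ j : L) := fun j =>
    (isAlgebraic_algHom_iff E.val E.val.injective).2 (Algebra.IsAlgebraic.isAlgebraic (b₀ j))
  choose D hD e _ he2 using fun j => exists_integral_powerSeries_multiple (halg j)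
  refine ⟨_, e, rfl, fun j => ?_, ?_⟩
  · rw [← he2]
    exact mul_mem (algebraMap_polynomial_mem E _) (b₀ j).2
  · rw [linearIndependent_powerSeries_iff (L := L)]
    have h1 : LinearIndependent (RatFunc ℂ) fun j => (b₀ j : L) :=
      b₀.linearIndependent.map' E.val.toLinearMap (LinearMap.ker_eq_bot.2 E.val.injective)
    have hD' : ∀ j, algebraMap (Polynomial ℂ) (RatFunc ℂ) (D j) ≠ 0 := fun j => by
      simpa using hD j
    have h2 := h1.units_smul fun j => Units.mk0 _ (hD' j)
    convert h2 using 2 with j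
    rw [← he2, IsScalarTower.algebraMap_apply (Polynomial ℂ) (RatFunc ℂ) L]
    simp [Units.smul_def, Algebra.smul_def]

lemma exists_dvd_expand {Q : ℕ} {D : Polynomial ℂ} (hD : D ≠ 0) :
    ∃ D₁ : Polynomial ℂ, D₁ ≠ 0 ∧ D ∣ Polynomial.expand ℂ Q D₁ := by
  refine ⟨Polynomial.C D.leadingCoeff *
    (D.roots.map fun a => Polynomial.X - Polynomial.C (a ^ Q)).prod, ?_, ?_⟩
  · refine mul_ne_zero (by simpa using hD) ?_
    exact (Polynomial.monic_multiset_prod_of_monic _ _ fun a _ => Polynomial.monic_X_sub_C _).ne_zero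
  · conv_lhs => rw [(IsAlgClosed.splits D).eq_prod_roots]
    rw [map_mul, Polynomial.expand_C, map_multiset_prod, Multiset.map_map]
    refine mul_dvd_mul_left _ (Multiset.prod_dvd_prod_of_dvd _ _ fun a _ => ?_)
    simp only [Function.comp_apply, map_sub, Polynomial.expand_X, Polynomial.expand_C, map_pow]
    exact sub_dvd_pow_sub_pow _ _ _

lemma expand_pow_mem {q : ℕ} (hq : q ≠ 0) {E : IntermediateField (RatFunc ℂ) L}
    (hσ : ∀ b : PowerSeries ℂ, algebraMap (PowerSeries ℂ) L b ∈ E →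
      algebraMap (PowerSeries ℂ) L (PowerSeries.expand q hq b) ∈ E)
    (k : ℕ) {b : PowerSeries ℂ} (hb : algebraMap (PowerSeries ℂ) L b ∈ E) :
    algebraMap (PowerSeries ℂ) L (PowerSeries.expand (q ^ k) (pow_ne_zero k hq) b) ∈ E := by
  induction k with
  | zero => simpa using hb
  | succ k ih =>
    have := hσ _ ih
    rw [← PowerSeries.expand_mul] at this
    simp only [pow_succ']
    exact this

lemma psSection_mem {Q : ℕ} (hQ : Q ≠ 0) {E : IntermediateField (RatFunc ℂ) L}
    [FiniteDimensional (RatFunc ℂ) E]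
    (hσ : ∀ b : PowerSeries ℂ, algebraMap (PowerSeries ℂ) L b ∈ E →
      algebraMap (PowerSeries ℂ) L (PowerSeries.expand Q hQ b) ∈ E)
    {e : PowerSeries ℂ} (he : algebraMap (PowerSeries ℂ) L e ∈ E) {i : ℕ} (hi : i < Q) :
    algebraMap (PowerSeries ℂ) L (psSection Q i e) ∈ E := by
  obtain ⟨d, b, hd, hbE, hb⟩ := exists_basis_powerSeries E
  have hb' := linearIndependent_expand hQ hb
  have h1 := not_linearIndependent_of_mem E
    (y := Fin.cons e fun j => PowerSeries.expand Q hQ (b j))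
    (Fin.cases (by simpa using he) fun j => by simpa using hσ _ (hbE j)) (hd ▸ Nat.lt_succ_self d)
  rw [Fintype.not_linearIndependent_iff] at h1
  obtain ⟨g, hg, j₀, hj₀⟩ := h1
  rw [Fin.sum_univ_succ] at hg
  simp only [Fin.cons_zero, Fin.cons_succ] at hg
  have hg0 : g 0 ≠ 0 := by
    intro h0
    rw [h0, zero_smul, zero_add] at hg
    have := Fintype.linearIndependent_iff.1 hb' _ hg
    revert hj₀
    refine Fin.cases (fun h => h h0) (fun j h => h (this j)) j₀
  obtain ⟨D₁, hD₁, c, hc⟩ := exists_dvd_expand (Q := Q) hg0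
  have h2 : PowerSeries.expand Q hQ (D₁ : PowerSeries ℂ) * e +
      ∑ j : Fin d, ((c * g j.succ : Polynomial ℂ) : PowerSeries ℂ) *
        PowerSeries.expand Q hQ (b j) = 0 := by
    have := congrArg (fun x => (c : PowerSeries ℂ) * x) hg
    simp only [mul_add, mul_zero, Finset.mul_sum, polynomial_smul_eq_coe_mul] at this
    rw [← coe_polynomial_expand, hc, ← this, Polynomial.coe_mul]
    simp only [Polynomial.coe_mul]
    congr 1
    · ring
    · exact Finset.sum_congr rfl fun j _ => by ring
  have h3 := congrArg (psSection Q i) h2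
  rw [psSection_add, psSection_zero, psSection_sum, psSection_expand_mul hQ hi] at h3
  choose c' hc' using fun j : Fin d => exists_polynomial_psSection hQ i (c * g j.succ)
  simp only [psSection_mul_expand hQ hi, hc'] at h3
  have h4 := congrArg (algebraMap (PowerSeries ℂ) L) h3
  rw [map_add, map_mul, map_zero, map_sum, algebraMap_coe_polynomial] at h4
  have h5 : algebraMap (PowerSeries ℂ) L (psSection Q i e) =
      (algebraMap (Polynomial ℂ) L D₁)⁻¹ *
        (-∑ j, algebraMap (PowerSeries ℂ) L ((c' j : PowerSeries ℂ) * b j)) := by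
    rw [← eq_neg_of_add_eq_zero_left h4, inv_mul_cancel_left₀ (algebraMap_polynomial_ne_zero hD₁)]
  rw [h5]
  refine mul_mem (inv_mem (algebraMap_polynomial_mem E _)) (neg_mem (sum_mem fun j _ => ?_))
  rw [map_mul, algebraMap_coe_polynomial]
  exact mul_mem (algebraMap_polynomial_mem E _) (hbE j)

end AlgebraicMahler

section AlgebraicMahlerRational

variable {L : Type*} [Field L] [Algebra (PowerSeries ℂ) L] [IsFractionRing (PowerSeries ℂ) L]
  [Algebra (Polynomial ℂ) L] [IsScalarTower (Polynomial ℂ) (PowerSeries ℂ) L]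
  [Algebra (RatFunc ℂ) L] [IsScalarTower (Polynomial ℂ) (RatFunc ℂ) L]

lemma exists_isDegreeBounded_rescale {e : PowerSeries ℂ} (he : IsIntegral (Polynomial ℂ) e) :
    ∃ D : ℕ, ∀ ω : ℂ,
      IsDegreeBounded ℂ D (algebraMap (PowerSeries ℂ) L (PowerSeries.rescale ω e)) := by
  obtain ⟨P, hP, hP0⟩ := he
  refine ⟨(Finset.range (P.natDegree + 1)).sup fun j => (P.coeff j).natDegree, fun ω => ?_⟩
  have hD : ∀ j, (P.coeff j).natDegree ≤
      (Finset.range (P.natDegree + 1)).sup fun j => (P.coeff j).natDegree := by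
    intro j
    by_cases hj : j < P.natDegree + 1
    · exact Finset.le_sup (f := fun j => (P.coeff j).natDegree) (Finset.mem_range.2 hj)
    · rw [Polynomial.coeff_eq_zero_of_natDegree_lt (by omega)]; simp
  set φ : Polynomial ℂ →+* Polynomial ℂ :=
    Polynomial.compRingHom (Polynomial.C ω * Polynomial.X) with hφ
  refine isDegreeBounded_of_monic (P := P.map φ) (hP.map φ) (fun j => ?_) ?_
  · rw [Polynomial.coeff_map]
    refine le_trans ?_ (hD j)
    rw [hφ, Polynomial.coe_compRingHom_apply]
    refine Polynomial.natDegree_comp_le.trans ?_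
    calc _ ≤ (P.coeff j).natDegree * 1 :=
          Nat.mul_le_mul_left _ (by simpa using Polynomial.natDegree_C_mul_X_pow_le ω 1)
      _ = _ := mul_one _
  · rw [Polynomial.aeval_algebraMap_apply]
    have hcomp : (algebraMap (Polynomial ℂ) (PowerSeries ℂ)).comp φ =
        (PowerSeries.rescale ω).comp (algebraMap (Polynomial ℂ) (PowerSeries ℂ)) := by
      refine RingHom.ext fun p => ?_
      exact (rescale_coe_polynomial ω p).symm
    have h1 : Polynomial.aeval (PowerSeries.rescale ω e) (P.map φ) = 0 := by
      rw [Polynomial.aeval_def, Polynomial.eval₂_map, hcomp, ← Polynomial.hom_eval₂, hP0, map_zero]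
    rw [h1, map_zero]

lemma psSection_coe_of_natDegree_lt {F : Type*} [Field F] {Q s : ℕ} {p : Polynomial F}
    (hp : p.natDegree < Q) :
    psSection Q s (p : PowerSeries F) = PowerSeries.C (p.coeff s) := by
  ext n
  rw [coeff_psSection, Polynomial.coeff_coe, PowerSeries.coeff_C]
  split_ifs with h
  · subst h; simp
  · apply Polynomial.coeff_eq_zero_of_natDegree_lt
    have : Q * 1 ≤ Q * n := Nat.mul_le_mul_left _ (by omega)
    omega

lemma coeff_eq_zero_of_isDegreeBounded {Q : ℕ} (hQ : Q ≠ 0)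
    {E : IntermediateField (RatFunc ℂ) L} [FiniteDimensional (RatFunc ℂ) E]
    (hσ : ∀ b : PowerSeries ℂ, algebraMap (PowerSeries ℂ) L b ∈ E →
      algebraMap (PowerSeries ℂ) L (PowerSeries.expand Q hQ b) ∈ E)
    {e : PowerSeries ℂ} (he : algebraMap (PowerSeries ℂ) L e ∈ E) {D : ℕ}
    (hD : ∀ ω : ℂ, IsDegreeBounded ℂ D (algebraMap (PowerSeries ℂ) L (PowerSeries.rescale ω e)))
    {i : ℕ} (hi : i < Q) (hQi : Module.finrank (RatFunc ℂ) E * (D + i) < Q) {n : ℕ} (hn : n ≠ 0) :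
    PowerSeries.coeff (Q * n + i) e = 0 := by
  set η := psSection Q i e with hη
  have hηE : algebraMap (PowerSeries ℂ) L η ∈ E := psSection_mem hQ hσ he hi
  set u := PowerSeries.X ^ i * PowerSeries.expand Q hQ η with hu
  have hXE : algebraMap (PowerSeries ℂ) L PowerSeries.X ∈ E := by
    rw [← Polynomial.coe_X, algebraMap_coe_polynomial]
    exact algebraMap_polynomial_mem E _
  have huE : algebraMap (PowerSeries ℂ) L u ∈ E := by
    rw [hu, map_mul, map_pow]
    exact mul_mem (pow_mem hXE i) (hσ _ hηE)
  have hub : IsDegreeBounded ℂ D (algebraMap (PowerSeries ℂ) L u) := by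
    rw [hu, hη, X_pow_mul_expand_psSection hQ hi (Complex.isPrimitiveRoot_exp Q hQ), map_sum]
    refine IsDegreeBounded.sum fun t _ => ?_
    rw [map_mul, ← Polynomial.coe_C, algebraMap_coe_polynomial]
    exact (hD _).const_mul _
  set μ := minpoly (RatFunc ℂ) (algebraMap (PowerSeries ℂ) L u) with hμ
  have hμd : μ.natDegree ≤ Module.finrank (RatFunc ℂ) E := by
    have h1 := minpoly.natDegree_le (A := RatFunc ℂ) (⟨_, huE⟩ : E)
    have h2 : minpoly (RatFunc ℂ) (⟨_, huE⟩ : E) = μ :=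
      (minpoly.algHom_eq E.val E.val.injective _).symm
    rwa [h2] at h1
  have hDint : IsIntegral (RatFunc ℂ) (algebraMap (PowerSeries ℂ) L u) := hub.1.tower_top
  choose p hp hpd using fun j => hub.minpoly_coeff j
  set m := μ.natDegree with hm
  have hrel : ∑ j ∈ Finset.range (m + 1), ((p j * Polynomial.X ^ (i * j) : Polynomial ℂ) :
      PowerSeries ℂ) * PowerSeries.expand Q hQ (η ^ j) = 0 := by
    apply IsFractionRing.injective (PowerSeries ℂ) L
    rw [map_zero, map_sum, ← minpoly.aeval (RatFunc ℂ) (algebraMap (PowerSeries ℂ) L u),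
      Polynomial.aeval_eq_sum_range]
    refine Finset.sum_congr rfl fun j _ => ?_
    rw [← hp j, Algebra.smul_def, ← IsScalarTower.algebraMap_apply, ← algebraMap_coe_polynomial,
      ← map_pow, ← map_mul, hu, mul_pow, Polynomial.coe_mul, Polynomial.coe_pow, Polynomial.coe_X,
      map_pow, pow_mul, mul_assoc]
  have hdeg : ∀ j ≤ m, (p j * Polynomial.X ^ (i * j)).natDegree < Q := by
    intro j hj
    refine lt_of_le_of_lt ?_ hQi
    refine Polynomial.natDegree_mul_le.trans ?_
    rw [Polynomial.natDegree_X_pow, mul_add, mul_comm _ D, mul_comm _ i]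
    exact add_le_add ((hpd j).trans (Nat.mul_le_mul_left _ hμd))
      (Nat.mul_le_mul_left _ (hj.trans hμd))
  have hpm : p m = 1 := by
    have : algebraMap (Polynomial ℂ) (RatFunc ℂ) (p m) = 1 := by
      rw [hp m]; exact (minpoly.monic hDint).coeff_natDegree
    exact (IsFractionRing.injective (Polynomial ℂ) (RatFunc ℂ)) (by rw [this, map_one])
  have hs : i * m < Q := by
    refine lt_of_le_of_lt ?_ hQi
    rw [mul_comm]
    exact Nat.mul_le_mul hμd (Nat.le_add_left _ _)
  have h1 := congrArg (psSection Q (i * m)) hrel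
  rw [psSection_sum, psSection_zero] at h1
  have h2 : Polynomial.aeval η (∑ j ∈ Finset.range (m + 1),
      Polynomial.C ((p j * Polynomial.X ^ (i * j)).coeff (i * m)) * Polynomial.X ^ j) = 0 := by
    rw [map_sum, ← h1]
    refine Finset.sum_congr rfl fun j hj => ?_
    rw [psSection_mul_expand hQ hs,
      psSection_coe_of_natDegree_lt (hdeg j (by rw [Finset.mem_range] at hj; omega)),
      map_mul, map_pow, Polynomial.aeval_C, Polynomial.aeval_X]
    rfl
  have hne : (∑ j ∈ Finset.range (m + 1),
      Polynomial.C ((p j * Polynomial.X ^ (i * j)).coeff (i * m)) * Polynomial.X ^ j) ≠ 0 := by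
    intro h0
    have h3 := congrArg (fun r => Polynomial.coeff r m) h0
    simp only [Polynomial.finsetSum_coeff, Polynomial.coeff_C_mul_X_pow, Polynomial.coeff_zero,
      Finset.sum_ite_eq, Finset.mem_range, Nat.lt_succ_self, if_true, hpm, one_mul,
      Polynomial.coeff_X_pow] at h3
    exact one_ne_zero h3
  obtain ⟨a, ha⟩ := exists_eq_C_of_aeval_eq_zero hne h2
  rw [← coeff_psSection, ← hη, ha, PowerSeries.coeff_C, if_neg hn]

/-- A finite extension of `ℂ(z)` inside `ℂ((z))` which is stable under `z ↦ z ^ q` is trivial. -/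
theorem eq_bot_of_expand_stable {q : ℕ} (hq : 2 ≤ q) (hq0 : q ≠ 0)
    (E : IntermediateField (RatFunc ℂ) L) [FiniteDimensional (RatFunc ℂ) E]
    (hσ : ∀ b : PowerSeries ℂ, algebraMap (PowerSeries ℂ) L b ∈ E →
      algebraMap (PowerSeries ℂ) L (PowerSeries.expand q hq0 b) ∈ E) : E = ⊥ := by
  rw [eq_bot_iff]
  intro x hx
  have halg : IsAlgebraic (RatFunc ℂ) x :=
    (isAlgebraic_algHom_iff E.val E.val.injective).2
      (Algebra.IsAlgebraic.isAlgebraic (⟨x, hx⟩ : E))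
  obtain ⟨D, hD, e, hDint, he⟩ := exists_integral_powerSeries_multiple halg
  have heE : algebraMap (PowerSeries ℂ) L e ∈ E := by
    rw [← he]; exact mul_mem (algebraMap_polynomial_mem E _) hx
  obtain ⟨m, P, hP, hode⟩ := exists_ode_of_mem heE
  obtain ⟨B, hB⟩ := exists_isDegreeBounded_rescale (L := L) hDint
  obtain ⟨p, hp⟩ := exists_polynomial_of_ode_of_gaps hP hode (by
    intro r N
    set k := Module.finrank (RatFunc ℂ) E * (B + r) + r + N
    have hk : k < q ^ k := Nat.lt_pow_self (by omega)
    refine ⟨q ^ k, by omega, fun i hi => ?_⟩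
    have := coeff_eq_zero_of_isDegreeBounded (pow_ne_zero k hq0)
      (fun b hb => expand_pow_mem hq0 hσ k hb) heE hB (i := i)
      (by omega) (lt_of_le_of_lt (Nat.mul_le_mul_left _ (by omega : B + i ≤ B + r))
        (by omega)) one_ne_zero
    rwa [mul_one] at this)
  have hx' : x = (algebraMap (Polynomial ℂ) L D)⁻¹ * algebraMap (Polynomial ℂ) L p := by
    rw [← algebraMap_coe_polynomial p, ← hp, ← he,
      inv_mul_cancel_left₀ (algebraMap_polynomial_ne_zero hD)]
  rw [hx']
  exact mul_mem (inv_mem (algebraMap_polynomial_mem _ _)) (algebraMap_polynomial_mem _ _)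

end AlgebraicMahlerRational

section Descent

lemma eq_zero_of_sum_eq_zero_algebraicClosure {k L ι : Type*} [Field k] [Field L] [CharZero L]
    [Algebra k L] [Fintype ι] {Y : ι → L}
    (hY : ∀ x : ι → L, (∀ i, IsAlgebraic k (x i)) → ∑ i, x i * Y i = 0 → x = 0)
    (x : ι → AlgebraicClosure L) (hx : ∀ i, IsAlgebraic k (x i))
    (hsum : ∑ i, x i * algebraMap L (AlgebraicClosure L) (Y i) = 0) : x = 0 := by
  have : IsGalois L (AlgebraicClosure L) := {}
  suffices H : ∀ N : ℕ, ∀ x : ι → AlgebraicClosure L, (∀ i, IsAlgebraic k (x i)) →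
      ∑ i, x i * algebraMap L (AlgebraicClosure L) (Y i) = 0 →
      (Finset.univ.filter fun i => x i ≠ 0).card = N → x = 0 from H _ x hx hsum rfl
  intro N
  induction N using Nat.strong_induction_on with
  | _ N ih =>
    intro x hx hsum hN
    by_contra hne
    obtain ⟨i₀, hi₀⟩ : ∃ i, x i ≠ 0 := by
      by_contra! h; exact hne (funext h)
    set x' : ι → AlgebraicClosure L := fun i => (x i₀)⁻¹ * x i with hx'
    have hx'alg : ∀ i, IsAlgebraic k (x' i) := fun i => (hx i₀).inv.mul (hx i)
    have hx'sum : ∑ i, x' i * algebraMap L (AlgebraicClosure L) (Y i) = 0 := by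
      simp only [hx', mul_assoc, ← Finset.mul_sum, hsum, mul_zero]
    have hfix : ∀ i, ∀ τ : AlgebraicClosure L ≃ₐ[L] AlgebraicClosure L, τ (x' i) = x' i := by
      intro i τ
      have h0 : (fun i => τ (x' i) - x' i) = 0 := by
        refine ih _ ?_ (fun i => τ (x' i) - x' i) (fun i => ?_) ?_ rfl
        · rw [← hN]
          apply Finset.card_lt_card
          refine ⟨fun i hi => ?_, fun h => ?_⟩
          · simp only [Finset.mem_filter, Finset.mem_univ, true_and] at hi ⊢
            intro h0; apply hi; simp [hx', h0]
          · have := h (show i₀ ∈ _ by simpa using hi₀)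
            have h1 : x' i₀ = 1 := inv_mul_cancel₀ hi₀
            simp [h1] at this
        · refine IsAlgebraic.sub ?_ (hx'alg i)
          exact (isAlgebraic_algHom_iff (τ.toAlgHom.restrictScalars k) τ.injective).2 (hx'alg i)
        · simp only [sub_mul, Finset.sum_sub_distrib, hx'sum, sub_zero]
          have := congrArg τ hx'sum
          simpa only [map_sum, map_mul, AlgEquiv.commutes, map_zero] using this
      exact sub_eq_zero.1 (congrFun h0 i)
    have hrange : ∀ i, ∃ z : L, algebraMap L (AlgebraicClosure L) z = x' i := fun i => by
      have := (InfiniteGalois.mem_bot_iff_fixed (k := L) (x' i)).2 (hfix i)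
      simpa [IntermediateField.mem_bot] using this
    choose z hz using hrange
    have hz0 := hY z (fun i => by
      have := hx'alg i
      rw [← hz i] at this
      exact (isAlgebraic_algebraMap_iff (algebraMap L (AlgebraicClosure L)).injective).1 this) (by
      apply (algebraMap L (AlgebraicClosure L)).injective
      simpa only [map_sum, map_mul, hz, map_zero] using hx'sum)
    have h1 := hz i₀
    rw [hz0] at h1
    simp [hx', inv_mul_cancel₀ hi₀] at h1

end Descent

section MahlerSystem

variable {L : Type*} [Field L] [Algebra (PowerSeries ℂ) L] [IsFractionRing (PowerSeries ℂ) L]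
  [Algebra (Polynomial ℂ) L] [IsScalarTower (Polynomial ℂ) (PowerSeries ℂ) L]
  [Algebra (RatFunc ℂ) L] [IsScalarTower (Polynomial ℂ) (RatFunc ℂ) L]

/-- The operator `z ↦ z ^ q` on the fraction field of `ℂ⟦z⟧`. -/
def fracExpand (L : Type*) [Field L] [Algebra (PowerSeries ℂ) L]
    [IsFractionRing (PowerSeries ℂ) L] {q : ℕ} (hq : q ≠ 0) : L →+* L :=
  IsFractionRing.map (A := PowerSeries ℂ) (B := PowerSeries ℂ) (K := L) (L := L)
    (j := (PowerSeries.expand q hq : PowerSeries ℂ →ₐ[ℂ] PowerSeries ℂ).toRingHom)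
    (expand_ps_injective hq)

lemma fracExpand_algebraMap {q : ℕ} (hq : q ≠ 0) (b : PowerSeries ℂ) :
    fracExpand L hq (algebraMap _ L b) = algebraMap _ L (PowerSeries.expand q hq b) := by
  exact IsLocalization.map_eq (M := nonZeroDivisors (PowerSeries ℂ))
    (T := nonZeroDivisors (PowerSeries ℂ)) (Q := L) (S := L)
    (g := (PowerSeries.expand q hq : PowerSeries ℂ →ₐ[ℂ] PowerSeries ℂ).toRingHom)
    (nonZeroDivisors_le_comap_nonZeroDivisors_of_injective _ (expand_ps_injective hq)) b

lemma fracExpand_algebraMap_polynomial {q : ℕ} (hq : q ≠ 0) (p : Polynomial ℂ) :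
    fracExpand L hq (algebraMap _ L p) = algebraMap _ L (Polynomial.expand ℂ q p) := by
  rw [← algebraMap_coe_polynomial, fracExpand_algebraMap, ← coe_polynomial_expand hq,
    algebraMap_coe_polynomial]

lemma exists_fracExpand_ratFunc {q : ℕ} (hq : q ≠ 0) (c : RatFunc ℂ) :
    ∃ c' : RatFunc ℂ, fracExpand L hq (algebraMap _ L c) = algebraMap _ L c' := by
  obtain ⟨p, r, hr, rfl⟩ := IsFractionRing.div_surjective (A := Polynomial ℂ) c
  refine ⟨algebraMap _ _ (Polynomial.expand ℂ q p) / algebraMap _ _ (Polynomial.expand ℂ q r), ?_⟩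
  simp only [map_div₀, ← IsScalarTower.algebraMap_apply, fracExpand_algebraMap_polynomial]

lemma isAlgebraic_fracExpand {q : ℕ} (hq : q ≠ 0) {x : L} (hx : IsAlgebraic (RatFunc ℂ) x) :
    IsAlgebraic (RatFunc ℂ) (fracExpand L hq x) := by
  rw [← IsFractionRing.isAlgebraic_iff (Polynomial ℂ) (RatFunc ℂ) L] at hx ⊢
  obtain ⟨P, hP, hP0⟩ := hx
  refine ⟨P.map (Polynomial.expand ℂ q).toRingHom, ?_, ?_⟩
  · refine (Polynomial.map_ne_zero_iff ?_).2 hP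
    exact Polynomial.expand_injective (Nat.pos_of_ne_zero hq)
  · have hcomp : (algebraMap (Polynomial ℂ) L).comp (Polynomial.expand ℂ q).toRingHom =
        (fracExpand L hq).comp (algebraMap (Polynomial ℂ) L) :=
      RingHom.ext fun p => (fracExpand_algebraMap_polynomial hq p).symm
    rw [Polynomial.aeval_def, Polynomial.eval₂_map, hcomp, ← Polynomial.hom_eval₂]
    rw [Polynomial.aeval_def] at hP0
    rw [hP0, map_zero]

lemma eq_zero_of_algebraic_relation {ι : Type*} [Fintype ι] {q : ℕ} (hq : 2 ≤ q) (hq0 : q ≠ 0)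
    {Y : ι → L} (hY : LinearIndependent (RatFunc ℂ) Y)
    {c d : ι → ι → RatFunc ℂ}
    (hc : ∀ l, fracExpand L hq0 (Y l) = ∑ m, algebraMap _ L (c l m) * Y m)
    (hd : ∀ l, Y l = ∑ m, algebraMap _ L (d l m) * fracExpand L hq0 (Y m))
    (x : ι → L) (hx : ∀ i, IsAlgebraic (RatFunc ℂ) (x i)) (hsum : ∑ i, x i * Y i = 0) :
    x = 0 := by
  set σ := fracExpand L hq0 with hσdef
  let A : IntermediateField (RatFunc ℂ) L := algebraicClosure (RatFunc ℂ) L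
  have hA : ∀ z : L, z ∈ A ↔ IsAlgebraic (RatFunc ℂ) z := fun z => mem_algebraicClosure_iff
  obtain ⟨κ, a, ha, hspan, hli⟩ := exists_linearIndependent' A Y
  have : Finite κ := Finite.of_injective a ha
  let _ : Fintype κ := Fintype.ofFinite κ
  have hli' : ∀ g h : κ → L, (∀ i, IsAlgebraic (RatFunc ℂ) (g i)) →
      (∀ i, IsAlgebraic (RatFunc ℂ) (h i)) →
      ∑ i, g i * Y (a i) = ∑ i, h i * Y (a i) → g = h := by
    intro g h hg hh hgh
    have h0 := Fintype.linearIndependent_iff.1 hli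
      (fun i => (⟨g i - h i, (hA _).2 ((hg i).sub (hh i))⟩ : A)) (by
        simp only [Algebra.smul_def, Function.comp]
        change ∑ i, (g i - h i) * Y (a i) = 0
        rw [← sub_eq_zero, ← Finset.sum_sub_distrib] at hgh
        simpa only [sub_mul] using hgh)
    funext i
    exact sub_eq_zero.1 (congrArg Subtype.val (h0 i))
  have hrep : ∀ l, ∃ e : κ → L, (∀ i, IsAlgebraic (RatFunc ℂ) (e i)) ∧
      Y l = ∑ i, e i * Y (a i) := by
    intro l
    have hl : Y l ∈ Submodule.span A (Set.range (Y ∘ a)) := by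
      rw [hspan]; exact Submodule.subset_span ⟨l, rfl⟩
    obtain ⟨e, he⟩ := (Submodule.mem_span_range_iff_exists_fun A).1 hl
    exact ⟨fun i => (e i : L), fun i => (hA _).1 (e i).2, he.symm⟩
  choose e healg he using hrep
  have halg_sum : ∀ {ν : Type _} (s : Finset ν) (g : ν → L),
      (∀ i ∈ s, IsAlgebraic (RatFunc ℂ) (g i)) → IsAlgebraic (RatFunc ℂ) (∑ i ∈ s, g i) := by
    intro ν s g hg
    exact (hA _).1 (sum_mem fun i hi => (hA _).2 (hg i hi))
  let G : ι → κ → L := fun l i => ∑ m, algebraMap _ L (c l m) * e m i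
  have hGalg : ∀ l i, IsAlgebraic (RatFunc ℂ) (G l i) := fun l i =>
    halg_sum _ _ fun m _ => (isAlgebraic_algebraMap _).mul (healg m i)
  have hσG : ∀ l, σ (Y l) = ∑ i, G l i * Y (a i) := by
    intro l
    rw [hc l]
    simp only [G, Finset.sum_mul]
    rw [Finset.sum_comm]
    refine Finset.sum_congr rfl fun m _ => ?_
    conv_lhs => rw [he m, Finset.mul_sum]
    simp only [mul_assoc]
  have hσe : ∀ l, σ (Y l) = ∑ i, (∑ j, σ (e l j) * G (a j) i) * Y (a i) := by
    intro l
    conv_lhs => rw [he l, map_sum]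
    simp only [map_mul, hσG, Finset.mul_sum, Finset.sum_mul]
    rw [Finset.sum_comm]
    simp only [mul_assoc]
  have hσealg : ∀ l j, IsAlgebraic (RatFunc ℂ) (σ (e l j)) := fun l j =>
    isAlgebraic_fracExpand hq0 (healg l j)
  have hGe : ∀ l i, G l i = ∑ j, σ (e l j) * G (a j) i := fun l i =>
    congrFun (hli' (G l) (fun i => ∑ j, σ (e l j) * G (a j) i) (hGalg l)
      (fun i => halg_sum _ _ fun j _ => (hσealg l j).mul (hGalg _ _)) (by rw [← hσG, ← hσe])) i
  let Ga : Matrix κ κ L := fun j i => G (a j) i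
  let t : Matrix κ κ L := fun i j => ∑ m, algebraMap _ L (d (a i) m) * σ (e m j)
  have htalg : ∀ i j, IsAlgebraic (RatFunc ℂ) (t i j) := fun i j =>
    halg_sum _ _ fun m _ => (isAlgebraic_algebraMap _).mul (hσealg _ _)
  have htG : t * Ga = 1 := by
    ext i i'
    refine congrFun (hli' (fun i' => (t * Ga) i i') (fun i' => (1 : Matrix κ κ L) i i') ?_ ?_ ?_) i'
    · intro i'
      exact halg_sum _ _ fun j _ => (htalg _ _).mul (hGalg _ _)
    · intro i'
      rw [Matrix.one_apply]
      split_ifs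
      · exact isAlgebraic_one
      · exact isAlgebraic_zero
    · have h1 : ∑ i', (1 : Matrix κ κ L) i i' * Y (a i') = Y (a i) := by
        simp [Matrix.one_apply]
      rw [h1, hd (a i)]
      have h2 : ∑ i', (t * Ga) i i' * Y (a i') = ∑ j, t i j * σ (Y (a j)) := by
        simp only [Matrix.mul_apply, hσG, Finset.sum_mul, Finset.mul_sum]
        rw [Finset.sum_comm]
        simp only [Ga, mul_assoc]
      rw [h2]
      simp only [t, Finset.sum_mul]
      rw [Finset.sum_comm]
      refine Finset.sum_congr rfl fun m _ => ?_
      conv_rhs => rw [he m, map_sum, Finset.mul_sum]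
      simp only [map_mul, mul_assoc]
  let E : IntermediateField (RatFunc ℂ) L :=
    IntermediateField.adjoin (RatFunc ℂ) (Set.range fun p : ι × κ => e p.1 p.2)
  have heE : ∀ l i, e l i ∈ E := fun l i =>
    IntermediateField.subset_adjoin _ _ ⟨(l, i), rfl⟩
  have hGE : ∀ l i, G l i ∈ E := fun l i =>
    sum_mem fun m _ => mul_mem (E.algebraMap_mem _) (heE m i)
  have : FiniteDimensional (RatFunc ℂ) E := by
    apply IntermediateField.finiteDimensional_adjoin
    rintro _ ⟨p, rfl⟩
    exact (healg _ _).isIntegral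
  let GaE : Matrix κ κ E := fun j i => ⟨G (a j) i, hGE _ _⟩
  have hmap : GaE.map E.val = Ga := rfl
  have hdet : GaE.det ≠ 0 := by
    intro h0
    have h1 : Ga.det = 0 := by
      rw [← hmap]
      have := (E.val : E →+* L).map_det GaE
      rw [h0, map_zero] at this
      exact this.symm
    have h2 := congrArg Matrix.det htG
    rw [Matrix.det_mul, h1, mul_zero, Matrix.det_one] at h2
    exact zero_ne_one h2
  have hσeE : ∀ l j, σ (e l j) ∈ E := by
    intro l j
    have h1 : σ (e l j) = ∑ i, G l i * (GaE⁻¹ i j : E) := by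
      have h2 : Ga * (GaE⁻¹.map E.val) = 1 := by
        have h3 := congrArg (fun M : Matrix κ κ E => M.map E.val)
          (Matrix.mul_nonsing_inv GaE (isUnit_iff_ne_zero.2 hdet))
        have h4 := Matrix.map_mul (L := GaE) (M := GaE⁻¹) (f := (E.val : E →+* L))
        have h5 : (1 : Matrix κ κ E).map E.val = 1 := Matrix.map_one _ (map_zero _) (map_one _)
        rw [← h5, ← h3]
        exact h4.symm
      have h6 : ∀ j', ∑ i, Ga j' i * (GaE⁻¹ i j : E) = if j' = j then 1 else 0 := by
        intro j'
        have := congrFun (congrFun h2 j') j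
        rw [Matrix.mul_apply, Matrix.one_apply] at this
        exact this
      simp only [hGe l, Finset.sum_mul]
      rw [Finset.sum_comm]
      simp only [mul_assoc, ← Finset.mul_sum]
      rw [Finset.sum_eq_single j]
      · rw [h6 j]; simp
      · intro j' _ hj'
        rw [h6 j']; simp [hj']
      · simp
    rw [h1]
    exact sum_mem fun i _ => mul_mem (hGE _ _) (GaE⁻¹ i j).2
  have hσE : ∀ x ∈ E, σ x ∈ E := by
    intro x hx
    induction hx using IntermediateField.adjoin_induction with
    | mem x hx => obtain ⟨p, rfl⟩ := hx; exact hσeE _ _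
    | algebraMap x =>
      obtain ⟨c', hc'⟩ := exists_fracExpand_ratFunc (L := L) hq0 x
      rw [hc']; exact E.algebraMap_mem _
    | add x y _ _ hx hy => rw [map_add]; exact add_mem hx hy
    | inv x _ hx => rw [map_inv₀]; exact inv_mem hx
    | mul x y _ _ hx hy => rw [map_mul]; exact mul_mem hx hy
  have hbot := eq_bot_of_expand_stable hq hq0 E fun b hb => by
    rw [← fracExpand_algebraMap]; exact hσE _ hb
  have hsurj : Function.Surjective a := by
    intro l
    by_contra hl
    refine hY.notMem_span_image (s := Set.range a) (x := l) hl ?_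
    rw [he l]
    refine Submodule.sum_mem _ fun i _ => ?_
    have h1 := heE l i
    rw [hbot, IntermediateField.mem_bot] at h1
    obtain ⟨c', hc'⟩ := h1
    rw [← hc', ← Algebra.smul_def]
    exact Submodule.smul_mem _ _ (Submodule.subset_span ⟨a i, ⟨i, rfl⟩, rfl⟩)
  let φ : κ ≃ ι := Equiv.ofBijective a ⟨ha, hsurj⟩
  have h0 := hli' (fun i => x (a i)) 0 (fun i => hx _) (fun i => isAlgebraic_zero) (by
    have := φ.sum_comp fun i => x i * Y i
    rw [hsum] at this
    simp only [Pi.zero_apply, zero_mul, Finset.sum_const_zero]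
    exact this)
  funext l
  obtain ⟨i, rfl⟩ := hsurj l
  exact congrFun h0 i

/-- Solutions of a regular Mahler system that are linearly independent over the rational functions
remain so over the algebraic functions. -/
theorem eq_zero_of_algebraicClosure_relation {ι : Type*} [Fintype ι] [CharZero L]
    {q : ℕ} (hq : 2 ≤ q) (hq0 : q ≠ 0)
    {Y : ι → L} (hY : LinearIndependent (RatFunc ℂ) Y)
    {c d : ι → ι → RatFunc ℂ}
    (hc : ∀ l, fracExpand L hq0 (Y l) = ∑ m, algebraMap _ L (c l m) * Y m)
    (hd : ∀ l, Y l = ∑ m, algebraMap _ L (d l m) * fracExpand L hq0 (Y m))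
    (x : ι → AlgebraicClosure L) (hx : ∀ i, IsAlgebraic (RatFunc ℂ) (x i))
    (hsum : ∑ i, x i * algebraMap L (AlgebraicClosure L) (Y i) = 0) : x = 0 :=
  eq_zero_of_sum_eq_zero_algebraicClosure
    (eq_zero_of_algebraic_relation hq hq0 hY hc hd) x hx hsum

end MahlerSystem

section ZeroDivisor

open scoped TensorProduct

lemma exists_algebraic_relation_of_finite {k L k' ι : Type*} [Field k] [CharZero k] [Field L]
    [Field k'] [Algebra k L] [Algebra k k'] [Module.Finite k k'] [Fintype ι] (y : ι → L)
    (x : ι → k') (hx : x ≠ 0) (G : L ⊗[k] k') (hG : G ≠ 0)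
    (h : (∑ s, y s ⊗ₜ[k] x s) * G = 0) :
    ∃ x' : ι → AlgebraicClosure L, x' ≠ 0 ∧ (∀ s, IsAlgebraic k (x' s)) ∧
      ∑ s, x' s * algebraMap L (AlgebraicClosure L) (y s) = 0 := by
  have : Algebra.IsSeparable k k' := inferInstance
  have : Algebra.FormallyUnramified k k' := Algebra.FormallyUnramified.of_isSeparable k k'
  have : IsReduced (L ⊗[k] k') := Algebra.FormallyUnramified.isReduced_of_field L _
  obtain ⟨P, hP, hGP⟩ : ∃ P : Ideal (L ⊗[k] k'), P.IsPrime ∧ G ∉ P := by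
    by_contra! h0
    exact hG ((nilpotent_iff_mem_prime.2 h0).eq_zero)
  have hFP : (∑ s, y s ⊗ₜ[k] x s) ∈ P := by
    refine (hP.mem_or_mem (?_ : (∑ s, y s ⊗ₜ[k] x s) * G ∈ P)).resolve_right hGP
    rw [h]
    exact zero_mem _
  let D := (L ⊗[k] k') ⧸ P
  have : Module.Finite L D := inferInstance
  have : Algebra.IsAlgebraic L D := inferInstance
  let θ : D →ₐ[L] AlgebraicClosure L := IsAlgClosed.lift
  let ρ : k' →ₐ[k] AlgebraicClosure L :=
    ((θ.restrictScalars k).comp (Ideal.Quotient.mkₐ k P)).comp Algebra.TensorProduct.includeRight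
  have hρ : ∀ (z : L) (w : k'), θ (Ideal.Quotient.mk P (z ⊗ₜ w)) = ρ w * algebraMap _ _ z := by
    intro z w
    have : (z ⊗ₜ[k] w) = algebraMap L (L ⊗[k] k') z * (1 ⊗ₜ w) := by simp
    rw [this, map_mul, map_mul, mul_comm]
    congr 1
    exact θ.commutes z
  refine ⟨fun s => ρ (x s), fun h0 => ?_, fun s => ?_, ?_⟩
  · exact hx (funext fun s => ρ.injective ((congrFun h0 s).trans (map_zero ρ).symm))
  · have : IsAlgebraic k (x s) := Algebra.IsAlgebraic.isAlgebraic _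
    exact this.algHom ρ
  · have h2 := congrArg θ (Ideal.Quotient.eq_zero_iff_mem.2 hFP)
    rw [map_zero] at h2
    rw [← h2]
    simp only [map_sum, ← hρ]

/-- If `∑ x s ⊗ y s` is a zero divisor in a tensor product of fields, then the `y s` satisfy a
nontrivial linear relation with coefficients algebraic over the base field. -/
theorem exists_algebraic_relation_of_mul_eq_zero {k L M ι : Type*} [Field k] [CharZero k] [Field L]
    [Field M] [Algebra k L] [Algebra k M] [Fintype ι] (y : ι → L) (x : ι → M) (hx : x ≠ 0)
    (G : M ⊗[k] L) (hG : G ≠ 0) (h : (∑ s, x s ⊗ₜ[k] y s) * G = 0) :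
    ∃ x' : ι → AlgebraicClosure L, x' ≠ 0 ∧ (∀ s, IsAlgebraic k (x' s)) ∧
      ∑ s, x' s * algebraMap L (AlgebraicClosure L) (y s) = 0 := by
  obtain ⟨s₀, hs₀⟩ : ∃ s, x s ≠ 0 := by
    by_contra! h0; exact hx (funext h0)
  let b := Module.Basis.ofVectorSpace k L
  let bM := Algebra.TensorProduct.basis M b
  let u := bM.repr G
  obtain ⟨l₀, hl₀⟩ : ∃ l, u l ≠ 0 := by
    by_contra! h0
    apply hG
    have : bM.repr G = 0 := Finsupp.ext h0
    simpa using this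
  let S : Set M := Set.range x ∪ (u '' u.support) ∪ {(x s₀)⁻¹, (u l₀)⁻¹}
  have hS : S.Finite := by
    refine ((Set.finite_range x).union ?_).union (by simp)
    exact (Finset.finite_toSet _).image _
  let R := Algebra.adjoin k S
  have hxR : ∀ s, x s ∈ R := fun s => Algebra.subset_adjoin (Or.inl (Or.inl ⟨s, rfl⟩))
  have huR : ∀ l, u l ∈ R := by
    intro l
    by_cases hl : u l = 0
    · rw [hl]; exact zero_mem _
    · exact Algebra.subset_adjoin (Or.inl (Or.inr ⟨l, by simpa using hl, rfl⟩))
  have hxi : (x s₀)⁻¹ ∈ R := Algebra.subset_adjoin (Or.inr (by simp))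
  have hui : (u l₀)⁻¹ ∈ R := Algebra.subset_adjoin (Or.inr (by simp))
  have : Algebra.FiniteType k R :=
    (Subalgebra.fg_iff_finiteType _).1 ⟨hS.toFinset, by simp [R]⟩
  obtain ⟨k', _, _, π, hfin⟩ : ∃ (k' : Type _) (_ : Field k') (_ : Algebra k k')
      (_ : R →ₐ[k] k'), Module.Finite k k' := by
    obtain ⟨m, hm⟩ := Ideal.exists_maximal R
    let _ : Field (R ⧸ m) := Ideal.Quotient.field m
    exact ⟨R ⧸ m, inferInstance, inferInstance, Ideal.Quotient.mkₐ k m,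
      finite_of_finite_type_of_isJacobsonRing k (R ⧸ m)⟩
  let F' : R ⊗[k] L := ∑ s, (⟨x s, hxR s⟩ : R) ⊗ₜ y s
  let G' : R ⊗[k] L := ∑ l ∈ u.support, (⟨u l, huR l⟩ : R) ⊗ₜ b l
  have hinj : Function.Injective (Algebra.TensorProduct.map R.val (AlgHom.id k L)) := by
    have := Module.Flat.rTensor_preserves_injective_linearMap (M := L) R.val.toLinearMap
      Subtype.val_injective
    exact this
  have hG' : Algebra.TensorProduct.map R.val (AlgHom.id k L) G' = G := by
    conv_rhs => rw [← bM.linearCombination_repr G]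
    simp only [G', map_sum, Finsupp.linearCombination_apply, Finsupp.sum]
    refine Finset.sum_congr rfl fun l _ => ?_
    simp [bM, u, TensorProduct.smul_tmul']
  have hFG' : F' * G' = 0 := by
    apply hinj
    rw [map_mul, hG', map_zero, ← h]
    congr 1
    simp [F']
  let ψ : R ⊗[k] L →ₐ[k] L ⊗[k] k' :=
    (Algebra.TensorProduct.comm k k' L).toAlgHom.comp
      (Algebra.TensorProduct.map π (AlgHom.id k L))
  have hψG : ψ G' ≠ 0 := by
    intro h0
    have h1 : Algebra.TensorProduct.map π (AlgHom.id k L) G' = 0 :=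
      (Algebra.TensorProduct.comm k k' L).injective (by rw [map_zero]; exact h0)
    have h2 : ∑ l ∈ u.support, π ⟨u l, huR l⟩ • (Algebra.TensorProduct.basis k' b) l = 0 := by
      rw [← h1]
      simp [G', TensorProduct.smul_tmul']
    have h3 := linearIndependent_iff'.1 (Algebra.TensorProduct.basis k' b).linearIndependent
      _ _ h2 l₀ (by simpa using hl₀)
    have h4 : π ⟨u l₀, huR l₀⟩ * π ⟨_, hui⟩ = 1 := by
      rw [← map_mul, ← map_one π]
      congr 1
      exact Subtype.ext (mul_inv_cancel₀ hl₀)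
    rw [h3, zero_mul] at h4
    exact zero_ne_one h4
  refine exists_algebraic_relation_of_finite y (fun s => π ⟨x s, hxR s⟩) (fun h0 => ?_)
    (ψ G') hψG ?_
  · have h1 := congrFun h0 s₀
    have h4 : π ⟨x s₀, hxR s₀⟩ * π ⟨_, hxi⟩ = 1 := by
      rw [← map_mul, ← map_one π]
      congr 1
      exact Subtype.ext (mul_inv_cancel₀ hs₀)
    rw [show π ⟨x s₀, hxR s₀⟩ = 0 from h1, zero_mul] at h4
    exact zero_ne_one h4
  · rw [← map_zero ψ, ← hFG', map_mul]
    congr 1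
    simp [F', ψ]

end ZeroDivisor

section BaseChange

/-- Linear independence of power series over polynomials is preserved by extension of the
coefficient field. -/
lemma linearIndependent_map_powerSeries {K K' ι : Type*} [Field K] [Field K'] (φ : K →+* K')
    {y : ι → PowerSeries K} (hy : LinearIndependent (Polynomial K) y) :
    LinearIndependent (Polynomial K') fun i => PowerSeries.map φ (y i) := by
  let _ : Algebra K K' := φ.toAlgebra
  rw [linearIndependent_iff'] at hy ⊢
  intro s P hP i hi
  ext n
  rw [Polynomial.coeff_zero]
  refine (Module.forall_dual_apply_eq_zero_iff K _).1 fun ψ => ?_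
  let Q : ι → Polynomial K := fun i => ∑ n ∈ (P i).support, Polynomial.monomial n (ψ ((P i).coeff n))
  have hQ : ∀ i n, (Q i).coeff n = ψ ((P i).coeff n) := by
    intro i n
    simp only [Q, Polynomial.finsetSum_coeff, Polynomial.coeff_monomial, Finset.sum_ite_eq']
    split_ifs with h
    · rfl
    · rw [Polynomial.notMem_support_iff.1 h, map_zero]
  have h0 : ∑ i ∈ s, Q i • y i = 0 := by
    ext n
    have h1 := congrArg (fun u => ψ (PowerSeries.coeff n u)) hP
    simp only [map_sum, polynomial_smul_eq_coe_mul, PowerSeries.coeff_mul, Polynomial.coeff_coe,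
      PowerSeries.coeff_map, map_zero] at h1 ⊢
    rw [← h1]
    refine Finset.sum_congr rfl fun i _ => Finset.sum_congr rfl fun p _ => ?_
    have h2 : (P i).coeff p.1 * φ (PowerSeries.coeff p.2 (y i)) =
        PowerSeries.coeff p.2 (y i) • (P i).coeff p.1 := by
      rw [Algebra.smul_def, mul_comm]; rfl
    rw [hQ, h2, map_smul, smul_eq_mul, mul_comm]
  rw [← hQ, hy s Q h0 i hi, Polynomial.coeff_zero]

open scoped TensorProduct in
lemma eq_zero_of_sum_tmul_eq_zero {k M N κ : Type*} [Field k] [AddCommGroup M] [Module k M]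
    [AddCommGroup N] [Module k N] [Fintype κ] {m : κ → M} (hm : LinearIndependent k m)
    {v : κ → N} (h : ∑ j, m j ⊗ₜ[k] v j = 0) : v = 0 := by
  obtain ⟨g, hg⟩ := LinearMap.exists_extend (hm.repr : Submodule.span k (Set.range m) →ₗ[k] κ →₀ k)
  have hgm : ∀ j, g (m j) = Finsupp.single j 1 := by
    intro j
    have := LinearMap.congr_fun hg ⟨m j, Submodule.subset_span ⟨j, rfl⟩⟩
    simp only [LinearMap.comp_apply, Submodule.subtype_apply] at this
    rw [this]
    exact hm.repr_eq_single j _ rfl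
  funext j
  have h1 := congrArg (fun t => TensorProduct.lid k N
    ((((Finsupp.lapply j : (κ →₀ k) →ₗ[k] k).comp g).rTensor N) t)) h
  simp only [map_sum, LinearMap.rTensor_tmul, TensorProduct.lid_tmul, LinearMap.comp_apply, hgm,
    map_zero, Finsupp.lapply_apply, Finsupp.single_apply, ite_smul, one_smul, zero_smul] at h1
  simpa using h1

end BaseChange

section NonZeroDivisor

variable {L : Type*} [Field L] [Algebra (PowerSeries ℂ) L] [IsFractionRing (PowerSeries ℂ) L]
  [Algebra (Polynomial ℂ) L] [IsScalarTower (Polynomial ℂ) (PowerSeries ℂ) L]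
  [Algebra (RatFunc ℂ) L] [IsScalarTower (Polynomial ℂ) (RatFunc ℂ) L]

open scoped TensorProduct in
lemma eq_zero_of_mahler_matrix_aux {K M ι κ μ : Type*} [Field K] [CharZero K] (φ : K →+* ℂ)
    [CharZero L]
    [Algebra (RatFunc K) L] [Algebra (Polynomial K) L]
    [IsScalarTower (Polynomial K) (RatFunc K) L]
    (hφ : ∀ p : Polynomial K, algebraMap _ L p = algebraMap _ L (p.map φ))
    [Field M] [Algebra (RatFunc K) M] [Fintype ι] [Fintype κ] [Fintype μ]
    {q : ℕ} (hq : 2 ≤ q) (hq0 : q ≠ 0) {y : ι → PowerSeries K}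
    (hy : LinearIndependent (Polynomial K) y)
    {D₁ D₂ : Polynomial K} (hD₁ : D₁ ≠ 0) (hD₂ : D₂ ≠ 0) {c d : ι → ι → Polynomial K}
    (hc : ∀ l, (D₁ : PowerSeries K) * PowerSeries.expand q hq0 (y l) = ∑ m, (c l m) * y m)
    (hd : ∀ l, (D₂ : PowerSeries K) * y l = ∑ m, (d l m) * PowerSeries.expand q hq0 (y m))
    {x : ι → M} (hx : x ≠ 0) {m' : κ → M} (hm' : LinearIndependent (RatFunc K) m')
    {m : μ → M} {Δ : Polynomial K} (hΔ : Δ ≠ 0) {γ : ι → μ → κ → Polynomial K}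
    (hγ : ∀ s j, algebraMap _ (RatFunc K) Δ • (x s * m' j) =
      ∑ i, algebraMap _ (RatFunc K) (γ s i j) • m i)
    {v : κ → PowerSeries K}
    (hv : ∀ i, ∑ j, (∑ s, (γ s i j : PowerSeries K) * y s) * v j = 0) : v = 0 := by
  let θ : PowerSeries K →+* L := (algebraMap (PowerSeries ℂ) L).comp (PowerSeries.map φ)
  have hθinj : Function.Injective θ := (IsFractionRing.injective (PowerSeries ℂ) L).comp
    (PowerSeries.map_injective φ φ.injective)
  have hθp : ∀ p : Polynomial K, θ p = algebraMap _ L (p.map φ) := by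
    intro p
    rw [← algebraMap_coe_polynomial]
    simp [θ, Polynomial.polynomial_map_coe]
  have hθp' : ∀ p : Polynomial K, θ p = algebraMap (RatFunc K) L (algebraMap _ _ p) := by
    intro p
    rw [hθp, ← hφ, IsScalarTower.algebraMap_apply (Polynomial K) (RatFunc K) L]
  have hθexp : ∀ b, θ (PowerSeries.expand q hq0 b) = fracExpand L hq0 (θ b) := by
    intro b
    simp only [θ, RingHom.comp_apply, fracExpand_algebraMap, PowerSeries.map_expand]
  have hYli : LinearIndependent (RatFunc ℂ) fun i => θ (y i) :=
    (linearIndependent_powerSeries_iff (L := L)).1 (linearIndependent_map_powerSeries φ hy)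
  have hne : ∀ {p : Polynomial K}, p ≠ 0 → algebraMap (Polynomial ℂ) L (p.map φ) ≠ 0 := by
    intro p hp
    rw [← hθp]
    intro h0
    rw [← map_zero θ] at h0
    exact hp (Polynomial.coe_injective K (by simpa using hθinj h0))
  have hrat : ∀ p : Polynomial ℂ, algebraMap (RatFunc ℂ) L (algebraMap _ _ p) =
      algebraMap _ L p := fun p => (IsScalarTower.algebraMap_apply _ _ _ _).symm
  have hcY : ∀ l, fracExpand L hq0 (θ (y l)) = ∑ m, algebraMap _ L
      (algebraMap _ (RatFunc ℂ) ((c l m).map φ) / algebraMap _ (RatFunc ℂ) (D₁.map φ)) *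
        θ (y m) := by
    intro l
    have h1 := congrArg θ (hc l)
    rw [map_mul, hθexp, map_sum, hθp] at h1
    rw [eq_comm, ← mul_right_inj' (hne hD₁), h1, Finset.mul_sum]
    refine Finset.sum_congr rfl fun m _ => ?_
    rw [map_div₀, hrat, hrat, map_mul, hθp, ← mul_assoc, mul_div_cancel₀ _ (hne hD₁)]
  have hdY : ∀ l, θ (y l) = ∑ m, algebraMap _ L
      (algebraMap _ (RatFunc ℂ) ((d l m).map φ) / algebraMap _ (RatFunc ℂ) (D₂.map φ)) *
        fracExpand L hq0 (θ (y m)) := by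
    intro l
    have h1 := congrArg θ (hd l)
    rw [map_mul, map_sum, hθp] at h1
    rw [eq_comm, ← mul_right_inj' (hne hD₂), h1, Finset.mul_sum]
    refine Finset.sum_congr rfl fun m _ => ?_
    rw [map_div₀, hrat, hrat, map_mul, hθp, hθexp, ← mul_assoc, mul_div_cancel₀ _ (hne hD₂)]
  have hG : ∑ j, m' j ⊗ₜ[RatFunc K] θ (v j) = 0 := by
    by_contra hG
    obtain ⟨x', hx'0, hx'alg, hx'sum⟩ := exists_algebraic_relation_of_mul_eq_zero
      (fun s => θ (y s)) x hx _ hG (by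
        have hΔ' : algebraMap _ (RatFunc K) Δ ≠ 0 := by simpa using hΔ
        rw [← smul_right_inj hΔ', smul_zero, Finset.sum_mul_sum, Finset.smul_sum]
        have : ∀ s, algebraMap _ (RatFunc K) Δ • ∑ j, (x s ⊗ₜ[RatFunc K] θ (y s)) *
            (m' j ⊗ₜ[RatFunc K] θ (v j)) = ∑ i, m i ⊗ₜ[RatFunc K]
              ∑ j, θ ((γ s i j : PowerSeries K) * y s * v j) := by
          intro s
          simp only [Algebra.TensorProduct.tmul_mul_tmul, Finset.smul_sum,
            TensorProduct.smul_tmul', hγ, TensorProduct.sum_tmul, TensorProduct.tmul_sum]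
          rw [Finset.sum_comm]
          refine Finset.sum_congr rfl fun i _ => Finset.sum_congr rfl fun j _ => ?_
          rw [← TensorProduct.smul_tmul', ← TensorProduct.tmul_smul, Algebra.smul_def, ← hθp',
            map_mul, map_mul, mul_assoc]
        simp only [this]
        rw [Finset.sum_comm]
        refine Finset.sum_eq_zero fun i _ => ?_
        rw [← TensorProduct.tmul_sum, Finset.sum_comm]
        have h2 := congrArg θ (hv i)
        simp only [Finset.sum_mul, map_sum, map_zero] at h2
        rw [h2, TensorProduct.tmul_zero])
    refine hx'0 (eq_zero_of_algebraicClosure_relation hq hq0 hYli hcY hdY x' (fun i => ?_) hx'sum)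
    obtain ⟨P, hP, hP0⟩ := (IsFractionRing.isAlgebraic_iff (Polynomial K) (RatFunc K)
      (AlgebraicClosure L)).2 (hx'alg i)
    refine (IsFractionRing.isAlgebraic_iff (Polynomial ℂ) (RatFunc ℂ) (AlgebraicClosure L)).1
      ⟨P.map (Polynomial.mapRingHom φ), ?_, ?_⟩
    · exact (Polynomial.map_ne_zero_iff (Polynomial.map_injective φ φ.injective)).2 hP
    · have hcomp : (algebraMap (Polynomial ℂ) (AlgebraicClosure L)).comp
          (Polynomial.mapRingHom φ) = algebraMap (Polynomial K) (AlgebraicClosure L) := by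
        refine RingHom.ext fun p => ?_
        rw [RingHom.comp_apply, IsScalarTower.algebraMap_apply (Polynomial ℂ) L (AlgebraicClosure L),
          IsScalarTower.algebraMap_apply (Polynomial K) L (AlgebraicClosure L), hφ]
        rfl
      rw [Polynomial.aeval_def, Polynomial.eval₂_map, hcomp, ← Polynomial.aeval_def, hP0]
  have h0 := eq_zero_of_sum_tmul_eq_zero hm' hG
  funext j
  exact hθinj ((congrFun h0 j).trans (map_zero θ).symm)

end NonZeroDivisor

/-- The matrix `∑ s, y s • γ s` attached to the solutions `y` of a regular Mahler system and to the
multiplication by the `x s` is injective. -/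
theorem eq_zero_of_mahler_matrix {K M ι κ μ : Type*} [Field K] [CharZero K] (φ : K →+* ℂ)
    [Field M] [Algebra (RatFunc K) M] [Fintype ι] [Fintype κ] [Fintype μ]
    {q : ℕ} (hq : 2 ≤ q) (hq0 : q ≠ 0) {y : ι → PowerSeries K}
    (hy : LinearIndependent (Polynomial K) y)
    {D₁ D₂ : Polynomial K} (hD₁ : D₁ ≠ 0) (hD₂ : D₂ ≠ 0) {c d : ι → ι → Polynomial K}
    (hc : ∀ l, (D₁ : PowerSeries K) * PowerSeries.expand q hq0 (y l) = ∑ m, (c l m) * y m)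
    (hd : ∀ l, (D₂ : PowerSeries K) * y l = ∑ m, (d l m) * PowerSeries.expand q hq0 (y m))
    {x : ι → M} (hx : x ≠ 0) {m' : κ → M} (hm' : LinearIndependent (RatFunc K) m')
    {m : μ → M} {Δ : Polynomial K} (hΔ : Δ ≠ 0) {γ : ι → μ → κ → Polynomial K}
    (hγ : ∀ s j, algebraMap _ (RatFunc K) Δ • (x s * m' j) =
      ∑ i, algebraMap _ (RatFunc K) (γ s i j) • m i)
    {v : κ → PowerSeries K}
    (hv : ∀ i, ∑ j, (∑ s, (γ s i j : PowerSeries K) * y s) * v j = 0) : v = 0 := by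
  let L := FractionRing (PowerSeries ℂ)
  have hinj : Function.Injective (algebraMap (Polynomial ℂ) L) := by
    rw [IsScalarTower.algebraMap_eq (Polynomial ℂ) (PowerSeries ℂ) L]
    exact (IsFractionRing.injective (PowerSeries ℂ) L).comp (Polynomial.coe_injective ℂ)
  let _ : Algebra (RatFunc ℂ) L := (IsFractionRing.lift hinj).toAlgebra
  have : IsScalarTower (Polynomial ℂ) (RatFunc ℂ) L := IsScalarTower.of_algebraMap_eq fun p =>
    (IsFractionRing.lift_algebraMap hinj p).symm
  let j : Polynomial K →+* L := (algebraMap (Polynomial ℂ) L).comp (Polynomial.mapRingHom φ)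
  have hj : Function.Injective j := hinj.comp (Polynomial.map_injective φ φ.injective)
  let _ : Algebra (Polynomial K) L := j.toAlgebra
  let _ : Algebra (RatFunc K) L := (IsFractionRing.lift hj).toAlgebra
  have : IsScalarTower (Polynomial K) (RatFunc K) L := IsScalarTower.of_algebraMap_eq fun p =>
    (IsFractionRing.lift_algebraMap hj p).symm
  have : CharZero L := charZero_of_injective_ringHom
    (f := (algebraMap (PowerSeries ℂ) L).comp PowerSeries.C) (RingHom.injective _)
  exact eq_zero_of_mahler_matrix_aux (L := L) φ (fun p => rfl) hq hq0 hy hD₁ hD₂ hc hd hx hm' hΔ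
    hγ hv

section Counting

variable {K μ κ : Type*} [Field K] [Fintype μ] [Fintype κ]

lemma exists_submatrix_det_ne_zero {R : Type*} [CommRing R] [IsDomain R] (c : Matrix μ κ R)
    (hc : ∀ v : κ → R, c.mulVec v = 0 → v = 0) :
    ∃ e : κ → μ, Function.Injective e ∧ (c.submatrix e id).det ≠ 0 := by
  let L := FractionRing R
  let C : Matrix μ κ L := c.map (algebraMap R L)
  have hcol : LinearIndependent L C.col := by
    rw [← LinearIndependent.iff_fractionRing R L, Fintype.linearIndependent_iff]
    intro g hg
    refine congrFun (hc g ?_)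
    funext i
    apply IsFractionRing.injective R L
    have := congrFun hg i
    simp only [Finset.sum_apply, Pi.zero_apply, Algebra.smul_def] at this
    rw [Pi.zero_apply, map_zero, ← this, Matrix.mulVec, dotProduct, map_sum]
    exact Finset.sum_congr rfl fun j _ => by rw [map_mul, mul_comm]; rfl
  have hrank : Module.finrank L (Submodule.span L (Set.range C.row)) = Fintype.card κ := by
    rw [← Matrix.rank_eq_finrank_span_row, ← Matrix.rank_transpose]
    exact LinearIndependent.rank_matrix (M := C.transpose) hcol
  have htop : Submodule.span L (Set.range C.row) = ⊤ :=
    Submodule.eq_top_of_finrank_eq (by rw [hrank, Module.finrank_fintype_fun_eq_card])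
  obtain ⟨ν, a, ha, hspan, hli⟩ := exists_linearIndependent' L C.row
  have : Finite ν := Finite.of_injective a ha
  let _ : Fintype ν := Fintype.ofFinite ν
  have hcard : Fintype.card ν = Fintype.card κ := by
    rw [← hrank, ← hspan, finrank_span_eq_card hli]
  let f : κ ≃ ν := (Fintype.equivOfCardEq hcard).symm
  refine ⟨a ∘ f, ha.comp f.injective, fun h0 => ?_⟩
  have h1 : LinearIndependent L (C.submatrix (a ∘ f) id).row := hli.comp f f.injective
  have h2 := Matrix.linearIndependent_rows_iff_isUnit.1 h1
  rw [Matrix.isUnit_iff_isUnit_det] at h2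
  have h3 : (C.submatrix (a ∘ f) id).det = algebraMap R L (c.submatrix (a ∘ f) id).det := by
    rw [RingHom.map_det]; rfl
  rw [h3, h0, map_zero] at h2
  exact not_isUnit_zero h2

/-- Hermite–Padé approximation modulo the image of an injective matrix. -/
theorem exists_approximants (c : Matrix μ κ (PowerSeries K))
    (hc : ∀ v : κ → PowerSeries K, c.mulVec v = 0 → v = 0) :
    Fintype.card κ ≤ Fintype.card μ ∧ ∃ a : ℕ, ∀ N δ : ℕ,
      (Fintype.card μ - Fintype.card κ) * N < Fintype.card μ * (δ + 1) →
      ∃ (P : μ → Polynomial K) (H : κ → Polynomial K), P ≠ 0 ∧ (∀ i, (P i).natDegree ≤ δ) ∧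
        ∀ i, PowerSeries.X ^ N ∣ PowerSeries.X ^ a * (P i : PowerSeries K) -
          ∑ j, c i j * (H j : PowerSeries K) := by
  obtain ⟨e, he, hdet⟩ := exists_submatrix_det_ne_zero c hc
  refine ⟨Fintype.card_le_of_injective e he, ?_⟩
  obtain ⟨a, u, hu⟩ : ∃ (a : ℕ) (u : (PowerSeries K)ˣ),
      (c.submatrix e id).det * (u : PowerSeries K) = PowerSeries.X ^ a :=
    IsDiscreteValuationRing.associated_pow_irreducible hdet PowerSeries.X_prime.irreducible
  refine ⟨a, fun N δ hN => ?_⟩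
  let A : Matrix κ κ (PowerSeries K) := (u : PowerSeries K) • (c.submatrix e id).adjugate
  have hA : c.submatrix e id * A = (PowerSeries.X ^ a : PowerSeries K) • 1 := by
    simp only [A, Matrix.mul_smul, Matrix.mul_adjugate, smul_smul, mul_comm _ (Matrix.det _), hu]
  let w := {i : μ // i ∉ Set.range e}
  have hw : Fintype.card w = Fintype.card μ - Fintype.card κ := by
    simp only [w]
    rw [Fintype.card_subtype_compl]
    congr 1
    exact Fintype.card_congr (Equiv.ofInjective e he).symm
  let toP : (μ → Fin (δ + 1) → K) →ₗ[K] (μ → PowerSeries K) :=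
    { toFun := fun b i => ∑ t, PowerSeries.C (b i t) * PowerSeries.X ^ (t : ℕ)
      map_add' := by
        intro b b'; funext i
        simp [add_mul, Finset.sum_add_distrib]
      map_smul' := by
        intro r b; funext i
        simp [Finset.smul_sum, PowerSeries.smul_eq_C_mul, mul_assoc] }
  let T : (μ → Fin (δ + 1) → K) →ₗ[K] (w → Fin N → K) :=
    { toFun := fun b i n => PowerSeries.coeff (n : ℕ)
        (PowerSeries.X ^ a * toP b i - ∑ j, c i j * (A.mulVec fun l => toP b (e l)) j)
      map_add' := by
        intro b b'; funext i n
        simp only [map_add, Pi.add_apply, Matrix.mulVec, dotProduct, mul_add,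
          Finset.sum_add_distrib, map_sub, map_sum]
        ring
      map_smul' := by
        intro r b; funext i n
        simp only [map_smul, Pi.smul_apply, Matrix.mulVec, dotProduct, map_sub, map_sum,
          smul_eq_mul, RingHom.id_apply, mul_smul_comm, ← Finset.smul_sum, mul_sub] }
  have hker : LinearMap.ker T ≠ ⊥ := by
    apply LinearMap.ker_ne_bot_of_finrank_lt
    simp only [Module.finrank_pi_fintype, Module.finrank_self, Finset.sum_const, Finset.card_univ,
      smul_eq_mul, mul_one, Fintype.card_fin]
    rw [hw]
    exact hN
  obtain ⟨b, hb, hb0⟩ := Submodule.exists_mem_ne_zero_of_ne_bot hker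
  let P : μ → Polynomial K := fun i => ∑ t : Fin (δ + 1), Polynomial.monomial (t : ℕ) (b i t)
  have hP : ∀ i, (P i : PowerSeries K) = toP b i := by
    intro i
    simp only [P, toP]
    ext n
    simp [Polynomial.finsetSum_coeff, Polynomial.coeff_monomial, PowerSeries.coeff_X_pow, eq_comm]
  let V : κ → PowerSeries K := A.mulVec fun l => (P (e l) : PowerSeries K)
  refine ⟨P, fun j => PowerSeries.trunc N (V j), fun h0 => hb0 ?_, fun i => ?_, fun i => ?_⟩
  · funext i t
    have h1 := congrArg (fun p : Polynomial K => p.coeff (t : ℕ)) (congrFun h0 i)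
    simp only [P, Polynomial.finsetSum_coeff, Polynomial.coeff_monomial, Pi.zero_apply,
      Polynomial.coeff_zero, Fin.val_inj, Finset.sum_ite_eq', Finset.mem_univ, if_true] at h1
    simpa using h1
  · refine Polynomial.natDegree_sum_le_of_forall_le _ _ fun t _ => ?_
    exact (Polynomial.natDegree_monomial_le _).trans (Nat.lt_succ_iff.1 t.2)
  · have h1 : PowerSeries.X ^ N ∣ PowerSeries.X ^ a * (P i : PowerSeries K) - ∑ j, c i j * V j := by
      by_cases hi : i ∈ Set.range e
      · obtain ⟨l, rfl⟩ := hi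
        have h2 : ∑ j, c (e l) j * V j = PowerSeries.X ^ a * (P (e l) : PowerSeries K) := by
          have h3 : (c.submatrix e id).mulVec V =
              (PowerSeries.X ^ a : PowerSeries K) • fun l => (P (e l) : PowerSeries K) := by
            simp only [V]
            rw [Matrix.mulVec_mulVec, hA, Matrix.smul_mulVec, Matrix.one_mulVec]
          exact congrFun h3 l
        rw [h2, sub_self]
        exact dvd_zero _
      · rw [PowerSeries.X_pow_dvd_iff]
        intro n hn
        have h2 := congrFun (congrFun (LinearMap.mem_ker.1 hb) ⟨i, hi⟩) ⟨n, hn⟩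
        simp only [T, LinearMap.coe_mk, AddHom.coe_mk, ← hP] at h2
        exact h2
    have h4 : PowerSeries.X ^ N ∣ ∑ j, c i j * (V j - (PowerSeries.trunc N (V j) : PowerSeries K)) := by
      refine Finset.dvd_sum fun j _ => Dvd.dvd.mul_left ?_ _
      rw [PowerSeries.X_pow_dvd_iff]
      intro n hn
      rw [map_sub, Polynomial.coeff_coe, PowerSeries.coeff_trunc, if_pos hn, sub_self]
    have := dvd_add h1 h4
    simp only [mul_sub, Finset.sum_sub_distrib] at this
    simpa using this

end Counting

section Size

variable {K : Type*} [Field K]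

/-- `HasSize D A x` : `D` is a denominator of `x` and all its conjugates are bounded by `A`. -/
def HasSize (D : ℕ) (A : ℝ) (x : K) : Prop :=
  IsIntegral ℤ ((D : K) * x) ∧ ∀ ψ : K →+* ℂ, ‖ψ x‖ ≤ A

lemma HasSize.mul {D D' : ℕ} {A A' : ℝ} (hA : 0 ≤ A) {x x' : K} (h : HasSize D A x)
    (h' : HasSize D' A' x') : HasSize (D * D') (A * A') (x * x') := by
  refine ⟨?_, fun ψ => ?_⟩
  · have := h.1.mul h'.1
    push_cast
    rwa [mul_mul_mul_comm] at this
  · rw [map_mul, norm_mul]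
    exact mul_le_mul (h.2 ψ) (h'.2 ψ) (norm_nonneg _) hA

lemma HasSize.mono {D D' : ℕ} {A A' : ℝ} {x : K} (h : HasSize D A x) (hD : D ∣ D') (hA : A ≤ A') :
    HasSize D' A' x := by
  obtain ⟨e, rfl⟩ := hD
  refine ⟨?_, fun ψ => (h.2 ψ).trans hA⟩
  have := (isIntegral_algebraMap (R := ℤ) (A := K) (x := (e : ℤ))).mul h.1
  simp only [algebraMap_int_eq, eq_intCast, Int.cast_natCast] at this
  rwa [Nat.cast_mul, mul_comm (D : K), mul_assoc]

lemma HasSize.add {D : ℕ} {A A' : ℝ} {x x' : K} (h : HasSize D A x) (h' : HasSize D A' x') :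
    HasSize D (A + A') (x + x') := by
  refine ⟨?_, fun ψ => ?_⟩
  · rw [mul_add]; exact h.1.add h'.1
  · rw [map_add]; exact (norm_add_le _ _).trans (add_le_add (h.2 ψ) (h'.2 ψ))

lemma HasSize.sum {ι : Type*} {s : Finset ι} {D : ℕ} {A : ι → ℝ} {x : ι → K}
    (h : ∀ i ∈ s, HasSize D (A i) (x i)) : HasSize D (∑ i ∈ s, A i) (∑ i ∈ s, x i) := by
  refine ⟨?_, fun ψ => ?_⟩
  · rw [Finset.mul_sum]; exact IsIntegral.sum _ fun i hi => (h i hi).1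
  · rw [map_sum]; exact (norm_sum_le _ _).trans (Finset.sum_le_sum fun i hi => (h i hi).2 ψ)

lemma HasSize.one {A : ℝ} (hA : 1 ≤ A) : HasSize 1 A (1 : K) :=
  ⟨by simp [isIntegral_one], fun ψ => by simpa using hA⟩

lemma HasSize.prod {ι : Type*} {s : Finset ι} {D : ι → ℕ} {A : ι → ℝ} {x : ι → K}
    (hA : ∀ i ∈ s, 0 ≤ A i)
    (h : ∀ i ∈ s, HasSize (D i) (A i) (x i)) :
    HasSize (∏ i ∈ s, D i) (∏ i ∈ s, A i) (∏ i ∈ s, x i) := by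
  induction s using Finset.induction_on with
  | empty => simpa using HasSize.one le_rfl
  | insert i s hi ih =>
    rw [Finset.prod_insert hi, Finset.prod_insert hi, Finset.prod_insert hi]
    exact (h i (by simp)).mul (hA i (by simp))
      (ih (fun j hj => hA j (by simp [hj])) fun j hj => h j (by simp [hj]))

lemma HasSize.pow {D : ℕ} {A : ℝ} (hA : 0 ≤ A) {x : K} (h : HasSize D A x) (n : ℕ) :
    HasSize (D ^ n) (A ^ n) (x ^ n) := by
  simpa using HasSize.prod (s := Finset.range n) (D := fun _ => D) (A := fun _ => A)
    (x := fun _ => x) (fun _ _ => hA) (fun _ _ => h)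

variable [NumberField K]

lemma exists_hasSize (x : K) : ∃ B : ℕ, 1 ≤ B ∧ HasSize B B x := by
  have halg : IsAlgebraic ℤ x :=
    (IsFractionRing.isAlgebraic_iff ℤ ℚ K).2 (Algebra.IsAlgebraic.isAlgebraic x)
  obtain ⟨y, hy0, hy⟩ := halg.exists_integral_multiple
  have : Fintype (K →+* ℂ) := inferInstance
  obtain ⟨M, hM⟩ := exists_nat_ge (∑ ψ : K →+* ℂ, ‖ψ x‖)
  have hyn : y.natAbs ≠ 0 := Int.natAbs_ne_zero.2 hy0
  refine ⟨y.natAbs * (M + 1), Nat.mul_pos (Nat.pos_of_ne_zero hyn) (Nat.succ_pos M), ?_⟩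
  have h1 : HasSize y.natAbs M x := by
    refine ⟨?_, fun ψ => ?_⟩
    · rw [Algebra.smul_def, algebraMap_int_eq, eq_intCast] at hy
      rcases Int.natAbs_eq y with h | h
      · rw [h] at hy; simpa using hy
      · rw [h] at hy
        simpa using hy.neg
    · exact (Finset.single_le_sum (f := fun ψ : K →+* ℂ => ‖ψ x‖) (fun _ _ => norm_nonneg _)
        (Finset.mem_univ ψ)).trans hM
  refine h1.mono (Dvd.intro _ rfl) ?_
  push_cast
  have : (1 : ℝ) ≤ y.natAbs := by exact_mod_cast Nat.pos_of_ne_zero hyn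
  nlinarith [Nat.cast_nonneg (α := ℝ) M]

/-- Liouville's inequality. -/
lemma HasSize.le_norm {D : ℕ} {A : ℝ} {x : K} (h : HasSize D A x) (hx : x ≠ 0) (hD : 1 ≤ D)
    (hA : 1 ≤ A) (φ : K →+* ℂ) : 1 ≤ (D * A) ^ Module.finrank ℚ K * ‖φ x‖ := by
  have hDx : (D : K) * x ≠ 0 := mul_ne_zero (by exact_mod_cast (by omega : D ≠ 0)) hx
  have h1 : (1 : ℝ) ≤ ‖algebraMap ℚ ℂ (Algebra.norm ℚ ((D : K) * x))‖ := by
    obtain ⟨n, hn⟩ := IsIntegrallyClosed.isIntegral_iff.1 (Algebra.isIntegral_norm ℚ h.1)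
    have hn0 : n ≠ 0 := by
      rintro rfl
      rw [map_zero] at hn
      exact hDx (Algebra.norm_eq_zero_iff.1 hn.symm)
    rw [← hn]
    simp only [algebraMap_int_eq, eq_intCast, map_intCast, Complex.norm_intCast]
    exact_mod_cast Int.one_le_abs hn0
  rw [Algebra.norm_eq_prod_embeddings ℚ ℂ, norm_prod] at h1
  have hDA : 1 ≤ D * A := by
    have : (1 : ℝ) ≤ D := by exact_mod_cast hD
    nlinarith
  have h2 : ∀ σ : K →ₐ[ℚ] ℂ, ‖σ ((D : K) * x)‖ ≤ D * A := by
    intro σ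
    rw [map_mul, map_natCast, norm_mul, Complex.norm_natCast]
    exact mul_le_mul_of_nonneg_left (h.2 σ) (Nat.cast_nonneg _)
  let σ₀ : K →ₐ[ℚ] ℂ := φ.toRatAlgHom
  rw [← Finset.mul_prod_erase _ _ (Finset.mem_univ σ₀)] at h1
  have h3 : ∏ σ ∈ Finset.univ.erase σ₀, ‖σ ((D : K) * x)‖ ≤ (D * A) ^ (Module.finrank ℚ K - 1) := by
    refine (Finset.prod_le_prod (fun _ _ => norm_nonneg _) fun σ _ => h2 σ).trans ?_
    rw [Finset.prod_const, Finset.card_erase_of_mem (Finset.mem_univ _), Finset.card_univ,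
      AlgHom.card]
  have h4 : ‖σ₀ ((D : K) * x)‖ ≤ D * A * ‖φ x‖ := by
    rw [map_mul, map_natCast, norm_mul, Complex.norm_natCast]
    change D * ‖φ x‖ ≤ _
    have : 0 ≤ D * ‖φ x‖ := by positivity
    nlinarith
  have hn : Module.finrank ℚ K ≠ 0 := Module.finrank_pos.ne'
  calc 1 ≤ _ := h1
    _ ≤ D * A * ‖φ x‖ * (D * A) ^ (Module.finrank ℚ K - 1) :=
      mul_le_mul h4 h3 (Finset.prod_nonneg fun _ _ => norm_nonneg _) (by positivity)
    _ = _ := by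
      obtain ⟨m, hm⟩ := Nat.exists_eq_succ_of_ne_zero hn
      rw [hm]; simp only [Nat.succ_eq_add_one, Nat.add_sub_cancel]; ring

end Size

section Geometric

variable {K : Type*} [Field K]

/-- The size of `x k` grows at most like `B ^ (q ^ k)`. -/
def HasGeomSize (q : ℕ) (x : ℕ → K) : Prop :=
  ∃ B : ℕ, 1 ≤ B ∧ ∀ k, HasSize (B ^ q ^ k) ((B : ℝ) ^ q ^ k) (x k)

lemma HasSize.mono_geom {B B' : ℕ} (hB' : 1 ≤ B') (h : B ∣ B') {e : ℕ} {x : K}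
    (hx : HasSize (B ^ e) ((B : ℝ) ^ e) x) : HasSize (B' ^ e) ((B' : ℝ) ^ e) x :=
  hx.mono (pow_dvd_pow_of_dvd h e)
    (pow_le_pow_left₀ (Nat.cast_nonneg _) (by exact_mod_cast Nat.le_of_dvd hB' h) e)

variable {q : ℕ}

lemma HasGeomSize.mul {x y : ℕ → K} (hx : HasGeomSize q x) (hy : HasGeomSize q y) :
    HasGeomSize q fun k => x k * y k := by
  obtain ⟨B, hB, hx⟩ := hx
  obtain ⟨B', hB', hy⟩ := hy
  refine ⟨B * B', Nat.mul_pos hB hB', fun k => ?_⟩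
  have := (hx k).mul (by positivity) (hy k)
  rwa [← mul_pow, ← mul_pow, ← Nat.cast_mul] at this

lemma HasGeomSize.add (hq : q ≠ 0) {x y : ℕ → K} (hx : HasGeomSize q x) (hy : HasGeomSize q y) :
    HasGeomSize q fun k => x k + y k := by
  obtain ⟨B, hB, hx⟩ := hx
  obtain ⟨B', hB', hy⟩ := hy
  have hpos : 1 ≤ B * B' := Nat.mul_pos hB hB'
  refine ⟨2 * (B * B'), by omega, fun k => ?_⟩
  have h1 := ((hx k).mono_geom hpos (Dvd.intro _ rfl)).add
    ((hy k).mono_geom hpos (Dvd.intro_left _ rfl))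
  refine h1.mono (pow_dvd_pow_of_dvd (Dvd.intro_left _ rfl) _) ?_
  push_cast
  rw [← two_mul, mul_pow 2]
  refine mul_le_mul_of_nonneg_right ?_ (by positivity)
  exact le_self_pow₀ one_le_two (pow_ne_zero _ hq)

lemma exists_common_hasGeomSize {ι : Type*} [Finite ι] {x : ι → ℕ → K}
    (hx : ∀ i, HasGeomSize q (x i)) :
    ∃ B : ℕ, 1 ≤ B ∧ ∀ i k, HasSize (B ^ q ^ k) ((B : ℝ) ^ q ^ k) (x i k) := by
  let _ := Fintype.ofFinite ι
  choose B hB h using hx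
  have hpos : 1 ≤ ∏ i, B i := Nat.one_le_iff_ne_zero.2
    (Finset.prod_ne_zero_iff.2 fun i _ => Nat.one_le_iff_ne_zero.1 (hB i))
  exact ⟨∏ i, B i, hpos, fun i k => (h i k).mono_geom hpos (Finset.dvd_prod_of_mem B (Finset.mem_univ i))⟩

variable [NumberField K]

lemma hasGeomSize_const (hq : q ≠ 0) (x : K) : HasGeomSize q fun _ => x := by
  obtain ⟨B, hB, h⟩ := exists_hasSize x
  refine ⟨B, hB, fun k => h.mono (dvd_pow_self _ (pow_ne_zero _ hq)) ?_⟩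
  exact le_self_pow₀ (by exact_mod_cast hB) (pow_ne_zero _ hq)

lemma hasGeomSize_pow (β : K) : HasGeomSize q fun k => β ^ q ^ k := by
  obtain ⟨B, hB, h⟩ := exists_hasSize β
  exact ⟨B, hB, fun k => h.pow (Nat.cast_nonneg _) _⟩

lemma hasGeomSize_eval (hq : q ≠ 0) (β : K) (p : Polynomial K) :
    HasGeomSize q fun k => p.eval (β ^ q ^ k) := by
  induction p using Polynomial.induction_on' with
  | add p r hp hr => simpa using hp.add hq hr
  | monomial n a =>
    simp only [Polynomial.eval_monomial]
    refine (hasGeomSize_const hq a).mul ?_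
    induction n with
    | zero => simpa using hasGeomSize_const hq (1 : K)
    | succ n ih => simpa only [pow_succ] using ih.mul (hasGeomSize_pow β)

/-- Sizes along a linear recurrence with coefficients of geometric size. -/
lemma hasGeomSize_recurrence (hq : 2 ≤ q) {ι : Type*} [Fintype ι] {r : ℕ → ι → K}
    {M : ι → ι → ℕ → K} (hM : ∀ s j, HasGeomSize q (M s j))
    (hr : ∀ k j, r (k + 1) j = ∑ s, r k s * M s j k) :
    ∃ B : ℕ, 1 ≤ B ∧ ∀ k j, HasSize (B ^ q ^ k) ((B : ℝ) ^ q ^ k) (r k j) := by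
  have hq0 : q ≠ 0 := by omega
  obtain ⟨B₁, hB₁, h₁⟩ := exists_common_hasGeomSize (ι := ι × ι) (x := fun p => M p.1 p.2)
    (fun p => hM _ _)
  obtain ⟨B₂, hB₂, h₂⟩ := exists_common_hasGeomSize (ι := ι) (x := fun j (_ : ℕ) => r 0 j)
    (fun j => hasGeomSize_const hq0 _)
  let N := Fintype.card ι + 1
  have hN : 1 ≤ N := Nat.succ_pos _
  have hpos : 1 ≤ N * B₁ * B₂ := Nat.mul_pos (Nat.mul_pos hN hB₁) hB₂
  refine ⟨N * B₁ * B₂, hpos, fun k => ?_⟩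
  induction k with
  | zero => exact fun j => (h₂ j 0).mono_geom hpos (Dvd.intro_left _ rfl)
  | succ k ih =>
    intro j
    rw [hr]
    have h3 := HasSize.sum (s := Finset.univ) fun s _ => (ih s).mul (by positivity) (h₁ (s, j) k)
    have hexp : q ^ k + q ^ k ≤ q ^ (k + 1) := by
      rw [pow_succ, ← mul_two]; exact Nat.mul_le_mul_left _ hq
    have hB1 : (1 : ℝ) ≤ ((N * B₁ * B₂ : ℕ) : ℝ) := by exact_mod_cast hpos
    refine h3.mono ?_ ?_
    · refine dvd_trans ?_ (pow_dvd_pow _ hexp)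
      rw [pow_add]
      refine mul_dvd_mul_left _ (pow_dvd_pow_of_dvd ⟨N * B₂, by ring⟩ _)
    · rw [Finset.sum_const, Finset.card_univ, nsmul_eq_mul]
      refine le_trans ?_ (pow_le_pow_right₀ hB1 hexp)
      rw [pow_add, mul_left_comm]
      refine mul_le_mul_of_nonneg_left ?_ (by positivity)
      have e1 : (Fintype.card ι : ℝ) ≤ (N : ℝ) ^ q ^ k := by
        refine le_trans ?_ (le_self_pow₀ (by exact_mod_cast hN) (pow_ne_zero _ hq0))
        simp [N]
      have e2 : (B₁ : ℝ) ^ q ^ k ≤ ((B₁ * B₂ : ℕ) : ℝ) ^ q ^ k := by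
        refine pow_le_pow_left₀ (Nat.cast_nonneg _) ?_ _
        exact_mod_cast Nat.le_mul_of_pos_right _ hB₂
      calc (Fintype.card ι : ℝ) * (B₁ : ℝ) ^ q ^ k
          ≤ (N : ℝ) ^ q ^ k * ((B₁ * B₂ : ℕ) : ℝ) ^ q ^ k := by gcongr
        _ = ((N * B₁ * B₂ : ℕ) : ℝ) ^ q ^ k := by
          rw [← mul_pow]; congr 1; push_cast; ring

end Geometric

section Convergence

/-- The power series `u` converges absolutely on the closed disk of radius `ρ`. -/
def IsConv (ρ : ℝ) (u : PowerSeries ℂ) : Prop :=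
  Summable fun n => ‖PowerSeries.coeff n u‖ * ρ ^ n

variable {ρ : ℝ} {u v : PowerSeries ℂ} {z : ℂ}

lemma IsConv.mono (hu : IsConv ρ u) {ρ' : ℝ} (h0 : 0 ≤ ρ') (h : ρ' ≤ ρ) : IsConv ρ' u :=
  Summable.of_nonneg_of_le (fun n => by positivity)
    (fun n => mul_le_mul_of_nonneg_left (pow_le_pow_left₀ h0 h n) (norm_nonneg _)) hu

lemma IsConv.summable_norm (hu : IsConv ρ u) (hz : ‖z‖ ≤ ρ) :
    Summable fun n => ‖PowerSeries.coeff n u * z ^ n‖ := by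
  have := hu.mono (norm_nonneg z) hz
  simpa only [IsConv, norm_mul, norm_pow] using this

lemma IsConv.hasSum (hu : IsConv ρ u) (hz : ‖z‖ ≤ ρ) :
    HasSum (fun n => PowerSeries.coeff n u * z ^ n) (psEval u z) :=
  (hu.summable_norm hz).of_norm.hasSum

lemma IsConv.add (hρ : 0 ≤ ρ) (hu : IsConv ρ u) (hv : IsConv ρ v) : IsConv ρ (u + v) := by
  refine Summable.of_nonneg_of_le (fun n => by positivity) (fun n => ?_) (Summable.add hu hv)
  rw [map_add, ← add_mul]
  exact mul_le_mul_of_nonneg_right (norm_add_le _ _) (by positivity)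

lemma IsConv.mul (hρ : 0 ≤ ρ) (hu : IsConv ρ u) (hv : IsConv ρ v) : IsConv ρ (u * v) := by
  have habs : ‖(ρ : ℂ)‖ = ρ := by simpa using hρ
  have h := summable_norm_sum_mul_antidiagonal_of_summable_norm (hu.summable_norm habs.le)
    (hv.summable_norm habs.le)
  refine h.congr fun n => ?_
  rw [PowerSeries.coeff_mul]
  conv_rhs => rw [← habs, ← norm_pow, ← norm_mul, Finset.sum_mul]
  congr 1
  refine Finset.sum_congr rfl fun p hp => ?_
  rw [← Finset.HasAntidiagonal.mem_antidiagonal.1 hp, pow_add]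
  ring

lemma isConv_coe (ρ : ℝ) (p : Polynomial ℂ) : IsConv ρ (p : PowerSeries ℂ) := by
  refine summable_of_hasFiniteSupport ((Finset.finite_toSet p.support).subset fun n hn => ?_)
  simp only [Function.mem_support, Polynomial.coeff_coe] at hn
  simp only [Finset.mem_coe, Polynomial.mem_support_iff]
  intro h0; simp [h0] at hn

lemma isConv_zero (ρ : ℝ) : IsConv ρ 0 := by
  simpa using isConv_coe ρ 0

lemma IsConv.sum (hρ : 0 ≤ ρ) {ι : Type*} {s : Finset ι} {u : ι → PowerSeries ℂ}
    (h : ∀ i ∈ s, IsConv ρ (u i)) : IsConv ρ (∑ i ∈ s, u i) := by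
  induction s using Finset.induction_on with
  | empty => simpa using isConv_zero ρ
  | insert i s hi ih =>
    rw [Finset.sum_insert hi]
    exact (h i (by simp)).add hρ (ih fun j hj => h j (by simp [hj]))

lemma psEval_coe (p : Polynomial ℂ) (z : ℂ) : psEval p z = p.eval z := by
  rw [psEval, Polynomial.eval_eq_sum, Polynomial.sum, tsum_eq_sum (s := p.support)]
  · simp
  · intro n hn
    simp [Polynomial.notMem_support_iff.1 hn]

lemma psEval_add (hu : IsConv ρ u) (hv : IsConv ρ v) (hz : ‖z‖ ≤ ρ) :
    psEval (u + v) z = psEval u z + psEval v z := by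
  refine HasSum.tsum_eq ?_
  simpa only [map_add, add_mul] using (hu.hasSum hz).add (hv.hasSum hz)

lemma psEval_mul (hu : IsConv ρ u) (hv : IsConv ρ v) (hz : ‖z‖ ≤ ρ) :
    psEval (u * v) z = psEval u z * psEval v z := by
  simp only [psEval]
  rw [tsum_mul_tsum_eq_tsum_sum_antidiagonal_of_summable_norm (hu.summable_norm hz)
    (hv.summable_norm hz)]
  congr 1
  funext n
  rw [PowerSeries.coeff_mul, Finset.sum_mul]
  refine Finset.sum_congr rfl fun p hp => ?_
  rw [← Finset.HasAntidiagonal.mem_antidiagonal.1 hp, pow_add]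
  ring

lemma psEval_zero (z : ℂ) : psEval 0 z = 0 := by simp [psEval]

lemma psEval_sum (hρ : 0 ≤ ρ) {ι : Type*} {s : Finset ι} {u : ι → PowerSeries ℂ}
    (h : ∀ i ∈ s, IsConv ρ (u i)) (hz : ‖z‖ ≤ ρ) :
    psEval (∑ i ∈ s, u i) z = ∑ i ∈ s, psEval (u i) z := by
  induction s using Finset.induction_on with
  | empty => simpa using psEval_zero z
  | insert i s hi ih =>
    rw [Finset.sum_insert hi, Finset.sum_insert hi,
      psEval_add (h i (by simp)) (IsConv.sum hρ fun j hj => h j (by simp [hj])) hz,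
      ih fun j hj => h j (by simp [hj])]

lemma psEval_coe_mul (p : Polynomial ℂ) (hu : IsConv ρ u) (hz : ‖z‖ ≤ ρ) :
    psEval (p * u) z = p.eval z * psEval u z := by
  rw [psEval_mul (isConv_coe ρ p) hu hz, psEval_coe]

lemma psEval_expand {q : ℕ} (hq : q ≠ 0) (u : PowerSeries ℂ) (z : ℂ) :
    psEval (PowerSeries.expand q hq u) z = psEval u (z ^ q) := by
  have hinj : Function.Injective fun n : ℕ => q * n := fun a b h =>
    Nat.eq_of_mul_eq_mul_left (Nat.pos_of_ne_zero hq) h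
  simp only [psEval]
  rw [← hinj.tsum_eq]
  · simp only [PowerSeries.coeff_expand_mul, pow_mul]
  · intro n hn
    by_contra h
    apply hn
    simp only
    rw [PowerSeries.coeff_expand_of_not_dvd _ _ _ fun ⟨m, hm⟩ => h ⟨m, hm.symm⟩, zero_mul]

lemma IsConv.expand (hρ : 0 ≤ ρ) (hρ1 : ρ ≤ 1) {q : ℕ} (hq : q ≠ 0) (hu : IsConv ρ u) :
    IsConv ρ (PowerSeries.expand q hq u) := by
  have hinj : Function.Injective fun n : ℕ => q * n := fun a b h =>
    Nat.eq_of_mul_eq_mul_left (Nat.pos_of_ne_zero hq) h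
  refine (hinj.summable_iff fun n hn => ?_).1 ?_
  · rw [PowerSeries.coeff_expand_of_not_dvd _ _ _ fun ⟨m, hm⟩ => hn ⟨m, hm.symm⟩]; simp
  · refine Summable.of_nonneg_of_le (fun n => by simp only [Function.comp]; positivity)
      (fun n => ?_) hu
    simp only [Function.comp, PowerSeries.coeff_expand_mul]
    refine mul_le_mul_of_nonneg_left ?_ (norm_nonneg _)
    exact pow_le_pow_of_le_one hρ hρ1 (Nat.le_mul_of_pos_left n (Nat.pos_of_ne_zero hq))

lemma IsConv.exists_bound_of_X_pow_dvd (hρ : 0 < ρ) (hu : IsConv ρ u) {N : ℕ}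
    (hN : PowerSeries.X ^ N ∣ u) :
    ∃ B : ℝ, 0 ≤ B ∧ ∀ z : ℂ, ‖z‖ ≤ ρ → ‖psEval u z‖ ≤ B * ‖z‖ ^ N := by
  refine ⟨∑' n, ‖PowerSeries.coeff n u‖ * ρ ^ n * (ρ ^ N)⁻¹, tsum_nonneg fun n => by positivity,
    fun z hz => ?_⟩
  have hs : Summable fun n => ‖PowerSeries.coeff n u‖ * ρ ^ n * (ρ ^ N)⁻¹ := Summable.mul_right _ hu
  refine (norm_tsum_le_tsum_norm (hu.summable_norm hz)).trans ?_
  rw [← tsum_mul_right]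
  refine Summable.tsum_le_tsum (fun n => ?_) (hu.summable_norm hz) (hs.mul_right _)
  rw [PowerSeries.X_pow_dvd_iff] at hN
  by_cases hn : n < N
  · rw [hN n hn]; simp
  · obtain ⟨m, rfl⟩ := Nat.exists_eq_add_of_le (not_lt.1 hn)
    rw [norm_mul, norm_pow, pow_add, pow_add, mul_assoc, mul_assoc]
    refine mul_le_mul_of_nonneg_left ?_ (norm_nonneg _)
    have h1 : ρ ^ N * ρ ^ m * ((ρ ^ N)⁻¹ * ‖z‖ ^ N) = ρ ^ m * ‖z‖ ^ N := by
      field_simp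
    rw [h1, mul_comm]
    exact mul_le_mul_of_nonneg_right (pow_le_pow_left₀ (norm_nonneg _) hz m) (by positivity)

end Convergence

section AuxiliaryEstimate

variable {K : Type*} [Field K] [NumberField K] {μ κ : Type*} [Fintype μ] [Fintype κ]

lemma exists_hasSize_sum_eval (P : μ → Polynomial K) {δ : ℕ} (hP : ∀ i, (P i).natDegree ≤ δ)
    {B : ℕ} (hB : 1 ≤ B) (d : ℕ) :
    ∃ C : ℕ, 1 ≤ C ∧ ∀ (e : ℕ) (z : K) (m : μ → K), HasSize (B ^ e) ((B : ℝ) ^ e) z →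
      (∀ i, HasSize (B ^ (e * d)) ((B : ℝ) ^ (e * d)) (m i)) →
      HasSize (C * B ^ (e * (d + δ))) (C * (B : ℝ) ^ (e * (d + δ)))
        (∑ i, (P i).eval z * m i) := by
  choose C hC hs using fun p : μ × Fin (δ + 1) => exists_hasSize ((P p.1).coeff p.2)
  let C₀ := ∏ p, C p
  have hC₀ : 1 ≤ C₀ := Nat.one_le_iff_ne_zero.2
    (Finset.prod_ne_zero_iff.2 fun p _ => Nat.one_le_iff_ne_zero.1 (hC p))
  let n := Fintype.card (μ × Fin (δ + 1)) + 1
  have hB' : (1 : ℝ) ≤ B := by exact_mod_cast hB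
  refine ⟨n * C₀, Nat.mul_pos (Nat.succ_pos _) hC₀, fun e z m hz hm => ?_⟩
  have hterm : ∀ p : μ × Fin (δ + 1), HasSize (C₀ * B ^ (e * (d + δ)))
      (C₀ * (B : ℝ) ^ (e * (d + δ))) ((P p.1).coeff p.2 * (z ^ (p.2 : ℕ) * m p.1)) := by
    intro p
    have h1 := (hs p).mono (D' := C₀) (A' := (C₀ : ℝ))
      (Finset.dvd_prod_of_mem C (Finset.mem_univ p))
      (by exact_mod_cast Nat.le_of_dvd hC₀ (Finset.dvd_prod_of_mem C (Finset.mem_univ p)))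
    refine h1.mul (Nat.cast_nonneg _) (((hz.pow (by positivity) p.2).mul (by positivity)
      (hm p.1)).mono ?_ ?_)
    · rw [← pow_mul, ← pow_add, ← mul_add]
      exact pow_dvd_pow _ (Nat.mul_le_mul_left _ (by omega))
    · rw [← pow_mul, ← pow_add, ← mul_add]
      exact pow_le_pow_right₀ hB' (Nat.mul_le_mul_left _ (by omega))
  have hsum := HasSize.sum (s := Finset.univ) fun p _ => hterm p
  have heq : ∑ i, (P i).eval z * m i =
      ∑ p : μ × Fin (δ + 1), (P p.1).coeff p.2 * (z ^ (p.2 : ℕ) * m p.1) := by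
    rw [Fintype.sum_prod_type]
    refine Finset.sum_congr rfl fun i _ => ?_
    rw [Polynomial.eval_eq_sum_range' (Nat.lt_succ_of_le (hP i)), Finset.sum_range,
      Finset.sum_mul]
    exact Finset.sum_congr rfl fun l _ => by ring
  rw [heq]
  refine hsum.mono ⟨n, by ring⟩ ?_
  rw [Finset.sum_const, nsmul_eq_mul, Finset.card_univ, Nat.cast_mul, mul_assoc]
  refine mul_le_mul_of_nonneg_right ?_ (by positivity)
  simp [n]

lemma le_one_of_frequently_le_mul_pow {q : ℕ} (hq : 2 ≤ q) {x y C : ℝ} (hx : 0 < x) (hy : 0 ≤ y)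
    (h : ∃ᶠ k in Filter.atTop, x ^ q ^ k ≤ C * y ^ q ^ k) : x ≤ y := by
  by_contra! hlt
  have hθ0 : 0 ≤ y / x := by positivity
  have hθ1 : y / x < 1 := (div_lt_one hx).2 hlt
  have ht : Filter.Tendsto (fun k : ℕ => C * (y / x) ^ q ^ k) Filter.atTop (nhds (C * 0)) :=
    ((tendsto_pow_atTop_nhds_zero_of_lt_one hθ0 hθ1).comp
      (tendsto_pow_atTop_atTop_of_one_lt (by omega : 1 < q))).const_mul C
  rw [mul_zero] at ht
  have hev := ht.eventually (gt_mem_nhds zero_lt_one)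
  obtain ⟨k, h1, h2⟩ := (h.and_eventually hev).exists
  rw [div_pow, ← mul_div_assoc, div_lt_one (by positivity)] at h2
  linarith

variable (φ : K →+* ℂ) {q : ℕ}

/-- Comparison of the analytic upper bound and the arithmetic lower bound for the values of an
auxiliary form. -/
lemma norm_pow_le_of_frequently (hq : 2 ≤ q) {ρ : ℝ} (hρ1 : ρ < 1) {β : K} (hβ0 : β ≠ 0)
    (hβ : ‖φ β‖ ≤ ρ) {B : ℕ} (hB : 1 ≤ B)
    (hz : ∀ k, HasSize (B ^ q ^ k) ((B : ℝ) ^ q ^ k) (β ^ q ^ k)) {d : ℕ} {m : μ → ℕ → K}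
    (hm : ∀ i k, HasSize (B ^ (q ^ k * d)) ((B : ℝ) ^ (q ^ k * d)) (m i k))
    {c : μ → κ → PowerSeries K} (hc : ∀ i j, IsConv ρ (PowerSeries.map φ (c i j)))
    {P : μ → Polynomial K} {H : κ → Polynomial K} {δ a N : ℕ} (hP : ∀ i, (P i).natDegree ≤ δ)
    (hdvd : ∀ i, PowerSeries.X ^ N ∣ PowerSeries.X ^ a * (P i : PowerSeries K) -
      ∑ j, c i j * (H j : PowerSeries K))
    (hfreq : ∃ᶠ k in Filter.atTop, ∑ i, (P i).eval (β ^ q ^ k) * m i k ≠ 0 ∧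
      ∀ j, ∑ i, psEval (PowerSeries.map φ (c i j)) (φ β ^ q ^ k) * φ (m i k) = 0) :
    ‖φ β‖ ^ a ≤ ‖φ β‖ ^ N * ((B : ℝ) ^ (2 * Module.finrank ℚ K + 1)) ^ (d + δ) := by
  have hβpos : 0 < ‖φ β‖ := norm_pos_iff.2 ((map_ne_zero φ).2 hβ0)
  have hρ : 0 < ρ := hβpos.trans_le hβ
  have hβ1 : ‖φ β‖ < 1 := hβ.trans_lt hρ1
  have hB' : (1 : ℝ) ≤ B := by exact_mod_cast hB
  obtain ⟨C, hC, hsize⟩ := exists_hasSize_sum_eval P hP hB d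
  have hC' : (1 : ℝ) ≤ C := by exact_mod_cast hC
  let ε : μ → PowerSeries ℂ := fun i => PowerSeries.X ^ a * (((P i).map φ : Polynomial ℂ) : PowerSeries ℂ) -
    ∑ j, PowerSeries.map φ (c i j) * (((H j).map φ : Polynomial ℂ) : PowerSeries ℂ)
  have hε : ∀ i, ε i = PowerSeries.map φ (PowerSeries.X ^ a * (P i : PowerSeries K) -
      ∑ j, c i j * (H j : PowerSeries K)) := by
    intro i
    simp only [ε, map_sub, map_mul, map_pow, PowerSeries.map_X, map_sum,
      Polynomial.polynomial_map_coe]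
  have hεdvd : ∀ i, PowerSeries.X ^ N ∣ ε i := by
    intro i
    rw [hε]
    simpa using map_dvd (PowerSeries.map φ) (hdvd i)
  have hterm : ∀ i j, IsConv ρ (PowerSeries.map φ (c i j) * (((H j).map φ : Polynomial ℂ) : PowerSeries ℂ)) :=
    fun i j => (hc i j).mul hρ.le (isConv_coe _ _)
  have hεeq : ∀ i, ε i + ∑ j, PowerSeries.map φ (c i j) * (((H j).map φ : Polynomial ℂ) : PowerSeries ℂ) =
      ((Polynomial.X ^ a * (P i).map φ : Polynomial ℂ) : PowerSeries ℂ) := by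
    intro i; simp [ε]
  have hεconv : ∀ i, IsConv ρ (ε i) := by
    intro i
    have h1 : ε i = ((Polynomial.X ^ a * (P i).map φ : Polynomial ℂ) : PowerSeries ℂ) +
      ∑ j, PowerSeries.map φ (c i j) * ((-(H j).map φ : Polynomial ℂ) : PowerSeries ℂ) := by
      simp [ε, sub_eq_add_neg]
    rw [h1]
    exact (isConv_coe _ _).add hρ.le
      (IsConv.sum hρ.le fun j _ => (hc i j).mul hρ.le (isConv_coe _ _))
  choose b hb0 hb using fun i => (hεconv i).exists_bound_of_X_pow_dvd hρ (hεdvd i)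
  let n := Module.finrank ℚ K
  refine le_one_of_frequently_le_mul_pow hq (C := ((C : ℝ) * C) ^ n * ∑ i, b i) (by positivity)
    (by positivity) (hfreq.mono fun k ⟨hQ, hrel⟩ => ?_)
  set Q := ∑ i, (P i).eval (β ^ q ^ k) * m i k with hQdef
  have hzk : ‖φ β ^ q ^ k‖ ≤ ρ := by
    rw [norm_pow]
    refine (pow_le_of_le_one hβpos.le hβ1.le (pow_ne_zero _ (by omega))).trans hβ
  have hup : (φ β ^ q ^ k) ^ a * φ Q = ∑ i, psEval (ε i) (φ β ^ q ^ k) * φ (m i k) := by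
    have h1 : ∀ i, psEval (ε i) (φ β ^ q ^ k) = (φ β ^ q ^ k) ^ a * φ ((P i).eval (β ^ q ^ k)) -
        ∑ j, psEval (PowerSeries.map φ (c i j)) (φ β ^ q ^ k) * φ ((H j).eval (β ^ q ^ k)) := by
      intro i
      have h2 := congrArg (fun u => psEval u (φ β ^ q ^ k)) (hεeq i)
      rw [psEval_coe, psEval_add (hεconv i) (IsConv.sum hρ.le fun j _ => hterm i j) hzk,
        psEval_sum hρ.le (fun j _ => hterm i j) hzk] at h2
      rw [eq_sub_iff_add_eq]
      simp only [psEval_mul (hc i _) (isConv_coe _ _) hzk, psEval_coe] at h2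
      simpa [Polynomial.eval_map, ← map_pow, Polynomial.eval₂_hom] using h2
    simp only [h1, sub_mul, Finset.sum_sub_distrib, Finset.sum_mul]
    rw [Finset.sum_comm]
    have h3 : ∀ j, ∑ i, psEval (PowerSeries.map φ (c i j)) (φ β ^ q ^ k) *
        φ ((H j).eval (β ^ q ^ k)) * φ (m i k) = 0 := by
      intro j
      have := congrArg (φ ((H j).eval (β ^ q ^ k)) * ·) (hrel j)
      simp only [Finset.mul_sum, mul_zero] at this
      rw [← this]
      exact Finset.sum_congr rfl fun i _ => by ring
    rw [Finset.sum_eq_zero fun j _ => h3 j, sub_zero, hQdef, map_sum, Finset.mul_sum]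
    exact Finset.sum_congr rfl fun i _ => by rw [map_mul]; ring
  have hupn : (‖φ β‖ ^ a) ^ q ^ k * ‖φ Q‖ ≤
      (∑ i, b i) * ((‖φ β‖ ^ N) ^ q ^ k * (B : ℝ) ^ (q ^ k * d)) := by
    have h1 : (‖φ β‖ ^ a) ^ q ^ k * ‖φ Q‖ = ‖(φ β ^ q ^ k) ^ a * φ Q‖ := by
      rw [norm_mul, norm_pow, norm_pow, ← pow_mul, ← pow_mul, mul_comm a]
    rw [h1, hup, Finset.sum_mul]
    refine (norm_sum_le _ _).trans (Finset.sum_le_sum fun i _ => ?_)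
    rw [norm_mul, ← mul_assoc]
    refine mul_le_mul ((hb i _ hzk).trans_eq ?_) ((hm i k).2 φ) (norm_nonneg _)
      (mul_nonneg (hb0 i) (by positivity))
    rw [norm_pow, ← pow_mul, ← pow_mul, mul_comm N]
  have hlow := (hsize (q ^ k) (β ^ q ^ k) (fun i => m i k) (hz k) (fun i => hm i k)).le_norm hQ
    (Nat.mul_pos hC (Nat.pow_pos hB)) (one_le_mul_of_one_le_of_one_le hC' (one_le_pow₀ hB')) φ
  have hS : 0 ≤ ∑ i, b i := Finset.sum_nonneg fun i _ => hb0 i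
  push_cast at hlow
  calc (‖φ β‖ ^ a) ^ q ^ k = (‖φ β‖ ^ a) ^ q ^ k * 1 := (mul_one _).symm
    _ ≤ (‖φ β‖ ^ a) ^ q ^ k *
        (((C : ℝ) * B ^ (q ^ k * (d + δ)) * (C * B ^ (q ^ k * (d + δ)))) ^ n * ‖φ Q‖) :=
      mul_le_mul_of_nonneg_left hlow (by positivity)
    _ = ((C : ℝ) * B ^ (q ^ k * (d + δ)) * (C * B ^ (q ^ k * (d + δ)))) ^ n *
        ((‖φ β‖ ^ a) ^ q ^ k * ‖φ Q‖) := by ring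
    _ ≤ ((C : ℝ) * B ^ (q ^ k * (d + δ)) * (C * B ^ (q ^ k * (d + δ)))) ^ n *
        ((∑ i, b i) * ((‖φ β‖ ^ N) ^ q ^ k * (B : ℝ) ^ (q ^ k * (d + δ)))) := by
      refine mul_le_mul_of_nonneg_left (hupn.trans ?_) (by positivity)
      gcongr
      exact Nat.le_add_right d δ
    _ = ((C : ℝ) * C) ^ n * (∑ i, b i) *
        (‖φ β‖ ^ N * ((B : ℝ) ^ (2 * n + 1)) ^ (d + δ)) ^ q ^ k := by
      rw [mul_pow (‖φ β‖ ^ N), ← pow_mul, ← pow_mul, ← pow_mul]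
      have e1 : (2 * n + 1) * ((d + δ) * q ^ k) =
        q ^ k * (d + δ) * n + q ^ k * (d + δ) * n + q ^ k * (d + δ) := by ring
      rw [e1, pow_add, pow_add, pow_mul _ _ n]
      simp only [mul_pow]
      ring

end AuxiliaryEstimate

section Germs

variable {K : Type*} [Field K]

/-- Evaluation of polynomials along a sequence, modulo the hyperfilter. -/
def evalGerm (z : ℕ → K) : Polynomial K →+* Filter.Germ (Filter.hyperfilter ℕ : Filter ℕ) K :=
  (Filter.Germ.coeRingHom _).comp (RingHom.pi fun k => Polynomial.evalRingHom (z k))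

lemma evalGerm_apply (z : ℕ → K) (p : Polynomial K) :
    evalGerm z p = ((fun k => p.eval (z k) : ℕ → K) :
      Filter.Germ (Filter.hyperfilter ℕ : Filter ℕ) K) := rfl

lemma evalGerm_injective {z : ℕ → K} (hz : Function.Injective z) :
    Function.Injective (evalGerm z) := by
  rw [injective_iff_map_eq_zero]
  intro p hp
  by_contra hp0
  rw [evalGerm_apply, ← Filter.Germ.coe_zero, Filter.Germ.coe_eq] at hp
  refine Filter.notMem_hyperfilter_of_finite (s := {k | p.eval (z k) = 0}) ?_ hp
  refine Set.Finite.of_finite_image (f := z) ((p.roots.toFinset.finite_toSet).subset ?_)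
    hz.injOn
  rintro _ ⟨k, hk, rfl⟩
  simpa [hp0] using hk

lemma exists_finset_linearIndependent_span_eq {F V ι : Type*} [Field F] [AddCommGroup V]
    [Module F V] [Fintype ι] (v : ι → V) :
    ∃ s : Finset ι, LinearIndependent F (fun i : s => v i) ∧
      ∀ i, v i ∈ Submodule.span F (Set.range fun i : s => v i) := by
  obtain ⟨κ, a, ha, hs, hl⟩ := exists_linearIndependent' F v
  let _ : Fintype κ := Fintype.ofInjective a ha
  have hr : Set.range (fun i : (Finset.univ.image a : Finset ι) => v i) = Set.range (v ∘ a) := by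
    ext w; simp
  refine ⟨Finset.univ.image a, ?_, fun i => ?_⟩
  · let e : κ ≃ (Finset.univ.image a : Finset ι) :=
      Equiv.ofBijective (fun k => ⟨a k, by simp⟩)
        ⟨fun k l h => ha (by simpa using h), fun ⟨i, hi⟩ => by simpa using hi⟩
    rw [← linearIndependent_equiv e]
    exact hl
  · rw [hr, hs]
    exact Submodule.subset_span ⟨i, rfl⟩

lemma exists_common_denominator {M τ μ : Type*} [Field M] [Algebra (RatFunc K) M] [Finite τ]
    [Fintype μ] {u : τ → M} {m : μ → M}
    (h : ∀ t, u t ∈ Submodule.span (RatFunc K) (Set.range m)) :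
    ∃ Δ : Polynomial K, Δ ≠ 0 ∧ ∃ γ : τ → μ → Polynomial K, ∀ t,
      algebraMap _ (RatFunc K) Δ • u t = ∑ i, algebraMap _ (RatFunc K) (γ t i) • m i := by
  choose c hc using fun t => (Submodule.mem_span_range_iff_exists_fun (RatFunc K)).1 (h t)
  obtain ⟨b, hb⟩ := IsLocalization.exist_integer_multiples_of_finite
    (nonZeroDivisors (Polynomial K)) fun p : τ × μ => c p.1 p.2
  choose γ hγ using hb
  refine ⟨b, nonZeroDivisors.ne_zero b.2, fun t i => γ (t, i), fun t => ?_⟩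
  rw [← hc t, Finset.smul_sum]
  refine Finset.sum_congr rfl fun i _ => ?_
  rw [hγ (t, i), Algebra.smul_def (b : Polynomial K), mul_smul]

lemma not_polynomial_growth {h : ℕ → ℕ} {T n : ℕ} (h0 : 1 ≤ h 0)
    (hmono : ∀ d, h d ≤ h (d + 1)) (hstep : ∀ d, h (d + 1) ≤ T * (h (d + 1) - h d))
    (hpoly : ∀ d, h d ≤ (d + 1) ^ n) : False := by
  have hone : ∀ d, 1 ≤ h d := fun d => by
    induction d with
    | zero => exact h0
    | succ d ih => exact ih.trans (hmono d)
  have hrec : ∀ d, (T : ℝ) * h d ≤ (T - 1) * h (d + 1) := fun d => by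
    have h1 : ((h (d + 1) : ℕ) : ℝ) ≤ T * (h (d + 1) - h d) := by
      rw [← Nat.cast_sub (hmono d)]; exact_mod_cast hstep d
    linarith
  have hT0 : 0 < T := by
    rcases Nat.eq_zero_or_pos T with rfl | h
    · have := hstep 0; have := hone 1; simp at *; omega
    · exact h
  have hT : (1 : ℝ) < T := by
    by_contra! hT
    have h1 := hrec 0
    have h2 : (1 : ℝ) ≤ h 0 := by exact_mod_cast hone 0
    have h3 : (1 : ℝ) ≤ T := by exact_mod_cast hT0
    have h4 : (T : ℝ) = 1 := le_antisymm hT h3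
    rw [h4] at h1
    linarith
  set r : ℝ := T / (T - 1) with hr
  have hr1 : 1 < r := by rw [hr, one_lt_div (by linarith)]; linarith
  have hgrow : ∀ d, r ^ d ≤ h d := fun d => by
    induction d with
    | zero => simpa using h0
    | succ d ih =>
      have h1 : r * h d ≤ h (d + 1) := by
        rw [hr, div_mul_eq_mul_div, div_le_iff₀ (by linarith)]
        linarith [hrec d]
      rw [pow_succ, mul_comm]
      exact (mul_le_mul_of_nonneg_left ih (by linarith)).trans h1
  have ht := ((tendsto_pow_const_div_const_pow_of_one_lt n hr1).comp
    (Filter.tendsto_add_atTop_nat 1)).eventually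
    (gt_mem_nhds (show (0 : ℝ) < r⁻¹ by positivity))
  obtain ⟨d, hd⟩ := ht.exists
  have h1 : r ^ d ≤ ((d + 1 : ℕ) : ℝ) ^ n := (hgrow d).trans (by exact_mod_cast hpoly d)
  simp only [Function.comp] at hd
  rw [div_lt_iff₀ (by positivity), pow_succ, mul_comm, mul_assoc,
    mul_inv_cancel₀ (by positivity), mul_one] at hd
  linarith

end Germs

section Independence

variable {K ι : Type*} [Field K] [Fintype ι] (φ : K →+* ℂ) {q : ℕ}

lemma sum_mul_eq_of_mahler_system {hq0 : q ≠ 0}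
    {y : ι → PowerSeries K} (hy : LinearIndependent (Polynomial K) y) {D₁ D₂ : Polynomial K}
    {c d : ι → ι → Polynomial K}
    (hc : ∀ l, (D₁ : PowerSeries K) * PowerSeries.expand q hq0 (y l) =
      ∑ m, (c l m : PowerSeries K) * y m)
    (hd : ∀ l, (D₂ : PowerSeries K) * y l =
      ∑ m, (d l m : PowerSeries K) * PowerSeries.expand q hq0 (y m)) (l m : ι) :
    ∑ p, d l p * c p m = if l = m then D₁ * D₂ else 0 := by
  have h1 : ∑ m, (∑ p, d l p * c p m - if l = m then D₁ * D₂ else 0) • y m = 0 := by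
    simp only [sub_smul, Finset.sum_sub_distrib, polynomial_smul_eq_coe_mul]
    have e1 : ∑ m, ((if l = m then D₁ * D₂ else 0 : Polynomial K) : PowerSeries K) * y m =
        (D₁ : PowerSeries K) * ((D₂ : PowerSeries K) * y l) := by
      rw [Finset.sum_eq_single l]
      · simp [mul_assoc]
      · intro b _ hb; simp [Ne.symm hb]
      · simp
    have e2 : ∑ m, ((∑ p, d l p * c p m : Polynomial K) : PowerSeries K) * y m =
        (D₁ : PowerSeries K) * ((D₂ : PowerSeries K) * y l) := by
      rw [hd, Finset.mul_sum]
      have e3 : ∀ p, (D₁ : PowerSeries K) * ((d l p : PowerSeries K) *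
          PowerSeries.expand q hq0 (y p)) =
          ∑ m, (d l p : PowerSeries K) * (c p m : PowerSeries K) * y m := by
        intro p
        rw [mul_left_comm, hc, Finset.mul_sum]
        exact Finset.sum_congr rfl fun m _ => by ring
      rw [Finset.sum_congr rfl fun p _ => e3 p, Finset.sum_comm]
      refine Finset.sum_congr rfl fun m _ => ?_
      rw [← Finset.sum_mul]
      congr 1
      simpa only [Polynomial.coeToPowerSeries.ringHom_apply, Polynomial.coe_mul] using
        map_sum (Polynomial.coeToPowerSeries.ringHom (R := K)) (fun p => d l p * c p m)
          Finset.univ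
    rw [e1, e2, sub_self]
  exact sub_eq_zero.1 (Fintype.linearIndependent_iff.1 hy _ h1 m)

/-- Monomials of degree `d` in a family of sequences. -/
def monSeq (r : ℕ → ι → K) (e : ι → ℕ) (k : ℕ) : K := ∏ s, r k s ^ e s

lemma hasSize_monSeq {r : ℕ → ι → K} {B : ℕ}
    (hr : ∀ k j, HasSize (B ^ q ^ k) ((B : ℝ) ^ q ^ k) (r k j)) {d : ℕ} {e : ι → ℕ}
    (he : ∑ s, e s = d) (k : ℕ) :
    HasSize (B ^ (q ^ k * d)) ((B : ℝ) ^ (q ^ k * d)) (monSeq r e k) := by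
  have := HasSize.prod (s := Finset.univ) (fun s _ => by positivity)
    fun s _ => (hr k s).pow (by positivity) (e s)
  simp only [← pow_mul] at this
  rwa [Finset.prod_pow_eq_pow_sum, Finset.prod_pow_eq_pow_sum, ← Finset.mul_sum, he] at this

lemma monSeq_add_single (r : ℕ → ι → K) (e : ι → ℕ) (s : ι) (k : ℕ) :
    monSeq r (e + Pi.single s 1) k = r k s * monSeq r e k := by
  simp only [monSeq, Pi.add_apply, pow_add, Finset.prod_mul_distrib]
  rw [mul_comm]
  congr 1
  rw [Finset.prod_eq_single s]
  · simp
  · intro b _ hb; simp [hb]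
  · simp


/-- Values at `β` of the components of a regular Mahler system, linearly independent over the
polynomials, are linearly independent over `K`. -/
theorem eq_zero_of_sum_mul_psEval_eq_zero [NumberField K] (hq : 2 ≤ q) (hq0 : q ≠ 0)
    {y : ι → PowerSeries K} (hy : LinearIndependent (Polynomial K) y) {D₁ D₂ : Polynomial K}
    {c d : ι → ι → Polynomial K}
    (hc : ∀ l, (D₁ : PowerSeries K) * PowerSeries.expand q hq0 (y l) =
      ∑ m, (c l m : PowerSeries K) * y m)
    (hd : ∀ l, (D₂ : PowerSeries K) * y l =
      ∑ m, (d l m : PowerSeries K) * PowerSeries.expand q hq0 (y m))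
    {ρ : ℝ} (hρ1 : ρ < 1) (hconv : ∀ l, IsConv ρ (PowerSeries.map φ (y l)))
    {β : K} (hβ0 : β ≠ 0) (hβ : ‖φ β‖ ≤ ρ) (hD₁ : ∀ j, D₁.eval (β ^ q ^ j) ≠ 0)
    (hD₂ : ∀ j, D₂.eval (β ^ q ^ j) ≠ 0) {r₀ : ι → K}
    (hr₀ : ∑ l, φ (r₀ l) * psEval (PowerSeries.map φ (y l)) (φ β) = 0) : r₀ = 0 := by
  by_contra hr₀0
  have hβpos : 0 < ‖φ β‖ := norm_pos_iff.2 ((map_ne_zero φ).2 hβ0)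
  have hρ : 0 < ρ := hβpos.trans_le hβ
  have hβ1 : ‖φ β‖ < 1 := hβ.trans_lt hρ1
  let z : ℕ → K := fun k => β ^ q ^ k
  have hzφ : ∀ k, φ (z k) = φ β ^ q ^ k := fun k => map_pow _ _ _
  have hzρ : ∀ k, ‖φ β ^ q ^ k‖ ≤ ρ := fun k => by
    rw [norm_pow]
    exact (pow_le_of_le_one hβpos.le hβ1.le (pow_ne_zero _ hq0)).trans hβ
  have hzinj : Function.Injective z := by
    intro k l hkl
    have h1 : ‖φ β‖ ^ q ^ k = ‖φ β‖ ^ q ^ l := by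
      rw [← norm_pow, ← norm_pow, ← hzφ, ← hzφ, hkl]
    have h2 := (pow_right_strictAnti₀ hβpos hβ1).injective h1
    exact Nat.pow_right_injective hq h2
  -- the transported relations
  let r : ℕ → ι → K := fun k => Nat.rec r₀ (fun k rk j => ∑ s, rk s * (d s j).eval (z k)) k
  have hrs : ∀ k j, r (k + 1) j = ∑ s, r k s * (d s j).eval (z k) := fun k j => rfl
  have hrel : ∀ k, ∑ l, φ (r k l) * psEval (PowerSeries.map φ (y l)) (φ β ^ q ^ k) = 0 := by
    intro k
    induction k with
    | zero => simp only [pow_zero, pow_one]; exact hr₀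
    | succ k ih =>
      have h1 : ∀ l, φ (D₂.eval (z k)) * psEval (PowerSeries.map φ (y l)) (φ β ^ q ^ k) =
          ∑ m, φ ((d l m).eval (z k)) * psEval (PowerSeries.map φ (y m)) (φ β ^ q ^ (k + 1)) := by
        intro l
        have h2 := congrArg (fun u => psEval (PowerSeries.map φ u) (φ β ^ q ^ k)) (hd l)
        simp only [map_mul, map_sum, ← Polynomial.polynomial_map_coe, PowerSeries.map_expand] at h2
        rw [psEval_coe_mul _ (hconv l) (hzρ k), psEval_sum hρ.le (fun m _ =>
          (isConv_coe _ _).mul hρ.le ((hconv m).expand hρ.le hρ1.le hq0)) (hzρ k)] at h2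
        simp only [psEval_coe_mul _ ((hconv _).expand hρ.le hρ1.le hq0) (hzρ k),
          psEval_expand, ← pow_mul, ← pow_succ, Polynomial.eval_map] at h2
        simp only [← Polynomial.eval₂_hom, hzφ]
        exact h2
      simp only [hrs, map_sum, map_mul, Finset.sum_mul]
      rw [Finset.sum_comm]
      have h3 : ∀ s, ∑ m, φ (r k s) * φ ((d s m).eval (z k)) *
          psEval (PowerSeries.map φ (y m)) (φ β ^ q ^ (k + 1)) =
          φ (D₂.eval (z k)) * (φ (r k s) * psEval (PowerSeries.map φ (y s)) (φ β ^ q ^ k)) := by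
        intro s
        rw [mul_left_comm, h1, Finset.mul_sum]
        exact Finset.sum_congr rfl fun m _ => by ring
      rw [Finset.sum_congr rfl fun s _ => h3 s, ← Finset.mul_sum, ih, mul_zero]
  have hr0 : ∀ k, r k ≠ 0 := by
    intro k
    induction k with
    | zero => exact hr₀0
    | succ k ih =>
      intro h0
      refine ih (funext fun m => ?_)
      have h1 : ∑ p, r (k + 1) p * (c p m).eval (z k) =
          r k m * (D₁.eval (z k) * D₂.eval (z k)) := by
        simp only [hrs, Finset.sum_mul]
        rw [Finset.sum_comm]
        have h2 : ∀ l, ∑ p, r k l * (d l p).eval (z k) * (c p m).eval (z k) =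
            r k l * if l = m then D₁.eval (z k) * D₂.eval (z k) else 0 := by
          intro l
          have := congrArg (Polynomial.eval (z k)) (sum_mul_eq_of_mahler_system hy hc hd l m)
          rw [Polynomial.eval_finsetSum] at this
          simp only [Polynomial.eval_mul, apply_ite (Polynomial.eval (z k)),
            Polynomial.eval_zero] at this
          rw [← this, Finset.mul_sum]
          exact Finset.sum_congr rfl fun p _ => by ring
        rw [Finset.sum_congr rfl fun l _ => h2 l]
        simp
      simp only [h0, Pi.zero_apply, zero_mul, Finset.sum_const_zero] at h1
      exact (mul_eq_zero.1 h1.symm).resolve_right (mul_ne_zero (hD₁ k) (hD₂ k))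
  -- sizes
  obtain ⟨B, hB, hzB, hrB⟩ : ∃ B : ℕ, 1 ≤ B ∧
      (∀ k, HasSize (B ^ q ^ k) ((B : ℝ) ^ q ^ k) (β ^ q ^ k)) ∧
      ∀ k j, HasSize (B ^ q ^ k) ((B : ℝ) ^ q ^ k) (r k j) := by
    obtain ⟨B₁, hB₁, h₁⟩ := hasGeomSize_pow (q := q) β
    obtain ⟨B₂, hB₂, h₂⟩ := hasGeomSize_recurrence hq
      (fun s j => hasGeomSize_eval hq0 β (d s j)) hrs
    have hpos : 1 ≤ B₁ * B₂ := Nat.mul_pos hB₁ hB₂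
    exact ⟨B₁ * B₂, hpos, fun k => (h₁ k).mono_geom hpos (Dvd.intro _ rfl),
      fun k j => (h₂ k j).mono_geom hpos (Dvd.intro_left _ rfl)⟩
  have hB' : (1 : ℝ) ≤ B := by exact_mod_cast hB
  let Γ : ℝ := (B : ℝ) ^ (2 * Module.finrank ℚ K + 1)
  have hΓ : 1 ≤ Γ := one_le_pow₀ hB'
  obtain ⟨T, hT⟩ : ∃ T : ℕ, ‖φ β‖ ^ T * Γ ≤ 1 / 2 := by
    obtain ⟨T, hT⟩ := exists_pow_lt_of_lt_one (show 0 < 1 / 2 / Γ by positivity) hβ1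
    exact ⟨T, ((lt_div_iff₀ (by positivity)).1 hT).le⟩
  -- the field of germs
  let 𝓕 := Filter.Germ (Filter.hyperfilter ℕ : Filter ℕ) K
  let _ : Algebra (RatFunc K) 𝓕 := (IsFractionRing.lift (evalGerm_injective hzinj)).toAlgebra
  let g : (ℕ → K) →+* 𝓕 := Filter.Germ.coeRingHom _
  have hg : ∀ {u v : ℕ → K}, g u = g v ↔
      ∀ᶠ k in (Filter.hyperfilter ℕ : Filter ℕ), u k = v k := Filter.Germ.coe_eq
  have halg : ∀ p : Polynomial K, algebraMap (RatFunc K) 𝓕 (algebraMap _ _ p) =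
      g fun k => p.eval (z k) :=
    fun p => IsFractionRing.lift_algebraMap (evalGerm_injective hzinj) p
  let x : ι → 𝓕 := fun s => g fun k => r k s
  have hx : x ≠ 0 := by
    intro h0
    have h1 : ∀ s, ∀ᶠ k in (Filter.hyperfilter ℕ : Filter ℕ), r k s = 0 := fun s =>
      hg.1 ((congrFun h0 s).trans (map_zero g).symm)
    obtain ⟨k, hk⟩ := (Filter.eventually_all.2 h1).exists
    exact hr0 k (funext hk)
  let E : ℕ → Type _ := fun n => (Finset.piAntidiag (Finset.univ : Finset ι) n : Finset (ι → ℕ))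
  have hE : ∀ n (e : E n), ∑ s, e.1 s = n := fun n e => (Finset.mem_piAntidiag.1 e.2).1
  let mon : ∀ n, E n → 𝓕 := fun n e => g (monSeq r e.1)
  choose S hSli hSspan using fun n =>
    exists_finset_linearIndependent_span_eq (F := RatFunc K) (mon n)
  have hfreq : ∀ {p : ℕ → Prop}, (∀ᶠ k in (Filter.hyperfilter ℕ : Filter ℕ), p k) →
      ∃ᶠ k in Filter.atTop, p k := fun h => h.frequently.filter_mono Nat.hyperfilter_le_atTop
  have hstep : ∀ n, (S n).card ≤ (S (n + 1)).card ∧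
      (S (n + 1)).card ≤ T * ((S (n + 1)).card - (S n).card) := by
    intro n
    let m : S (n + 1) → 𝓕 := fun i => mon (n + 1) i
    let m' : S n → 𝓕 := fun j => mon n j
    obtain ⟨Δ, hΔ, γ, hγ⟩ := exists_common_denominator (K := K) (m := m)
      (u := fun p : ι × S n => x p.1 * m' p.2) fun p => by
        have : x p.1 * m' p.2 = mon (n + 1) ⟨p.2.1.1 + Pi.single p.1 1, by
            simp [Finset.sum_add_distrib, hE]⟩ := by
          simp only [x, m', mon, ← map_mul]
          congr 1
          funext k
          exact (monSeq_add_single r _ _ k).symm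
        rw [this]
        exact hSspan _ _
    let C : Matrix (S (n + 1)) (S n) (PowerSeries K) := fun i j =>
      ∑ s, (γ (s, j) i : PowerSeries K) * y s
    have hC : ∀ v : S n → PowerSeries K, C.mulVec v = 0 → v = 0 := fun v hv =>
      eq_zero_of_mahler_matrix φ hq hq0 hy (fun h => hD₁ 0 (by simp [h]))
        (fun h => hD₂ 0 (by simp [h])) hc hd hx (hSli n) hΔ
        (γ := fun s i j => γ (s, j) i) (fun s j => hγ (s, j)) fun i => congrFun hv i
    obtain ⟨hcard, a, happ⟩ := exists_approximants C hC
    simp only [Fintype.card_coe] at hcard happ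
    refine ⟨hcard, ?_⟩
    by_contra! hlt
    obtain ⟨δ, hδ⟩ : ∃ δ : ℕ, (1 / 2 : ℝ) ^ (δ + 1) * Γ ^ n < ‖φ β‖ ^ a := by
      obtain ⟨δ, hδ⟩ := exists_pow_lt_of_lt_one
        (show (0 : ℝ) < ‖φ β‖ ^ a / Γ ^ n by positivity) (by norm_num : (1 / 2 : ℝ) < 1)
      refine ⟨δ, lt_of_le_of_lt ?_ ((lt_div_iff₀ (by positivity)).1 hδ)⟩
      gcongr ?_ * _
      exact pow_le_pow_of_le_one (by norm_num) (by norm_num) (Nat.le_succ δ)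
    obtain ⟨P, H, hP0, hPdeg, hPH⟩ := happ (T * (δ + 1)) δ (by
      rw [← mul_assoc, mul_comm _ T]
      exact Nat.mul_lt_mul_of_pos_right hlt (Nat.succ_pos δ))
    have hQ : ∀ᶠ k in (Filter.hyperfilter ℕ : Filter ℕ),
        ∑ i, (P i).eval (β ^ q ^ k) * monSeq r i.1.1 k ≠ 0 := by
      rw [Ultrafilter.eventually_not]
      intro h0
      apply hP0
      have h1 : ∑ i, algebraMap _ (RatFunc K) (P i) • m i = 0 := by
        simp only [Algebra.smul_def, halg, m, mon, ← map_mul, ← map_sum]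
        rw [← map_zero g, hg]
        filter_upwards [h0] with k hk
        simpa [z] using hk
      funext i
      have := Fintype.linearIndependent_iff.1 (hSli (n + 1)) _ h1 i
      simpa using this
    have hR : ∀ᶠ k in (Filter.hyperfilter ℕ : Filter ℕ), ∀ j,
        ∑ i, psEval (PowerSeries.map φ (C i j)) (φ β ^ q ^ k) * φ (monSeq r i.1.1 k) = 0 := by
      have hident : ∀ᶠ k in (Filter.hyperfilter ℕ : Filter ℕ), ∀ p : ι × S n,
          Δ.eval (z k) * (r k p.1 * monSeq r p.2.1.1 k) =
            ∑ i, (γ p i).eval (z k) * monSeq r i.1.1 k := by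
        refine Filter.eventually_all.2 fun p => ?_
        have h1 := hγ p
        simp only [Algebra.smul_def, halg, m, m', x, mon, ← map_mul, ← map_sum] at h1
        filter_upwards [hg.1 h1] with k hk
        simpa using hk
      filter_upwards [hident] with k hk j
      have h1 : ∀ i, psEval (PowerSeries.map φ (C i j)) (φ β ^ q ^ k) =
          ∑ s, φ ((γ (s, j) i).eval (z k)) * psEval (PowerSeries.map φ (y s)) (φ β ^ q ^ k) := by
        intro i
        simp only [C, map_sum, map_mul, ← Polynomial.polynomial_map_coe]
        rw [psEval_sum hρ.le (fun s _ => (isConv_coe _ _).mul hρ.le (hconv s)) (hzρ k)]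
        simp only [psEval_coe_mul _ (hconv _) (hzρ k), Polynomial.eval_map,
          ← Polynomial.eval₂_hom, hzφ]
      simp only [h1, Finset.sum_mul]
      rw [Finset.sum_comm]
      have h2 : ∀ s, ∑ i, φ ((γ (s, j) i).eval (z k)) *
          psEval (PowerSeries.map φ (y s)) (φ β ^ q ^ k) * φ (monSeq r i.1.1 k) =
          φ (Δ.eval (z k) * monSeq r j.1.1 k) *
            (φ (r k s) * psEval (PowerSeries.map φ (y s)) (φ β ^ q ^ k)) := by
        intro s
        have h3 := congrArg φ (hk (s, j))
        simp only [map_mul, map_sum] at h3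
        calc _ = psEval (PowerSeries.map φ (y s)) (φ β ^ q ^ k) *
            ∑ i, φ ((γ (s, j) i).eval (z k)) * φ (monSeq r i.1.1 k) := by
              rw [Finset.mul_sum]
              exact Finset.sum_congr rfl fun i _ => by ring
          _ = _ := by rw [← h3, map_mul]; ring
      rw [Finset.sum_congr rfl fun s _ => h2 s, ← Finset.mul_sum, hrel, mul_zero]
    have hfin := norm_pow_le_of_frequently φ hq hρ1 hβ0 hβ hB hzB
      (fun (i : S (n + 1)) k => hasSize_monSeq hrB (hE _ i.1) k) (c := C) (fun i j => by
        simp only [C, map_sum, map_mul, ← Polynomial.polynomial_map_coe]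
        exact IsConv.sum hρ.le fun s _ => (isConv_coe _ _).mul hρ.le (hconv s))
      hPdeg hPH (hfreq (hQ.and hR))
    refine absurd hfin (not_le.2 (lt_of_le_of_lt ?_ hδ))
    change _ * Γ ^ _ ≤ _
    have e1 : ‖φ β‖ ^ (T * (δ + 1)) * Γ ^ (n + 1 + δ) =
        (‖φ β‖ ^ T * Γ) ^ (δ + 1) * Γ ^ n := by
      rw [pow_mul, mul_pow, mul_assoc, ← pow_add, show n + 1 + δ = δ + 1 + n by ring]
    rw [e1]
    gcongr
  refine not_polynomial_growth (h := fun n => (S n).card) (T := T) (n := Fintype.card ι) ?_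
    (fun n => (hstep n).1) (fun n => (hstep n).2) fun n => ?_
  · rw [Nat.one_le_iff_ne_zero, Ne, Finset.card_eq_zero]
    intro h0
    have h1 := hSspan 0 ⟨0, by simp⟩
    have : IsEmpty (S 0) := by rw [h0]; infer_instance
    rw [Set.range_eq_empty, Submodule.span_empty, Submodule.mem_bot] at h1
    have h2 : monSeq r (0 : ι → ℕ) = 1 := by funext k; simp [monSeq]
    simp only [mon, h2, map_one, one_ne_zero] at h1
  · refine (Finset.card_le_univ _).trans ?_
    have hinj : Function.Injective fun (e : E n) (s : ι) => (⟨e.1 s, Nat.lt_succ_of_le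
        ((Finset.single_le_sum (fun _ _ => Nat.zero_le _) (Finset.mem_univ s)).trans_eq
          (hE n e))⟩ : Fin (n + 1)) := by
      intro e e' h
      ext s
      simpa using congrArg Fin.val (congrFun h s)
    simpa using Fintype.card_le_of_injective _ hinj

end Independence

section MahlerSeq

variable {F : Type*} [Field F] {q : ℕ} (hq0 : q ≠ 0)

/-- The sequence `1, f(z), f(z^q), f(z^(q^2)), …`. -/
def mahlerSeq (f : PowerSeries F) : ℕ → PowerSeries F
  | 0 => 1
  | i + 1 => PowerSeries.expand (q ^ i) (pow_ne_zero i hq0) f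

variable {hq0} {f : PowerSeries F}

lemma expand_expand_pow (u : PowerSeries F) (k : ℕ) :
    PowerSeries.expand (q ^ (k + 1)) (pow_ne_zero _ hq0) u =
      PowerSeries.expand (q ^ k) (pow_ne_zero k hq0) (PowerSeries.expand q hq0 u) :=
  PowerSeries.expand_mul _ _ _ _ _

lemma expand_pow_expand (u : PowerSeries F) (k : ℕ) :
    PowerSeries.expand (q ^ (k + 1)) (pow_ne_zero _ hq0) u =
      PowerSeries.expand q hq0 (PowerSeries.expand (q ^ k) (pow_ne_zero k hq0) u) := by
  rw [← PowerSeries.expand_mul]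
  simp only [pow_succ']

lemma mahlerSeq_one : mahlerSeq hq0 f 1 = f := by
  simp [mahlerSeq]

lemma expand_mahlerSeq_zero :
    PowerSeries.expand q hq0 (mahlerSeq hq0 f 0) = mahlerSeq hq0 f 0 := by
  simp [mahlerSeq]

lemma expand_mahlerSeq_succ (i : ℕ) :
    PowerSeries.expand q hq0 (mahlerSeq hq0 f (i + 1)) = mahlerSeq hq0 f (i + 2) :=
  (expand_pow_expand f i).symm

lemma map_mahlerSeq {F' : Type*} [Field F'] (φ : F →+* F') (i : ℕ) :
    PowerSeries.map φ (mahlerSeq hq0 f i) = mahlerSeq hq0 (PowerSeries.map φ f) i := by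
  cases i with
  | zero => simp [mahlerSeq]
  | succ i => simp only [mahlerSeq, PowerSeries.map_expand]

/-- `IsMahler hq0 f` : the series `1, f(z), f(z^q), …` are linearly dependent over the
polynomials. -/
def IsMahler (hq0 : q ≠ 0) (f : PowerSeries F) : Prop :=
  ∃ n, ¬ LinearIndependent (Polynomial F) fun i : Fin n => mahlerSeq hq0 f i

lemma isMahler_of_sum_eq_zero {N : ℕ} {P : ℕ → Polynomial F}
    (hP : ∑ i ∈ Finset.range N, (P i : PowerSeries F) * mahlerSeq hq0 f i = 0)
    {i : ℕ} (hi : i < N) (h : P i ≠ 0) : IsMahler hq0 f := by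
  refine ⟨N, Fintype.not_linearIndependent_iff.2 ⟨fun i => P i, ?_, ⟨i, hi⟩, h⟩⟩
  simp only [polynomial_smul_eq_coe_mul]
  rwa [Finset.sum_range] at hP

/-- The data of a minimal relation. -/
structure MinimalRelation (hq0 : q ≠ 0) (f : PowerSeries F) (N : ℕ) (P : ℕ → Polynomial F) :
    Prop where
  linearIndependent : LinearIndependent (Polynomial F) fun i : Fin (N + 1) => mahlerSeq hq0 f i
  first_ne_zero : P 1 ≠ 0
  last_ne_zero : P (N + 1) ≠ 0
  sum_eq_zero : ∑ i ∈ Finset.range (N + 2), (P i : PowerSeries F) * mahlerSeq hq0 f i = 0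

/-- The coefficients expressing `P₁ f` through the `y_m(z^q)`. -/
def firstRow (P : ℕ → Polynomial F) (m : ℕ) : Polynomial F := if m = 0 then -P 0 else -P (m + 1)

lemma sum_firstRow {N : ℕ} {P : ℕ → Polynomial F}
    (h : ∑ i ∈ Finset.range (N + 2), (P i : PowerSeries F) * mahlerSeq hq0 f i = 0) :
    (P 1 : PowerSeries F) * f = ∑ m : Fin (N + 1), (firstRow P m : PowerSeries F) *
      PowerSeries.expand q hq0 (mahlerSeq hq0 f m) := by
  rw [Finset.sum_range_succ', Finset.sum_range_succ', zero_add, mahlerSeq_one] at h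
  rw [← Finset.sum_range fun m => (firstRow P m : PowerSeries F) *
      PowerSeries.expand q hq0 (mahlerSeq hq0 f m), Finset.sum_range_succ', expand_mahlerSeq_zero]
  simp only [expand_mahlerSeq_succ, firstRow, if_true, Nat.succ_ne_zero, if_false,
    Polynomial.coe_neg, neg_mul, Finset.sum_neg_distrib]
  linear_combination h

lemma linearIndependent_mahlerSeq_one :
    LinearIndependent (Polynomial F) fun i : Fin 1 => mahlerSeq hq0 f i := by
  refine Fintype.linearIndependent_iff.2 fun g hg i => ?_
  rw [Fin.sum_univ_one, polynomial_smul_eq_coe_mul] at hg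
  have h2 : ((g 0 : Polynomial F) : PowerSeries F) = 0 := by
    simpa only [mahlerSeq, Fin.val_zero, mul_one] using hg
  rw [Subsingleton.elim i 0]
  exact_mod_cast h2

lemma IsMahler.exists_linearIndependent (h : IsMahler hq0 f) :
    ∃ N, (LinearIndependent (Polynomial F) fun i : Fin (N + 1) => mahlerSeq hq0 f i) ∧
      ¬ LinearIndependent (Polynomial F) fun i : Fin (N + 2) => mahlerSeq hq0 f i := by
  by_contra! hcon
  have hall : ∀ N, LinearIndependent (Polynomial F) fun i : Fin (N + 1) => mahlerSeq hq0 f i := by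
    intro N
    induction N with
    | zero => exact linearIndependent_mahlerSeq_one
    | succ N ih => exact hcon N ih
  obtain ⟨n, hn⟩ := h
  cases n with
  | zero => exact hn linearIndependent_empty_type
  | succ n => exact hn (hall n)

lemma eq_zero_of_sum_coe_mul_eq_zero {ι : Type*} [Fintype ι] {y : ι → PowerSeries F}
    (hy : LinearIndependent (Polynomial F) y) {g : ι → Polynomial F}
    (hg : ∑ i, (g i : PowerSeries F) * y i = 0) (i : ι) : g i = 0 := by
  refine Fintype.linearIndependent_iff.1 hy g ?_ i
  simpa only [polynomial_smul_eq_coe_mul] using hg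

lemma exists_sum_coe_mul_eq_zero {n : ℕ} {y : ℕ → PowerSeries F}
    (hy : ¬ LinearIndependent (Polynomial F) fun i : Fin n => y i) :
    ∃ P : ℕ → Polynomial F, (∃ i < n, P i ≠ 0) ∧
      ∑ i ∈ Finset.range n, (P i : PowerSeries F) * y i = 0 := by
  obtain ⟨g, hg, i₀, hi₀⟩ := Fintype.not_linearIndependent_iff.1 hy
  have hPg : ∀ i : Fin n, (if hi : (i : ℕ) < n then g ⟨i, hi⟩ else 0) = g i := fun i => by simp
  refine ⟨fun i => if hi : i < n then g ⟨i, hi⟩ else 0, ⟨i₀, i₀.2, by simpa using hi₀⟩, ?_⟩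
  rw [Finset.sum_range, ← hg]
  simp only [polynomial_smul_eq_coe_mul, hPg]

lemma IsMahler.exists_minimalRelation (h : IsMahler hq0 f) :
    ∃ N P, MinimalRelation hq0 f N P := by
  obtain ⟨N, hli, hsp⟩ := h.exists_linearIndependent
  obtain ⟨P, ⟨i₀, hi, hi₀⟩, hsum⟩ := exists_sum_coe_mul_eq_zero hsp
  have hlast : P (N + 1) ≠ 0 := by
    intro h0
    have h1 := hsum
    rw [Finset.sum_range_succ, h0, Polynomial.coe_zero, zero_mul, add_zero, Finset.sum_range] at h1
    have h2 := eq_zero_of_sum_coe_mul_eq_zero hli h1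
    apply hi₀
    rcases Nat.lt_or_ge i₀ (N + 1) with hlt | hge
    · exact h2 ⟨i₀, hlt⟩
    · rw [show (i₀ : ℕ) = N + 1 by omega, h0]
  refine ⟨N, P, hli, fun h0 => hlast ?_, hlast, hsum⟩
  have h1 := sum_firstRow hsum
  rw [h0, Polynomial.coe_zero, zero_mul] at h1
  have h2 := eq_zero_of_sum_coe_mul_eq_zero (linearIndependent_expand hq0 hli) h1.symm
  by_cases hN : N = 0
  · rwa [hN]
  · have h3 : firstRow P N = 0 := h2 ⟨N, Nat.lt_succ_self N⟩
    rwa [firstRow, if_neg hN, neg_eq_zero] at h3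

namespace MinimalRelation

variable {N : ℕ} {P : ℕ → Polynomial F}

lemma forward (h : MinimalRelation hq0 f N P) (l : Fin (N + 1)) : ∃ c : Fin (N + 1) → Polynomial F,
    (P (N + 1) : PowerSeries F) * PowerSeries.expand q hq0 (mahlerSeq hq0 f l) =
      ∑ m, (c m : PowerSeries F) * mahlerSeq hq0 f m := by
  obtain ⟨l, hl⟩ := l
  rcases l with _ | l
  · refine ⟨fun m => if m = 0 then P (N + 1) else 0, ?_⟩
    rw [Finset.sum_eq_single 0]
    · simp [expand_mahlerSeq_zero]
    · intro b _ hb; simp [hb]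
    · simp
  · simp only [expand_mahlerSeq_succ]
    rcases Nat.lt_or_ge (l + 2) (N + 1) with hlt | hge
    · refine ⟨fun m => if m = ⟨l + 2, hlt⟩ then P (N + 1) else 0, ?_⟩
      rw [Finset.sum_eq_single ⟨l + 2, hlt⟩]
      · simp
      · intro b _ hb; simp [hb]
      · simp
    · obtain rfl : N = l + 1 := by omega
      refine ⟨fun m => -P m, ?_⟩
      have h1 := h.sum_eq_zero
      rw [Finset.sum_range_succ, Finset.sum_range] at h1
      simp only [Polynomial.coe_neg, neg_mul, Finset.sum_neg_distrib]
      linear_combination h1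

lemma backward (h : MinimalRelation hq0 f N P) (l : Fin (N + 1)) : ∃ d : Fin (N + 1) → Polynomial F,
    (P 1 : PowerSeries F) * mahlerSeq hq0 f l =
      ∑ m, (d m : PowerSeries F) * PowerSeries.expand q hq0 (mahlerSeq hq0 f m) := by
  obtain ⟨l, hl⟩ := l
  rcases l with _ | _ | l
  · refine ⟨fun m => if m = 0 then P 1 else 0, ?_⟩
    rw [Finset.sum_eq_single 0]
    · simp [expand_mahlerSeq_zero]
    · intro b _ hb; simp [hb]
    · simp
  · exact ⟨fun m => firstRow P m, by simpa [mahlerSeq_one] using sum_firstRow h.sum_eq_zero⟩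
  · have hl' : l + 1 < N + 1 := by omega
    refine ⟨fun m => if m = ⟨l + 1, hl'⟩ then P 1 else 0, ?_⟩
    rw [Finset.sum_eq_single ⟨l + 1, hl'⟩]
    · simp [expand_mahlerSeq_succ]
    · intro b _ hb; simp [hb]
    · simp

lemma exists_iterate (h : MinimalRelation hq0 f N P) (k : ℕ) : ∃ (D : Polynomial F) (A : Fin (N + 1) → Polynomial F), D ≠ 0 ∧
    (D : PowerSeries F) * f = ∑ m, (A m : PowerSeries F) *
      PowerSeries.expand (q ^ (k + 1)) (pow_ne_zero _ hq0) (mahlerSeq hq0 f m) := by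
  induction k with
  | zero =>
    refine ⟨P 1, fun m => firstRow P m, h.first_ne_zero, ?_⟩
    simpa using sum_firstRow h.sum_eq_zero
  | succ k ih =>
    obtain ⟨D, A, hD, hA⟩ := ih
    choose d hd using h.backward
    let e := fun p : Polynomial F => Polynomial.expand F (q ^ (k + 1)) p
    have he : ∀ p, ((e p : Polynomial F) : PowerSeries F) =
        PowerSeries.expand (q ^ (k + 1)) (pow_ne_zero _ hq0) (p : PowerSeries F) :=
      fun p => coe_polynomial_expand _ p
    refine ⟨e (P 1) * D, fun m => ∑ l, A l * e (d l m), mul_ne_zero ?_ hD, ?_⟩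
    · exact (Polynomial.expand_ne_zero (Nat.pos_of_ne_zero (pow_ne_zero _ hq0))).2
        h.first_ne_zero
    · have h1 : ∀ l : Fin (N + 1), ((e (P 1) : Polynomial F) : PowerSeries F) *
          PowerSeries.expand (q ^ (k + 1)) (pow_ne_zero _ hq0) (mahlerSeq hq0 f l) =
          ∑ m, ((e (d l m) : Polynomial F) : PowerSeries F) *
          PowerSeries.expand (q ^ (k + 2)) (pow_ne_zero _ hq0) (mahlerSeq hq0 f m) := by
        intro l
        have := congrArg (PowerSeries.expand (q ^ (k + 1)) (pow_ne_zero _ hq0)) (hd l)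
        simp only [map_mul, map_sum, ← expand_expand_pow, ← he] at this
        exact this
      have h2 : ∀ m, ((∑ l, A l * e (d l m) : Polynomial F) : PowerSeries F) =
          ∑ l, (A l : PowerSeries F) * (e (d l m) : Polynomial F) := fun m => by
        simpa only [Polynomial.coeToPowerSeries.ringHom_apply, Polynomial.coe_mul] using
          map_sum (Polynomial.coeToPowerSeries.ringHom (R := F)) (fun l => A l * e (d l m))
            Finset.univ
      simp only [h2, Polynomial.coe_mul, mul_assoc, hA, Finset.sum_mul, Finset.mul_sum]
      rw [Finset.sum_comm]
      refine Finset.sum_congr rfl fun l _ => ?_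
      rw [mul_left_comm, h1, Finset.mul_sum]

end MinimalRelation

end MahlerSeq

section Recurrence

variable {F : Type*} [Field F] {q : ℕ} {hq0 : q ≠ 0} {f : PowerSeries F}

lemma coeff_mahlerSeq_eq_zero_or (hq : 2 ≤ q) {i n k : ℕ} (hk : k ≠ 0) (hi : i ≠ 1)
    (hn : k < 2 * n) : PowerSeries.coeff k (mahlerSeq hq0 f i) = 0 ∨
      ∃ m < n, PowerSeries.coeff k (mahlerSeq hq0 f i) = PowerSeries.coeff m f := by
  rcases i with _ | _ | i
  · left
    rw [mahlerSeq, PowerSeries.coeff_one, if_neg hk]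
  · exact absurd rfl hi
  · rw [mahlerSeq, PowerSeries.coeff_expand]
    split_ifs
    · refine Or.inr ⟨_, ?_, rfl⟩
      have h2 : 2 ≤ q ^ (i + 1) := hq.trans (Nat.le_self_pow (by omega) q)
      rw [Nat.div_lt_iff_lt_mul (by omega)]
      nlinarith
    · exact Or.inl rfl

/-- The coefficients of a Mahler function satisfy a recurrence with finitely many weights. -/
lemma exists_recurrence (hq : 2 ≤ q) {N : ℕ} {P : ℕ → Polynomial F} (h1 : P 1 ≠ 0)
    (hsum : ∑ i ∈ Finset.range (N + 2), (P i : PowerSeries F) * mahlerSeq hq0 f i = 0) :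
    ∃ (M : ℕ) (T : Finset (ℕ × ℕ)) (w : ℕ × ℕ → F), ∀ n, M < n → ∃ x : ℕ × ℕ → F,
      (∀ p ∈ T, x p = 0 ∨ ∃ m < n, x p = PowerSeries.coeff m f) ∧
      PowerSeries.coeff n f = ∑ p ∈ T, w p * x p := by
  set t := (P 1).natTrailingDegree
  set r := (Finset.range (N + 2)).sup fun i => (P i).natDegree
  have hr : ∀ i ∈ Finset.range (N + 2), (P i).natDegree ≤ r := fun i hi =>
    Finset.le_sup (f := fun i => (P i).natDegree) hi
  have h1mem : 1 ∈ Finset.range (N + 2) := by simp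
  have htr : t ≤ r := (Polynomial.natTrailingDegree_le_natDegree _).trans (hr 1 h1mem)
  have hlead : (P 1).coeff t ≠ 0 := Polynomial.trailingCoeff_nonzero_iff_nonzero.2 h1
  refine ⟨r, Finset.range (N + 2) ×ˢ Finset.range (r + 1),
    fun p => -((P p.1).coeff p.2 / (P 1).coeff t), fun n hn => ?_⟩
  refine ⟨fun p => if p.1 = 1 ∧ p.2 ≤ t then 0 else
    PowerSeries.coeff (n + t - p.2) (mahlerSeq hq0 f p.1), ?_, ?_⟩
  · rintro ⟨i, s⟩ hp
    simp only [Finset.mem_product, Finset.mem_range] at hp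
    dsimp only
    split_ifs with h
    · exact Or.inl rfl
    · rcases eq_or_ne i 1 with rfl | hi
      · refine Or.inr ⟨n + t - s, by omega, by rw [mahlerSeq_one]⟩
      · exact coeff_mahlerSeq_eq_zero_or hq (by omega) hi (by omega)
  · have hc := congrArg (PowerSeries.coeff (n + t)) hsum
    rw [map_sum, map_zero, Finset.sum_congr rfl fun i hi => coeff_coe_mul_of_natDegree_le
      (n := n + t) (hr i hi) (by omega) (mahlerSeq hq0 f i), ← Finset.sum_product'] at hc
    have hsplit : ∀ p ∈ Finset.range (N + 2) ×ˢ Finset.range (r + 1),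
        (P p.1).coeff p.2 * PowerSeries.coeff (n + t - p.2) (mahlerSeq hq0 f p.1) =
        (P p.1).coeff p.2 * (if p.1 = 1 ∧ p.2 ≤ t then 0 else
          PowerSeries.coeff (n + t - p.2) (mahlerSeq hq0 f p.1)) +
        (if p = (1, t) then (P 1).coeff t * PowerSeries.coeff n f else 0) := by
      rintro ⟨i, s⟩ -
      dsimp only
      by_cases h : i = 1 ∧ s ≤ t
      · obtain ⟨rfl, hs⟩ := h
        rcases hs.lt_or_eq with hs | rfl
        · rw [Polynomial.coeff_eq_zero_of_lt_natTrailingDegree hs]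
          simp [hs.ne]
        · simp [mahlerSeq_one]
      · rw [if_neg h, if_neg, add_zero]
        rintro ⟨⟩
        exact h ⟨rfl, le_rfl⟩
    rw [Finset.sum_congr rfl hsplit, Finset.sum_add_distrib, Finset.sum_ite_eq',
      if_pos (by simp; omega)] at hc
    have hfin : PowerSeries.coeff n f = -((P 1).coeff t)⁻¹ *
        ∑ p ∈ Finset.range (N + 2) ×ˢ Finset.range (r + 1),
        (P p.1).coeff p.2 * (if p.1 = 1 ∧ p.2 ≤ t then 0 else
          PowerSeries.coeff (n + t - p.2) (mahlerSeq hq0 f p.1)) := by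
      rw [eq_neg_of_add_eq_zero_left hc]
      field_simp
    rw [hfin, Finset.mul_sum]
    refine Finset.sum_congr rfl fun p _ => ?_
    dsimp only
    rw [div_eq_mul_inv]
    ring

end Recurrence

lemma IsConv.of_geometric {u : PowerSeries ℂ} {B W : ℝ} (hW : 1 ≤ W)
    (h : ∀ n, ‖PowerSeries.coeff n u‖ ≤ B * W ^ n) : IsConv (1 / (2 * W)) u := by
  refine Summable.of_nonneg_of_le (fun n => by positivity) (fun n => ?_)
    (summable_geometric_two.mul_left B)
  calc ‖PowerSeries.coeff n u‖ * (1 / (2 * W)) ^ n ≤ B * W ^ n * (1 / (2 * W)) ^ n := by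
        gcongr
        exact h n
    _ = B * (1 / 2) ^ n := by
        rw [mul_assoc, ← mul_pow]
        congr 2
        field_simp

lemma exists_isConv_mahlerSeq {q : ℕ} {hq0 : q ≠ 0} {f : PowerSeries ℂ} (hq : 2 ≤ q) {N : ℕ}
    {P : ℕ → Polynomial ℂ} (h1 : P 1 ≠ 0)
    (hsum : ∑ i ∈ Finset.range (N + 2), (P i : PowerSeries ℂ) * mahlerSeq hq0 f i = 0) :
    ∃ ρ : ℝ, 0 < ρ ∧ ρ < 1 ∧ ∀ i, IsConv ρ (mahlerSeq hq0 f i) := by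
  obtain ⟨M, T, w, hrec⟩ := exists_recurrence hq h1 hsum
  set W := 1 + ∑ p ∈ T, ‖w p‖
  set B := ∑ m ∈ Finset.range (M + 1), ‖PowerSeries.coeff m f‖
  have hW0 : 0 ≤ ∑ p ∈ T, ‖w p‖ := Finset.sum_nonneg fun _ _ => norm_nonneg _
  have hW : 1 ≤ W := by simp only [W]; linarith
  have hB : 0 ≤ B := Finset.sum_nonneg fun _ _ => norm_nonneg _
  have hgrow : ∀ n, ‖PowerSeries.coeff n f‖ ≤ B * W ^ n := by
    intro n
    induction n using Nat.strong_induction_on with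
    | _ n ih =>
      rcases Nat.lt_or_ge M n with hn | hn
      · obtain ⟨x, hx, hxn⟩ := hrec n hn
        have hxb : ∀ p ∈ T, ‖x p‖ ≤ B * W ^ (n - 1) := by
          intro p hp
          rcases hx p hp with h | ⟨m, hm, h⟩
          · rw [h, norm_zero]; positivity
          · rw [h]
            refine (ih m hm).trans ?_
            gcongr
            omega
        calc ‖PowerSeries.coeff n f‖ ≤ ∑ p ∈ T, ‖w p * x p‖ := by
              rw [hxn]; exact norm_sum_le _ _
          _ ≤ ∑ p ∈ T, ‖w p‖ * (B * W ^ (n - 1)) := by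
              refine Finset.sum_le_sum fun p hp => ?_
              rw [norm_mul]
              exact mul_le_mul_of_nonneg_left (hxb p hp) (norm_nonneg _)
          _ = (∑ p ∈ T, ‖w p‖) * (B * W ^ (n - 1)) :=
              (Finset.sum_mul _ _ _).symm
          _ ≤ W * (B * W ^ (n - 1)) := by
              gcongr
              simp only [W]; linarith
          _ = B * W ^ n := by
              obtain ⟨k, rfl⟩ : ∃ k, n = k + 1 := ⟨n - 1, by omega⟩
              rw [Nat.add_sub_cancel]; ring
      · have h2 : ‖PowerSeries.coeff n f‖ ≤ B := Finset.single_le_sum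
          (f := fun m => ‖PowerSeries.coeff m f‖) (fun _ _ => norm_nonneg _)
          (Finset.mem_range.2 (by omega))
        exact h2.trans (le_mul_of_one_le_right hB (one_le_pow₀ hW))
  have hρ : (0 : ℝ) < 1 / (2 * W) := by positivity
  have hρ1 : 1 / (2 * W) < 1 := by
    rw [div_lt_one (by positivity)]; linarith
  refine ⟨1 / (2 * W), hρ, hρ1, fun i => ?_⟩
  cases i with
  | zero => simpa [mahlerSeq] using isConv_coe (1 / (2 * W)) 1
  | succ i => exact (IsConv.of_geometric hW hgrow).expand hρ.le hρ1.le _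

/-- A Mahler function with algebraic coefficients is defined over a number field. -/
lemma IsMahler.exists_intermediateField {L : Type*} [Field L] [CharZero L]
    [Algebra.IsAlgebraic ℚ L] {q : ℕ} {hq0 : q ≠ 0} (hq : 2 ≤ q) {f : PowerSeries L}
    (hf : IsMahler hq0 f) (a v : L) :
    ∃ (K : IntermediateField ℚ L) (g : PowerSeries K), FiniteDimensional ℚ K ∧
      PowerSeries.map (algebraMap K L) g = f ∧ IsMahler hq0 g ∧ a ∈ K ∧ v ∈ K := by
  obtain ⟨N, P, hP⟩ := hf.exists_minimalRelation
  obtain ⟨M, T, w, hrec⟩ := exists_recurrence hq hP.first_ne_zero hP.sum_eq_zero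
  let S : Finset L := T.image w ∪ (Finset.range (M + 1)).image (fun m => PowerSeries.coeff m f) ∪
    (Finset.range (N + 2)).biUnion (fun i => (P i).coeffs) ∪ {a, v}
  let K : IntermediateField ℚ L := IntermediateField.adjoin ℚ (S : Set L)
  have hS : ∀ x ∈ S, x ∈ K := fun x hx => IntermediateField.subset_adjoin ℚ _ hx
  have hfin : FiniteDimensional ℚ K := IntermediateField.finiteDimensional_adjoin fun x _ =>
    (Algebra.IsAlgebraic.isAlgebraic x).isIntegral
  have hcoeff : ∀ n, PowerSeries.coeff n f ∈ K := by
    intro n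
    induction n using Nat.strong_induction_on with
    | _ n ih =>
      rcases Nat.lt_or_ge M n with hn | hn
      · obtain ⟨x, hx, hxn⟩ := hrec n hn
        rw [hxn]
        refine sum_mem fun p hp => mul_mem (hS _ ?_) ?_
        · simp only [S, Finset.mem_union]
          exact Or.inl (Or.inl (Or.inl (Finset.mem_image_of_mem w hp)))
        · rcases hx p hp with h | ⟨m, hm, h⟩
          · rw [h]; exact zero_mem K
          · rw [h]; exact ih m hm
      · apply hS
        simp only [S, Finset.mem_union]
        exact Or.inl (Or.inl (Or.inr (Finset.mem_image_of_mem _ (Finset.mem_range.2 (by omega)))))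
  have hPl : ∀ i, ∃ Q : Polynomial K, i < N + 2 → Q.map (algebraMap K L) = P i := by
    intro i
    by_cases hi : i < N + 2
    · have : P i ∈ Polynomial.lifts (algebraMap K L) := by
        rw [Polynomial.lifts_iff_coeffs_subset_range]
        intro x hx
        have hxK : x ∈ K := hS x (by
          simp only [S, Finset.mem_union]
          exact Or.inl (Or.inr (Finset.mem_biUnion.2 ⟨i, Finset.mem_range.2 hi, hx⟩)))
        exact ⟨⟨x, hxK⟩, rfl⟩
      obtain ⟨Q, hQ⟩ := (Polynomial.mem_lifts _).1 this
      exact ⟨Q, fun _ => hQ⟩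
    · exact ⟨0, fun h => absurd h hi⟩
  choose Q hQ using hPl
  let g : PowerSeries K := PowerSeries.mk fun n => ⟨PowerSeries.coeff n f, hcoeff n⟩
  have hg : PowerSeries.map (algebraMap K L) g = f := by
    ext n
    rw [PowerSeries.coeff_map, PowerSeries.coeff_mk]
    rfl
  refine ⟨K, g, hfin, hg, ?_, hS a (by simp [S]), hS v (by simp [S])⟩
  refine isMahler_of_sum_eq_zero (N := N + 2) (P := Q) (i := 1) ?_ (by omega) ?_
  · apply PowerSeries.map_injective _ (algebraMap K L).injective
    rw [map_sum, map_zero, ← hP.sum_eq_zero]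
    refine Finset.sum_congr rfl fun i hi => ?_
    rw [map_mul, map_mahlerSeq, hg, ← Polynomial.polynomial_map_coe, hQ i (Finset.mem_range.1 hi)]
  · intro h0
    apply hP.first_ne_zero
    rw [← hQ 1 (by omega), h0, Polynomial.map_zero]

section Continuation

open Filter Topology

lemma MeromorphicOn.eventuallyEq_nhdsNE_of_eventuallyEq {F G : ℂ → ℂ} {R : ℝ}
    (hF : MeromorphicOn F (Metric.ball 0 R)) (hG : MeromorphicOn G (Metric.ball 0 R))
    (h : F =ᶠ[𝓝[≠] 0] G) {z : ℂ} (hz : ‖z‖ < R) : F =ᶠ[𝓝[≠] z] G := by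
  have hR : (0 : ℂ) ∈ Metric.ball (0 : ℂ) R := by
    simpa using (norm_nonneg z).trans_lt hz
  have hz' : z ∈ Metric.ball (0 : ℂ) R := by simpa using hz
  have h0 : meromorphicOrderAt (F - G) 0 = ⊤ :=
    meromorphicOrderAt_eq_top_iff.2 (h.mono fun w hw => by simp [hw])
  have h1 : meromorphicOrderAt (F - G) z = ⊤ := by
    by_contra hne
    exact (hF.sub hG).meromorphicOrderAt_ne_top_of_isPreconnected
      (convex_ball (0 : ℂ) R).isPreconnected hz' hR hne h0
  exact (meromorphicOrderAt_eq_top_iff.1 h1).mono fun w hw => sub_eq_zero.1 hw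

lemma MeromorphicNFOn.eq_of_eventuallyEq {F G : ℂ → ℂ} {R : ℝ}
    (hF : MeromorphicNFOn F (Metric.ball 0 R)) (hG : MeromorphicNFOn G (Metric.ball 0 R))
    (h : F =ᶠ[𝓝[≠] 0] G) {z : ℂ} (hz : ‖z‖ < R) : F z = G z := by
  have hz' : z ∈ Metric.ball (0 : ℂ) R := by simpa using hz
  exact (((hF hz').eventuallyEq_nhdsNE_iff_eventuallyEq_nhds (hG hz')).1
    (hF.meromorphicOn.eventuallyEq_nhdsNE_of_eventuallyEq hG.meromorphicOn h hz)).eq_of_nhds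

/-- A germ that extends meromorphically to every smaller disk extends to the unit disk. -/
lemma exists_meromorphicNFOn_of_forall_lt {g : ℂ → ℂ} (hg : AnalyticAt ℂ g 0)
    (h : ∀ R : ℝ, 0 < R → R < 1 → ∃ G, MeromorphicOn G (Metric.ball 0 R) ∧ G =ᶠ[𝓝[≠] 0] g) :
    ∃ F, MeromorphicNFOn F (Metric.ball 0 1) ∧ F =ᶠ[𝓝 0] g := by
  have h' : ∀ R : ℝ, ∃ G, 0 < R → R < 1 →
      MeromorphicNFOn G (Metric.ball 0 R) ∧ G =ᶠ[𝓝[≠] 0] g := by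
    intro R
    by_cases hR : 0 < R ∧ R < 1
    · obtain ⟨G, hG, hGg⟩ := h R hR.1 hR.2
      exact ⟨toMeromorphicNFOn G (Metric.ball 0 R), fun _ _ =>
        ⟨meromorphicNFOn_toMeromorphicNFOn _ _,
          (hG.toMeromorphicNFOn_eq_self_on_nhdsNE (by simpa using hR.1)).trans hGg⟩⟩
    · exact ⟨0, fun h1 h2 => absurd ⟨h1, h2⟩ hR⟩
  choose G hG using h'
  have heq : ∀ R z, ‖z‖ < R → R < 1 → G ((1 + ‖z‖) / 2) z = G R z := by
    intro R z hz hR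
    have hz0 := norm_nonneg z
    obtain ⟨h1, h2⟩ := hG ((1 + ‖z‖) / 2) (by linarith) (by linarith)
    obtain ⟨h3, h4⟩ := hG R (by linarith) hR
    have hle1 : Metric.ball (0 : ℂ) (min ((1 + ‖z‖) / 2) R) ⊆ Metric.ball 0 ((1 + ‖z‖) / 2) :=
      Metric.ball_subset_ball (min_le_left _ _)
    have hle2 : Metric.ball (0 : ℂ) (min ((1 + ‖z‖) / 2) R) ⊆ Metric.ball 0 R :=
      Metric.ball_subset_ball (min_le_right _ _)
    exact MeromorphicNFOn.eq_of_eventuallyEq (fun w hw => h1 (hle1 hw)) (fun w hw => h3 (hle2 hw))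
      (h2.trans h4.symm) (lt_min (by linarith) hz)
  have hloc : ∀ z : ℂ, ‖z‖ < 1 →
      (fun w : ℂ => G ((1 + ‖w‖) / 2) w) =ᶠ[𝓝 z] G ((1 + ‖z‖) / 2) := by
    intro z hz
    have hopen : IsOpen {w : ℂ | ‖w‖ < (1 + ‖z‖) / 2} := isOpen_lt continuous_norm continuous_const
    filter_upwards [hopen.mem_nhds (show ‖z‖ < (1 + ‖z‖) / 2 by linarith)] with w hw
    exact heq _ w hw (by linarith)
  have hNF : ∀ z : ℂ, ‖z‖ < 1 → MeromorphicNFAt (fun w : ℂ => G ((1 + ‖w‖) / 2) w) z := by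
    intro z hz
    rw [meromorphicNFAt_congr (hloc z hz)]
    have hz0 := norm_nonneg z
    refine (hG ((1 + ‖z‖) / 2) (by linarith) (by linarith)).1 ?_
    simp only [Metric.mem_ball, dist_zero_right]
    linarith
  refine ⟨fun w => G ((1 + ‖w‖) / 2) w, fun z hz => hNF z (by simpa using hz), ?_⟩
  rw [← (hNF 0 (by simp)).eventuallyEq_nhdsNE_iff_eventuallyEq_nhds hg.meromorphicNFAt]
  exact ((hloc 0 (by simp)).filter_mono nhdsWithin_le_nhds).trans
    (hG _ (by simp) (by norm_num)).2

lemma Polynomial.eventually_nhdsNE_eval_ne_zero {p : Polynomial ℂ} (hp : p ≠ 0) (x : ℂ) :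
    ∀ᶠ z in 𝓝[≠] x, p.eval z ≠ 0 := by
  have hfin : {z | p.IsRoot z}.Finite := Polynomial.finite_setOfPred_isRoot hp
  have h := (hfin.subset Set.sdiff_subset : ({z | p.IsRoot z} \ {x}).Finite).isClosed
  have hmem : ({z | p.IsRoot z} \ {x})ᶜ ∈ 𝓝 x := h.isOpen_compl.mem_nhds (by simp)
  filter_upwards [mem_nhdsWithin_of_mem_nhds hmem, self_mem_nhdsWithin] with z hz hzx h0
  exact hz ⟨h0, hzx⟩

lemma IsConv.analyticAt_psEval {ρ : ℝ} {u : PowerSeries ℂ} (hu : IsConv ρ u) {z : ℂ}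
    (hz : ‖z‖ < ρ) : AnalyticAt ℂ (psEval u) z := by
  have hd : DifferentiableOn ℂ (psEval u) (Metric.ball 0 ρ) := by
    refine Complex.differentiableOn_tsum_of_summable_norm hu (fun n => by fun_prop)
      Metric.isOpen_ball fun n w hw => ?_
    rw [norm_mul, norm_pow]
    have : ‖w‖ ≤ ρ := by simpa using (Metric.mem_ball.1 hw).le
    gcongr
  exact hd.analyticAt (Metric.isOpen_ball.mem_nhds (by simpa using hz))

section Functional

variable {ι : Type*} [Fintype ι] {Q : ℕ} {hQ : Q ≠ 0} {D : Polynomial ℂ} {A : ι → Polynomial ℂ}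
  {f : PowerSeries ℂ} {y : ι → PowerSeries ℂ} {ρ : ℝ}

/-- The function `∑ A_m(z) y_m(z^Q)`. -/
def sumEval (Q : ℕ) (A : ι → Polynomial ℂ) (y : ι → PowerSeries ℂ) (z : ℂ) : ℂ :=
  ∑ m, (A m).eval z * psEval (y m) (z ^ Q)

lemma analyticAt_sumEval (hconv : ∀ m, IsConv ρ (y m)) {z : ℂ} (hz : ‖z ^ Q‖ < ρ) :
    AnalyticAt ℂ (sumEval Q A y) z := by
  refine Finset.analyticAt_fun_sum _ fun m _ => AnalyticAt.mul ?_ ?_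
  · exact (A m).differentiable.analyticAt z
  · exact AnalyticAt.fun_comp (g := psEval (y m)) (f := fun w : ℂ => w ^ Q)
      ((hconv m).analyticAt_psEval hz) (analyticAt_id.pow Q)

lemma eval_mul_psEval_eq_sumEval (hρ : 0 ≤ ρ) (hρ1 : ρ ≤ 1) (hf : IsConv ρ f)
    (hconv : ∀ m, IsConv ρ (y m))
    (h : (D : PowerSeries ℂ) * f = ∑ m, (A m : PowerSeries ℂ) * PowerSeries.expand Q hQ (y m))
    {z : ℂ} (hz : ‖z‖ ≤ ρ) : D.eval z * psEval f z = sumEval Q A y z := by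
  have hexp : ∀ m, IsConv ρ (PowerSeries.expand Q hQ (y m)) := fun m =>
    (hconv m).expand hρ hρ1 hQ
  rw [← psEval_coe_mul D hf hz, h, psEval_sum hρ (fun m _ => (isConv_coe ρ _).mul hρ (hexp m)) hz]
  refine Finset.sum_congr rfl fun m _ => ?_
  rw [psEval_coe_mul _ (hexp m) hz, psEval_expand]

lemma norm_lt_rpow_inv_iff (hQ : Q ≠ 0) (hρ : 0 ≤ ρ) (z : ℂ) :
    ‖z‖ < ρ ^ (Q : ℝ)⁻¹ ↔ ‖z ^ Q‖ < ρ := by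
  rw [Real.lt_rpow_inv_iff_of_pos (norm_nonneg z) hρ (by positivity), Real.rpow_natCast, norm_pow]

lemma eventually_norm_le (hρ : 0 < ρ) : ∀ᶠ z : ℂ in 𝓝 0, ‖z‖ ≤ ρ := by
  filter_upwards [Metric.ball_mem_nhds (0 : ℂ) hρ] with z hz
  simpa using (Metric.mem_ball.1 hz).le

lemma eval_mul_eventuallyEq_sumEval (hρ : 0 < ρ) (hρ1 : ρ ≤ 1) (hf : IsConv ρ f)
    (hconv : ∀ m, IsConv ρ (y m))
    (h : (D : PowerSeries ℂ) * f = ∑ m, (A m : PowerSeries ℂ) * PowerSeries.expand Q hQ (y m))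
    {F : ℂ → ℂ} (hF : MeromorphicOn F (Metric.ball 0 1)) (hFf : F =ᶠ[𝓝 0] psEval f)
    {z : ℂ} (hz : ‖z ^ Q‖ < ρ) : (fun w => D.eval w * F w) =ᶠ[𝓝[≠] z] sumEval Q A y := by
  have hR1 : ρ ^ (Q : ℝ)⁻¹ ≤ 1 := Real.rpow_le_one hρ.le hρ1 (by positivity)
  refine MeromorphicOn.eventuallyEq_nhdsNE_of_eventuallyEq (R := ρ ^ (Q : ℝ)⁻¹) ?_ ?_ ?_
    ((norm_lt_rpow_inv_iff hQ hρ.le z).2 hz)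
  · intro w hw
    exact (D.differentiable.analyticAt w).meromorphicAt.fun_mul
      (hF w (Metric.ball_subset_ball hR1 hw))
  · intro w hw
    refine (analyticAt_sumEval hconv ?_).meromorphicAt
    exact (norm_lt_rpow_inv_iff hQ hρ.le w).1 (by simpa using hw)
  · refine Filter.EventuallyEq.filter_mono ?_ nhdsWithin_le_nhds
    filter_upwards [hFf, eventually_norm_le hρ] with w hw hw'
    rw [hw, eval_mul_psEval_eq_sumEval hρ.le hρ1 hf hconv h hw']

lemma exists_meromorphicOn_ball (hρ : 0 < ρ) (hρ1 : ρ ≤ 1) (hf : IsConv ρ f)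
    (hconv : ∀ m, IsConv ρ (y m)) (hD : D ≠ 0)
    (h : (D : PowerSeries ℂ) * f = ∑ m, (A m : PowerSeries ℂ) * PowerSeries.expand Q hQ (y m))
    {R : ℝ} (hRρ : R ^ Q ≤ ρ) :
    ∃ G, MeromorphicOn G (Metric.ball 0 R) ∧ G =ᶠ[𝓝[≠] 0] psEval f := by
  refine ⟨fun z => sumEval Q A y z / D.eval z, fun z hz => ?_, ?_⟩
  · refine MeromorphicAt.fun_div (analyticAt_sumEval hconv ?_).meromorphicAt
      (D.differentiable.analyticAt z).meromorphicAt
    have hz' : ‖z‖ < R := by simpa using hz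
    rw [norm_pow]
    exact (pow_lt_pow_left₀ hz' (norm_nonneg z) hQ).trans_le hRρ
  · filter_upwards [D.eventually_nhdsNE_eval_ne_zero hD 0,
      mem_nhdsWithin_of_mem_nhds (eventually_norm_le hρ)] with z hz hz'
    rw [← eval_mul_psEval_eq_sumEval hρ.le hρ1 hf hconv h hz', mul_div_cancel_left₀ _ hz]

end Functional

end Continuation

section Transfer

open Filter Topology

lemma tendsto_pow_pow_nhds_zero {q : ℕ} (hq : 2 ≤ q) {z : ℂ} (hz : ‖z‖ < 1) :
    Tendsto (fun k : ℕ => z ^ q ^ k) atTop (𝓝 0) :=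
  (tendsto_pow_atTop_nhds_zero_of_norm_lt_one hz).comp
    (tendsto_pow_atTop_atTop_of_one_lt (by omega))

variable {K : Type*} [Field K] {q : ℕ} {hq0 : q ≠ 0} {f : PowerSeries K}

lemma eventually_eval_pow_pow_ne_zero (ψ : K →+* ℂ) (hq : 2 ≤ q) {a : K} (ha : a ≠ 0)
    (ha1 : ‖ψ a‖ < 1) {p : Polynomial K} (hp : p ≠ 0) :
    ∀ᶠ k in atTop, p.eval (a ^ q ^ k) ≠ 0 := by
  have hp' : p.map ψ ≠ 0 := (Polynomial.map_ne_zero_iff ψ.injective).2 hp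
  have htend : Tendsto (fun k : ℕ => ψ a ^ q ^ k) atTop (𝓝[≠] 0) :=
    tendsto_nhdsWithin_iff.2 ⟨tendsto_pow_pow_nhds_zero hq ha1, Eventually.of_forall fun k =>
      pow_ne_zero _ ((map_ne_zero ψ).2 ha)⟩
  filter_upwards [htend.eventually ((p.map ψ).eventually_nhdsNE_eval_ne_zero hp' 0)] with k hk h0
  apply hk
  rw [← map_pow, Polynomial.eval_map, Polynomial.eval₂_hom, h0, map_zero]

lemma exists_eval_ne_zero_of_relation {ι : Type*} [Fintype ι] (a : K) (w : ι → PowerSeries K)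
    (D : Polynomial K) (A : ι → Polynomial K) (hD : D ≠ 0)
    (h : (D : PowerSeries K) * f = ∑ m, (A m : PowerSeries K) * w m) :
    ∃ (D' : Polynomial K) (A' : ι → Polynomial K), D' ≠ 0 ∧
      (D' : PowerSeries K) * f = ∑ m, (A' m : PowerSeries K) * w m ∧
      (D'.eval a ≠ 0 ∨ ∃ m, (A' m).eval a ≠ 0) := by
  induction hn : D.natDegree using Nat.strong_induction_on generalizing D A with
  | _ n ih =>
    by_cases hne : D.eval a ≠ 0 ∨ ∃ m, (A m).eval a ≠ 0
    · exact ⟨D, A, hD, h, hne⟩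
    push Not at hne
    obtain ⟨D₁, hD₁⟩ := Polynomial.dvd_iff_isRoot.2 hne.1
    choose A₁ hA₁ using fun m => Polynomial.dvd_iff_isRoot.2 (hne.2 m)
    have hD₁0 : D₁ ≠ 0 := by
      rintro rfl
      exact hD (by rw [hD₁, mul_zero])
    refine ih D₁.natDegree ?_ D₁ A₁ hD₁0 ?_ rfl
    · rw [← hn, hD₁, Polynomial.natDegree_mul (Polynomial.X_sub_C_ne_zero a) hD₁0,
        Polynomial.natDegree_X_sub_C]
      omega
    · have hX : ((Polynomial.X - Polynomial.C a : Polynomial K) : PowerSeries K) ≠ 0 := by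
        rw [Ne, Polynomial.coe_eq_zero_iff]
        exact Polynomial.X_sub_C_ne_zero a
      apply mul_left_cancel₀ hX
      rw [← mul_assoc, ← Polynomial.coe_mul, ← hD₁, h, Finset.mul_sum]
      refine Finset.sum_congr rfl fun m _ => ?_
      rw [← mul_assoc, ← Polynomial.coe_mul, ← hA₁]

lemma map_relation {ι : Type*} [Fintype ι] (ψ : K →+* ℂ) {Q : ℕ} {hQ : Q ≠ 0}
    {y : ι → PowerSeries K} {D : Polynomial K} {A : ι → Polynomial K}
    (h : (D : PowerSeries K) * f = ∑ m, (A m : PowerSeries K) * PowerSeries.expand Q hQ (y m)) :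
    ((D.map ψ : Polynomial ℂ) : PowerSeries ℂ) * PowerSeries.map ψ f =
      ∑ m, (((A m).map ψ : Polynomial ℂ) : PowerSeries ℂ) *
        PowerSeries.expand Q hQ (PowerSeries.map ψ (y m)) := by
  have := congrArg (PowerSeries.map ψ) h
  simpa only [map_mul, map_sum, PowerSeries.map_expand, ← Polynomial.polynomial_map_coe] using this

lemma MinimalRelation.exists_isConv {N : ℕ} {P : ℕ → Polynomial K} (hq : 2 ≤ q)
    (h : MinimalRelation hq0 f N P) (ψ : K →+* ℂ) :
    ∃ ρ : ℝ, 0 < ρ ∧ ρ < 1 ∧ ∀ i, IsConv ρ (PowerSeries.map ψ (mahlerSeq hq0 f i)) := by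
  simp only [map_mahlerSeq]
  refine exists_isConv_mahlerSeq hq (N := N) (P := fun i => (P i).map ψ)
    ((Polynomial.map_ne_zero_iff ψ.injective).2 h.first_ne_zero) ?_
  have := congrArg (PowerSeries.map ψ) h.sum_eq_zero
  simpa only [map_mul, map_sum, map_zero, map_mahlerSeq, ← Polynomial.polynomial_map_coe] using this

lemma sumEval_map {ι : Type*} [Fintype ι] (ψ : K →+* ℂ) (Q : ℕ) (A : ι → Polynomial K)
    (y : ι → PowerSeries ℂ) (a : K) :
    sumEval Q (fun m => (A m).map ψ) y (ψ a) = ∑ m, ψ ((A m).eval a) * psEval (y m) (ψ (a ^ Q)) := by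
  simp only [sumEval, Polynomial.eval_map, Polynomial.eval₂_hom, map_pow]

/-- A Mahler function extends meromorphically to the unit disk. -/
lemma MinimalRelation.exists_meromorphicNFOn {N : ℕ} {P : ℕ → Polynomial K} (hq : 2 ≤ q)
    (h : MinimalRelation hq0 f N P) (ψ : K →+* ℂ) :
    ∃ F, MeromorphicNFOn F (Metric.ball 0 1) ∧ F =ᶠ[𝓝 0] psEval (PowerSeries.map ψ f) := by
  obtain ⟨ρ, hρ, hρ1, hconv⟩ := h.exists_isConv hq ψ
  have hf : IsConv ρ (PowerSeries.map ψ f) := by simpa only [mahlerSeq_one] using hconv 1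
  refine exists_meromorphicNFOn_of_forall_lt (hf.analyticAt_psEval (by simpa using hρ))
    fun R hR hR1 => ?_
  have htend : Tendsto (fun k : ℕ => R ^ q ^ k) atTop (𝓝 0) :=
    (tendsto_pow_atTop_nhds_zero_of_lt_one hR.le hR1).comp
      (tendsto_pow_atTop_atTop_of_one_lt (by omega))
  obtain ⟨k, hk⟩ := (((tendsto_add_atTop_iff_nat 1).2 htend).eventually (Iic_mem_nhds hρ)).exists
  obtain ⟨D, A, hD, hDA⟩ := h.exists_iterate k
  exact exists_meromorphicOn_ball hρ hρ1.le hf (fun m : Fin (N + 1) => hconv m)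
    ((Polynomial.map_ne_zero_iff ψ.injective).2 hD) (map_relation ψ hDA) hk

lemma sum_mul_psEval_mahlerSeq_of_succ_eq_zero (ψ : K →+* ℂ) {N : ℕ} {r : Fin (N + 1) → K}
    (hr : ∀ m, m ≠ 0 → r m = 0) (z : ℂ) :
    ∑ m, ψ (r m) * psEval (PowerSeries.map ψ (mahlerSeq hq0 f m)) z = ψ (r 0) := by
  rw [Finset.sum_eq_single 0 (fun m _ hm => by simp [hr m hm]) (by simp)]
  have : psEval (PowerSeries.map ψ (mahlerSeq hq0 f 0)) z = 1 := by
    simpa [mahlerSeq] using psEval_coe 1 z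
  simp [this]

/-- Equality of the value of a Mahler function with an element of the field of coefficients does
not depend on the complex embedding. -/
theorem IsMahler.mahlerValue_map [NumberField K] (hq : 2 ≤ q) (hf : IsMahler hq0 f)
    (ψ ψ' : K →+* ℂ) {a v : K} (ha : a ≠ 0) (h1 : ‖ψ a‖ < 1) (h1' : ‖ψ' a‖ < 1)
    (hv : MahlerValue (PowerSeries.map ψ f) (ψ a) (ψ v)) :
    MahlerValue (PowerSeries.map ψ' f) (ψ' a) (ψ' v) := by
  obtain ⟨N, P, hP⟩ := hf.exists_minimalRelation
  obtain ⟨ρ, hρ, hρ1, hconv⟩ := hP.exists_isConv hq ψ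
  obtain ⟨ρ', hρ', hρ1', hconv'⟩ := hP.exists_isConv hq ψ'
  have hfc : IsConv ρ (PowerSeries.map ψ f) := by simpa only [mahlerSeq_one] using hconv 1
  have hfc' : IsConv ρ' (PowerSeries.map ψ' f) := by simpa only [mahlerSeq_one] using hconv' 1
  have hsmall : ∀ (φ : K →+* ℂ) {r : ℝ}, 0 < r → ‖φ a‖ < 1 →
      ∀ᶠ k : ℕ in atTop, ‖φ a ^ q ^ k‖ < r := fun φ r hr hφ => by
    filter_upwards [(tendsto_pow_pow_nhds_zero hq hφ).eventually (Metric.ball_mem_nhds 0 hr)]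
      with k hk
    simpa using hk
  obtain ⟨k, hk⟩ := eventually_atTop.1 ((hsmall ψ hρ h1).and ((hsmall ψ' hρ' h1').and
    ((eventually_eval_pow_pow_ne_zero ψ hq ha h1 hP.first_ne_zero).and
      (eventually_eval_pow_pow_ne_zero ψ hq ha h1 hP.last_ne_zero))))
  obtain ⟨hkρ, hkρ', -⟩ := hk (k + 1) k.le_succ
  obtain ⟨D₀, A₀, hD₀, hDA₀⟩ := hP.exists_iterate k
  obtain ⟨D, A, hD, hDA, hne⟩ := exists_eval_ne_zero_of_relation a _ D₀ A₀ hD₀ hDA₀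
  have hpow : ∀ j, (a ^ q ^ (k + 1)) ^ q ^ j = a ^ q ^ (k + 1 + j) := fun j => by
    rw [← pow_mul, ← pow_add]
  choose c hc using hP.forward
  choose d hd using hP.backward
  obtain ⟨F, hF, hFsum, hFan, hFv⟩ := hv
  have hFf : F =ᶠ[𝓝 0] psEval (PowerSeries.map ψ f) := hFsum.mono fun z hz => hz.tsum_eq.symm
  have hanal := analyticAt_sumEval (A := fun m => (A m).map ψ)
    (fun m : Fin (N + 1) => hconv m) hkρ
  have heq : (D.map ψ).eval (ψ a) * F (ψ a) = _ :=
    ((((D.map ψ).differentiable.analyticAt (ψ a)).fun_mul hFan).continuousAt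
      |>.eventuallyEq_nhds_iff_eventuallyEq_nhdsNE hanal.continuousAt |>.1
      (eval_mul_eventuallyEq_sumEval hρ hρ1.le hfc (fun m : Fin (N + 1) => hconv m)
        (map_relation ψ hDA) hF hFf hkρ)).eq_of_nhds
  rw [sumEval_map, hFv, Polynomial.eval_map, Polynomial.eval₂_hom] at heq
  have hr := eq_zero_of_sum_mul_psEval_eq_zero ψ hq hq0 hP.linearIndependent hc hd hρ1
    (fun m => hconv m) (pow_ne_zero (q ^ (k + 1)) ha) (by rw [map_pow]; exact hkρ.le)
    (fun j => by rw [hpow]; exact (hk _ (by omega)).2.2.2)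
    (fun j => by rw [hpow]; exact (hk _ (by omega)).2.2.1)
    (r₀ := fun m => (A m).eval a - if m = 0 then v * D.eval a else 0) (by
      simp only [map_sub, sub_mul, Finset.sum_sub_distrib]
      rw [← heq, sum_mul_psEval_mahlerSeq_of_succ_eq_zero ψ (r := fun m : Fin (N + 1) =>
        if m = 0 then v * D.eval a else 0) (fun m hm => if_neg hm)]
      simp [mul_comm])
  have hA0 : (A 0).eval a = v * D.eval a := by
    simpa [sub_eq_zero] using congrFun hr 0
  have hA : ∀ m, m ≠ 0 → (A m).eval a = 0 := fun m hm => by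
    simpa [hm] using congrFun hr m
  have hDa : D.eval a ≠ 0 := by
    rcases hne with h | ⟨m, hm⟩
    · exact h
    · rintro h0
      rcases eq_or_ne m 0 with rfl | hm0
      · exact hm (by rw [hA0, h0, mul_zero])
      · exact hm (hA m hm0)
  have hDa' : (D.map ψ').eval (ψ' a) ≠ 0 := by
    rw [Polynomial.eval_map, Polynomial.eval₂_hom]
    exact (map_ne_zero ψ').2 hDa
  obtain ⟨F', hF', hFf'⟩ := hP.exists_meromorphicNFOn hq ψ'
  have hquot : AnalyticAt ℂ (fun z => sumEval (q ^ (k + 1)) (fun m => (A m).map ψ')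
      (fun m : Fin (N + 1) => PowerSeries.map ψ' (mahlerSeq hq0 f m)) z / (D.map ψ').eval z)
      (ψ' a) :=
    (analyticAt_sumEval (fun m : Fin (N + 1) => hconv' m) hkρ').fun_div
      ((D.map ψ').differentiable.analyticAt _) hDa'
  have hev : F' =ᶠ[𝓝 (ψ' a)] _ := ((hF' (by simpa using h1'))
    |>.eventuallyEq_nhdsNE_iff_eventuallyEq_nhds hquot.meromorphicNFAt).1 (by
      filter_upwards [eval_mul_eventuallyEq_sumEval hρ' hρ1'.le hfc'
        (fun m : Fin (N + 1) => hconv' m) (map_relation ψ' hDA) hF'.meromorphicOn hFf' hkρ',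
        (D.map ψ').eventually_nhdsNE_eval_ne_zero
          ((Polynomial.map_ne_zero_iff ψ'.injective).2 hD) (ψ' a)] with z hz hz0
      rw [← hz, mul_div_cancel_left₀ _ hz0])
  refine ⟨F', hF'.meromorphicOn, ?_, hquot.congr hev.symm, ?_⟩
  · filter_upwards [hFf', eventually_norm_le hρ'] with z hz hz'
    rw [hz]
    exact hfc'.hasSum hz'
  · rw [hev.eq_of_nhds, sumEval_map, sum_mul_psEval_mahlerSeq_of_succ_eq_zero ψ' hA, hA0, map_mul,
      Polynomial.eval_map, Polynomial.eval₂_hom, mul_div_cancel_right₀ _ ((map_ne_zero ψ').2 hDa)]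

end Transfer

lemma psSigma_eq_expand {q : ℕ} (hq0 : q ≠ 0) (f : PowerSeries ℂ) :
    psSigma q f = PowerSeries.expand q hq0 f := by
  ext n
  rw [psSigma, PowerSeries.coeff_mk, PowerSeries.coeff_expand]

lemma psSigma_iterate {q : ℕ} (hq0 : q ≠ 0) (f : PowerSeries ℂ) (i : ℕ) :
    (psSigma q)^[i] f = mahlerSeq hq0 f (i + 1) := by
  induction i with
  | zero => rw [Function.iterate_zero, id, zero_add, mahlerSeq_one]
  | succ i ih =>
    rw [Function.iterate_succ_apply', ih, psSigma_eq_expand hq0, expand_mahlerSeq_succ]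

/-- An `M_q`-function is a Mahler function over the field of algebraic numbers. -/
lemma IsM.exists_isMahler {q : ℕ} (hq0 : q ≠ 0) {f : PowerSeries ℂ} (hf : IsM q f) :
    ∃ g : PowerSeries (algebraicClosure ℚ ℂ),
      PowerSeries.map (algebraMap (algebraicClosure ℚ ℂ) ℂ) g = f ∧ IsMahler hq0 g := by
  obtain ⟨hfalg, m, p, hp, ⟨i, him, hi⟩, hsum⟩ := hf
  let φ : algebraicClosure ℚ ℂ →+* ℂ := algebraMap (algebraicClosure ℚ ℂ) ℂ
  have hlift : ∀ i, ∃ Q : Polynomial (algebraicClosure ℚ ℂ), Q.map φ = p i := fun i =>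
    (Polynomial.mem_lifts _).1 ((Polynomial.lifts_iff_coeff_lifts _).2 fun k =>
      ⟨⟨(p i).coeff k, mem_algebraicClosure_iff.2 (hp i k)⟩, rfl⟩)
  choose Q hQ using hlift
  let g : PowerSeries (algebraicClosure ℚ ℂ) :=
    PowerSeries.mk fun n => ⟨PowerSeries.coeff n f, mem_algebraicClosure_iff.2 (hfalg n)⟩
  have hg : PowerSeries.map φ g = f := by
    ext n
    rw [PowerSeries.coeff_map, PowerSeries.coeff_mk]
    rfl
  refine ⟨g, hg, isMahler_of_sum_eq_zero (N := m + 2)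
    (P := fun i => if i = 0 then 0 else Q (i - 1)) (i := i + 1) ?_ (by omega) ?_⟩
  · apply PowerSeries.map_injective φ φ.injective
    rw [Finset.sum_range_succ', map_add, map_sum, map_zero, ← hsum]
    simp only [if_true, Polynomial.coe_zero, zero_mul, map_zero, add_zero, Nat.succ_ne_zero,
      if_false, Nat.add_sub_cancel, map_mul, map_mahlerSeq, hg, ← Polynomial.polynomial_map_coe,
      hQ, psSigma_iterate hq0]
    rfl
  · simp only [Nat.succ_ne_zero, if_false, Nat.add_sub_cancel]
    intro h0
    exact hi (by rw [← hQ, h0, Polynomial.map_zero])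

lemma galMap_coe (τ : algebraicClosure ℚ ℂ ≃+* algebraicClosure ℚ ℂ)
    (x : algebraicClosure ℚ ℂ) : galMap τ x = τ x := by
  rw [galMap, dif_pos x.2]

/-- If `f` is an M_q-function, `α` algebraic with `0 < |α| < 1` not a pole
of `f` and `f(α)` algebraic, then for every `τ ∈ Gal(ℚ̄/ℚ)` with `|τ(α)| < 1`, the
M_q-function `f^τ` has no pole at `τ(α)` and `f^τ(τ(α)) = τ(f(α))`. -/
theorem Mq_value_Galois_equivariance
    (q : ℕ) (hq : 2 ≤ q)
    (f : PowerSeries ℂ) (hf : IsM q f)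
    (α : ℂ) (hαalg : IsAlgebraic ℚ α)
    (hα0 : 0 < ‖α‖) (hα1 : ‖α‖ < 1)
    (v : ℂ) (hv : MahlerValue f α v) (hvalg : IsAlgebraic ℚ v)
    (τ : algebraicClosure ℚ ℂ ≃+* algebraicClosure ℚ ℂ)
    (hτα : ‖galMap τ α‖ < 1) :
    MahlerValue (PowerSeries.mk fun n => galMap τ (PowerSeries.coeff n f))
      (galMap τ α) (galMap τ v) := by
  have hq0 : q ≠ 0 := by omega
  obtain ⟨g, rfl, hg⟩ := hf.exists_isMahler hq0
  lift α to algebraicClosure ℚ ℂ using mem_algebraicClosure_iff.2 hαalg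
  lift v to algebraicClosure ℚ ℂ using mem_algebraicClosure_iff.2 hvalg
  have halg : Algebra.IsAlgebraic ℚ (algebraicClosure ℚ ℂ) := algebraicClosure.isAlgebraic ℚ ℂ
  obtain ⟨K, h, hfin, rfl, hh, hα, hv'⟩ := hg.exists_intermediateField hq α v
  have hK : NumberField K := { to_charZero := inferInstance, to_finiteDimensional := hfin }
  let φ : K →+* ℂ := (algebraMap (algebraicClosure ℚ ℂ) ℂ).comp
    (algebraMap K (algebraicClosure ℚ ℂ))
  let φ' : K →+* ℂ := (algebraMap (algebraicClosure ℚ ℂ) ℂ).comp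
    ((τ : algebraicClosure ℚ ℂ →+* algebraicClosure ℚ ℂ).comp
      (algebraMap K (algebraicClosure ℚ ℂ)))
  have hφ' : ∀ x : K, galMap τ ((x : algebraicClosure ℚ ℂ) : ℂ) = φ' x := fun x => galMap_coe τ x
  have hne : (⟨α, hα⟩ : K) ≠ 0 := by
    intro h0
    have : α = 0 := congrArg Subtype.val h0
    simp [this] at hα0
  have hα' : galMap τ α = φ' ⟨α, hα⟩ := hφ' ⟨α, hα⟩
  have hser : (PowerSeries.mk fun n => galMap τ (PowerSeries.coeff n
      (PowerSeries.map (algebraMap (algebraicClosure ℚ ℂ) ℂ)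
        (PowerSeries.map (algebraMap K (algebraicClosure ℚ ℂ)) h)))) = PowerSeries.map φ' h := by
    ext n
    rw [PowerSeries.coeff_mk, PowerSeries.coeff_map, PowerSeries.coeff_map, PowerSeries.coeff_map]
    exact hφ' _
  rw [hser, hα', show galMap τ v = φ' ⟨v, hv'⟩ from hφ' ⟨v, hv'⟩]
  rw [hα'] at hτα
  refine hh.mahlerValue_map hq φ φ' hne hα1 hτα ?_
  rwa [PowerSeries.map_comp, RingHom.comp_apply]
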